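/- arXiv:2405.15147 — 4 statements merged into one kernel-verified Lean document; each statement's English description precedes it below -/
import Mathlib

section
/- For every integer n ≥ 3, the generalized 3-connectivity of the godan graph EA_n equals n − 1, i.e., κ₃(EA_n) = n − 1. -/
namespace Godan

/-- The transposition (12), using 0-based indices 0,1 for symbols 1,2. -/
def perm12 (n : ℕ) (hn : 3 ≤ n) : Equiv.Perm (Fin n) :=
  Equiv.swap ⟨0, by omega⟩ ⟨1, by omega⟩

/-- The 3-cycle (123): symbol 1 ↦ 2 ↦ 3 ↦ 1, i.e. index 0 ↦ 1 ↦ 2 ↦ 0. -/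
def perm123 (n : ℕ) (hn : 3 ≤ n) : Equiv.Perm (Fin n) :=
  Equiv.swap ⟨0, by omega⟩ ⟨2, by omega⟩ * Equiv.swap ⟨0, by omega⟩ ⟨1, by omega⟩

/-- The 3-cycle (132): symbol 1 ↦ 3 ↦ 2 ↦ 1, i.e. index 0 ↦ 2 ↦ 1 ↦ 0. -/
def perm132 (n : ℕ) (hn : 3 ≤ n) : Equiv.Perm (Fin n) :=
  Equiv.swap ⟨0, by omega⟩ ⟨1, by omega⟩ * Equiv.swap ⟨0, by omega⟩ ⟨2, by omega⟩

/-- Ω* = {(12), (123), (132)} ∪ {(12)(3i) : 4 ≤ i ≤ n}; symbol i has index i - 1,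
so the transposition (3i) is `Equiv.swap ⟨2,_⟩ k` with 3 ≤ k = i - 1 ≤ n - 1. -/
def OmegaStar (n : ℕ) (hn : 3 ≤ n) : Set (Equiv.Perm (Fin n)) :=
  {perm12 n hn, perm123 n hn, perm132 n hn} ∪
    {s | ∃ k : Fin n, 3 ≤ (k : ℕ) ∧ s = perm12 n hn * Equiv.swap ⟨2, by omega⟩ k}

/-- The godan graph EA_n: vertices are the permutations of {1,…,n}, and u,v are
adjacent iff u = v ∘ s for some s ∈ Ω* (note `(v * s) i = v (s i)` in Mathlib).
Since Ω* is closed under inverses, `fromRel` yields exactly this adjacency. -/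
def godanGraph (n : ℕ) (hn : 3 ≤ n) : SimpleGraph (Equiv.Perm (Fin n)) :=
  SimpleGraph.fromRel (fun u v => ∃ s ∈ OmegaStar n hn, u = v * s)

/-- `T 0, …, T (r-1)` is a family of r pairwise internally edge disjoint S-trees:
each `T i` is a subgraph of `G` which is a tree containing all vertices of `S`,
and for i ≠ j, `V(T i) ∩ V(T j) = S` and `E(T i) ∩ E(T j) = ∅`. -/
def IsIDSTFamily {V : Type*} (G : SimpleGraph V) (S : Set V) {r : ℕ}
    (T : Fin r → G.Subgraph) : Prop :=
  (∀ i, S ⊆ (T i).verts ∧ ((T i).coe).IsTree) ∧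
    ∀ i j, i ≠ j → (T i).verts ∩ (T j).verts = S ∧ (T i).edgeSet ∩ (T j).edgeSet = ∅

/-- The maximum number of pairwise internally edge disjoint S-trees in G. -/
noncomputable def maxIDST {V : Type*} (G : SimpleGraph V) (S : Set V) : ℕ :=
  sSup {r : ℕ | ∃ T : Fin r → G.Subgraph, IsIDSTFamily G S T}

/-- The generalized k-connectivity κ_k(G): the minimum over all k-element vertex
sets S of the maximum number of pairwise internally edge disjoint S-trees. -/
noncomputable def genConn {V : Type*} [Fintype V] (G : SimpleGraph V) (k : ℕ) : ℕ :=
  sInf {m : ℕ | ∃ S : Finset V, S.card = k ∧ maxIDST G (↑S : Set V) = m}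

section Linkage

variable {V : Type*}

/-- A vertex set is linked in `G` if every bipartition of it is crossed by an edge of `G`. -/
def Linked (G : SimpleGraph V) (C : Set V) : Prop :=
  ∀ U : Set V, (∃ c ∈ C, c ∈ U) → (∃ c ∈ C, c ∉ U) → ∃ u ∈ C, ∃ v ∈ C, u ∈ U ∧ v ∉ U ∧ G.Adj u v

/-- The edges of `G` with both ends in `P`. -/
def within (G : SimpleGraph V) (P : Set V) : SimpleGraph V where
  Adj u v := G.Adj u v ∧ u ∈ P ∧ v ∈ P
  symm := ⟨fun _ _ h => ⟨h.1.symm, h.2.2, h.2.1⟩⟩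
  loopless := ⟨fun _ h => h.1.ne rfl⟩

theorem within_le (G : SimpleGraph V) (P : Set V) : within G P ≤ G := fun _ _ h => h.1

theorem Linked.mono {G H : SimpleGraph V} {C : Set V} (h : Linked G C) (hle : G ≤ H) :
    Linked H C := by
  intro U h1 h2
  obtain ⟨u, hu, v, hv, hU, hV, ha⟩ := h U h1 h2
  exact ⟨u, hu, v, hv, hU, hV, hle ha⟩

theorem linked_singleton (G : SimpleGraph V) (v : V) : Linked G {v} := by
  rintro U ⟨c, rfl, hc⟩ ⟨d, rfl, hd⟩
  exact absurd hc hd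

theorem linked_pair {G : SimpleGraph V} {u v : V} (h : G.Adj u v) : Linked G {u, v} := by
  rintro U ⟨c, hc, hcU⟩ ⟨d, hd, hdU⟩
  have hcd : c ≠ d := by rintro rfl; exact hdU hcU
  refine ⟨c, hc, d, hd, hcU, hdU, ?_⟩
  rcases hc with rfl | rfl <;> rcases hd with rfl | rfl
  · exact absurd rfl hcd
  · exact h
  · exact h.symm
  · exact absurd rfl hcd

theorem Linked.union {G : SimpleGraph V} {C D : Set V} (hC : Linked G C) (hD : Linked G D)
    (h : ∃ v ∈ C, v ∈ D) : Linked G (C ∪ D) := by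
  intro U h1 h2
  by_contra hcon
  push Not at hcon
  have key : ∀ E : Set V, E ⊆ C ∪ D → Linked G E → (∃ c ∈ E, c ∈ U) → ∀ c ∈ E, c ∈ U := by
    intro E hE hl he c hc
    by_contra hcU
    obtain ⟨u, hu, v, hv, hU, hV, ha⟩ := hl U he ⟨c, hc, hcU⟩
    exact hcon u (hE hu) v (hE hv) hU hV ha
  have kC := key C Set.subset_union_left hC
  have kD := key D Set.subset_union_right hD
  obtain ⟨v, hvC, hvD⟩ := h
  obtain ⟨c, hc, hcU⟩ := h1
  obtain ⟨d, hd, hdU⟩ := h2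
  have hvU : v ∈ U := by
    rcases hc with hc | hc
    · exact kC ⟨c, hc, hcU⟩ v hvC
    · exact kD ⟨c, hc, hcU⟩ v hvD
  rcases hd with hd | hd
  · exact hdU (kC ⟨v, hvC, hvU⟩ d hd)
  · exact hdU (kD ⟨v, hvD, hvU⟩ d hd)

theorem Linked.union_of_adj {G : SimpleGraph V} {C D : Set V} (hC : Linked G C) (hD : Linked G D)
    {u v : V} (hu : u ∈ C) (hv : v ∈ D) (h : G.Adj u v) : Linked G (C ∪ D) := by
  have h1 := hC.union (linked_pair h) ⟨u, hu, by simp⟩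
  have h2 := h1.union hD ⟨v, by simp, hv⟩
  convert h2 using 1
  ext w
  simp only [Set.mem_union, Set.mem_insert_iff, Set.mem_singleton_iff]
  constructor
  · tauto
  · rintro ((h | rfl | rfl) | h) <;> tauto

theorem Linked.insert {G : SimpleGraph V} {C : Set V} (hC : Linked G C)
    {u v : V} (hu : u ∈ C) (h : G.Adj v u) : Linked G (insert v C) :=
  (linked_singleton G v).union_of_adj hC rfl hu h

theorem Linked.subset_of_within {G : SimpleGraph V} {P C : Set V} (h : Linked (within G P) C)
    {a : V} (ha : a ∈ C) (haP : a ∈ P) : C ⊆ P := by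
  intro c hc
  by_contra hcP
  obtain ⟨u, -, v, -, -, hv, -, -, hvP⟩ := h P ⟨a, ha, haP⟩ ⟨c, hc, hcP⟩
  exact hv hvP

/-- Menger's theorem: if every separation of `A` from `B` has order at least `k`, then there are
`k` pairwise disjoint linked sets meeting both `A` and `B`. -/
theorem exists_disjoint_linked [Finite V] (k : ℕ) (G : SimpleGraph V) : ∀ A B : Set V,
    (∀ P Q : Set V, (∀ v, v ∈ P ∨ v ∈ Q) → A ⊆ P → B ⊆ Q →
      (∀ u ∈ P, u ∉ Q → ∀ v ∈ Q, v ∉ P → ¬ G.Adj u v) → k ≤ (P ∩ Q).ncard) →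
    ∃ (T : Set V) (C : V → Set V), T ⊆ B ∧ T.ncard = k ∧
      (∀ b ∈ T, b ∈ C b ∧ (∃ a ∈ A, a ∈ C b) ∧ Linked G (C b)) ∧
      ∀ b ∈ T, ∀ b' ∈ T, ∀ v ∈ C b, v ∈ C b' → b = b' := by
  induction G using WellFoundedLT.induction with
  | ind G ih =>
  intro A B hsep
  by_cases hE : ∀ u v, ¬ G.Adj u v
  · have h := hsep A (B ∪ Aᶜ) (fun v => by by_cases h : v ∈ A <;> simp [h]) subset_rfl
      Set.subset_union_left (fun u _ _ v _ _ => hE u v)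
    obtain ⟨T, hT, hTk⟩ := Set.exists_subset_card_eq h
    refine ⟨T, fun b => {b}, fun b hb => ?_, hTk, fun b hb => ⟨rfl, ⟨b, (hT hb).1, rfl⟩,
      linked_singleton G b⟩, ?_⟩
    · rcases (hT hb).2 with h | h
      · exact h
      · exact absurd (hT hb).1 h
    · rintro b - b' - v rfl rfl
      rfl
  push Not at hE
  obtain ⟨x₀, y₀, hxy₀⟩ := hE
  have hlt : G.deleteEdges {s(x₀, y₀)} < G := by
    refine lt_of_le_not_ge (SimpleGraph.deleteEdges_le _) fun h => ?_
    have := h hxy₀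
    simp at this
  by_cases hdel : ∀ P Q : Set V, (∀ v, v ∈ P ∨ v ∈ Q) → A ⊆ P → B ⊆ Q →
      (∀ u ∈ P, u ∉ Q → ∀ v ∈ Q, v ∉ P → ¬ (G.deleteEdges {s(x₀, y₀)}).Adj u v) →
        k ≤ (P ∩ Q).ncard
  · obtain ⟨T, C, h1, h2, h3, h4⟩ := ih _ hlt A B hdel
    exact ⟨T, C, h1, h2, fun b hb => ⟨(h3 b hb).1, (h3 b hb).2.1, (h3 b hb).2.2.mono hlt.le⟩, h4⟩
  push Not at hdel
  obtain ⟨P, Q, hPQ, hAP, hBQ, hcross, hk⟩ := hdel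
  obtain ⟨x, hxP, hxQ, y, hyQ, hyP, hxy⟩ : ∃ u ∈ P, u ∉ Q ∧ ∃ v ∈ Q, v ∉ P ∧ G.Adj u v := by
    by_contra hcon
    push Not at hcon
    exact absurd (hsep P Q hPQ hAP hBQ fun u h1 h2 v h3 h4 => hcon u h1 h2 v h3 h4) (by omega)
  have huniq : ∀ u ∈ P, u ∉ Q → ∀ v ∈ Q, v ∉ P → G.Adj u v → u = x ∧ v = y := by
    have key : ∀ u ∈ P, u ∉ Q → ∀ v ∈ Q, v ∉ P → G.Adj u v → s(u, v) = s(x₀, y₀) := by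
      intro u h1 h2 v h3 h4 h5
      have := hcross u h1 h2 v h3 h4
      rw [SimpleGraph.deleteEdges_adj] at this
      by_contra h
      exact this ⟨h5, h⟩
    intro u h1 h2 v h3 h4 h5
    have := (key u h1 h2 v h3 h4 h5).trans (key x hxP hxQ y hyQ hyP hxy).symm
    rcases Sym2.eq_iff.1 this with h | h
    · exact h
    · rw [h.1] at h2
      exact absurd hyQ h2
  have hcard : ∀ w, w ∉ P ∩ Q → (insert w (P ∩ Q)).ncard = (P ∩ Q).ncard + 1 := fun w hw =>
    Set.ncard_insert_of_notMem hw
  have hkx : k ≤ (P ∩ Q).ncard + 1 := by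
    have h := hsep P (insert x Q) (fun v => (hPQ v).imp id (Set.mem_insert_of_mem x)) hAP
      (hBQ.trans (Set.subset_insert _ _)) (by
        intro u h1 h2 v h3 h4 h5
        rcases h3 with rfl | h3
        · exact h4 hxP
        · exact h2 (Or.inl (huniq u h1 (fun h => h2 (Or.inr h)) v h3 h4 h5).1))
    rwa [Set.inter_insert_of_mem hxP, hcard x fun h => hxQ h.2] at h
  have hcx : (insert x (P ∩ Q)).ncard = k := by rw [hcard x fun h => hxQ h.2]; omega
  have hcy : (insert y (P ∩ Q)).ncard = k := by rw [hcard y fun h => hyP h.1]; omega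
  have hltP : within G P < G := lt_of_le_not_ge (within_le G P) fun h => hyP (h hxy).2.2
  have hltQ : within G Q < G := lt_of_le_not_ge (within_le G Q) fun h => hxQ (h hxy).2.1
  obtain ⟨T₁, C, hT₁, hT₁k, hC, hCd⟩ := ih _ hltP A (insert x (P ∩ Q)) (by
    intro P₁ Q₁ h1 h2 h3 h4
    have h := hsep (P₁ ∩ P) (Q₁ ∪ Pᶜ) (fun v => by
        by_cases hv : v ∈ P
        · exact (h1 v).imp (fun h => ⟨h, hv⟩) Or.inl
        · exact Or.inr (Or.inr hv)) (fun a ha => ⟨h2 ha, hAP ha⟩) (fun b hb => by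
        by_cases hv : b ∈ P
        · exact Or.inl (h3 (Or.inr ⟨hv, hBQ hb⟩))
        · exact Or.inr hv) (by
        rintro u ⟨hu1, hu2⟩ hu3 v hv1 hv2 ha
        have hu4 : u ∉ Q₁ := fun h => hu3 (Or.inl h)
        by_cases hv : v ∈ P
        · have hv3 : v ∉ P₁ := fun h => hv2 ⟨h, hv⟩
          exact h4 u hu1 hu4 v ((h1 v).resolve_left hv3) hv3 ⟨ha, hu2, hv⟩
        · have hvQ := (hPQ v).resolve_left hv
          by_cases huQ : u ∈ Q
          · exact hu4 (h3 (Or.inr ⟨hu2, huQ⟩))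
          · exact hu4 (h3 (Or.inl (huniq u hu2 huQ v hvQ hv ha).1)))
    refine h.trans (Set.ncard_le_ncard ?_)
    rintro v ⟨⟨h5, h6⟩, h7 | h7⟩
    · exact ⟨h5, h7⟩
    · exact absurd h6 h7)
  obtain ⟨T, D, hT, hTk, hD, hDd⟩ := ih _ hltQ (insert y (P ∩ Q)) B (by
    intro P₁ Q₁ h1 h2 h3 h4
    have h := hsep (P₁ ∪ Qᶜ) (Q₁ ∩ Q) (fun v => by
        by_cases hv : v ∈ Q
        · exact (h1 v).imp Or.inl (fun h => ⟨h, hv⟩)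
        · exact Or.inl (Or.inr hv)) (fun b hb => by
        by_cases hv : b ∈ Q
        · exact Or.inl (h2 (Or.inr ⟨hAP hb, hv⟩))
        · exact Or.inr hv) (fun a ha => ⟨h3 ha, hBQ ha⟩) (by
        rintro u hu1 hu2 v ⟨hv1, hv2⟩ hv3 ha
        have hv4 : v ∉ P₁ := fun h => hv3 (Or.inl h)
        by_cases hu : u ∈ Q
        · have hu3 : u ∉ Q₁ := fun h => hu2 ⟨h, hu⟩
          exact h4 u ((h1 u).resolve_right hu3) hu3 v hv1 hv4 ⟨ha, hu, hv2⟩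
        · have huP := (hPQ u).resolve_right hu
          by_cases hvP : v ∈ P
          · exact hv4 (h2 (Or.inr ⟨hvP, hv2⟩))
          · exact hv4 (h2 (Or.inl (huniq u huP hu v hv2 hvP ha).2)))
    refine h.trans (Set.ncard_le_ncard ?_)
    rintro v ⟨h7 | h7, ⟨h5, h6⟩⟩
    · exact ⟨h7, h5⟩
    · exact absurd h6 h7)
  have hT₁eq : T₁ = insert x (P ∩ Q) :=
    Set.eq_of_subset_of_ncard_le hT₁ (by rw [hT₁k, hcx])
  rw [hT₁eq] at hC hCd
  have hCP : ∀ b ∈ insert x (P ∩ Q), C b ⊆ P := fun b hb =>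
    let ⟨a, ha, haC⟩ := (hC b hb).2.1
    (hC b hb).2.2.subset_of_within haC (hAP ha)
  have hDQ : ∀ b ∈ T, D b ⊆ Q := fun b hb =>
    (hD b hb).2.2.subset_of_within (hD b hb).1 (hBQ (hT hb))
  choose! g hg hgD using fun b hb => (hD b hb).2.1
  have hginj : Set.InjOn g T := fun b hb b' hb' h =>
    hDd b hb b' hb' (g b) (hgD b hb) (h ▸ hgD b' hb')
  have hgim : g '' T = insert y (P ∩ Q) := by
    refine Set.eq_of_subset_of_ncard_le (Set.image_subset_iff.2 hg) ?_
    rw [hginj.ncard_image, hTk, hcy]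
  classical
  set φ : V → V := fun v => if v = y then x else v with hφ
  have hφmem : ∀ v ∈ insert y (P ∩ Q), φ v ∈ insert x (P ∩ Q) := by
    rintro v (rfl | hv)
    · simp [hφ]
    · have : v ≠ y := by rintro rfl; exact hyP hv.1
      simp only [hφ, this, if_false]
      exact Or.inr hv
  have hφinj : ∀ v ∈ insert y (P ∩ Q), ∀ v' ∈ insert y (P ∩ Q), φ v = φ v' → v = v' := by
    have key : ∀ v ∈ insert y (P ∩ Q), v = y ∨ v ≠ y ∧ v ≠ x := by
      rintro v (rfl | hv)
      · exact Or.inl rfl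
      · exact Or.inr ⟨by rintro rfl; exact hyP hv.1, by rintro rfl; exact hxQ hv.2⟩
    intro v hv v' hv' h
    simp only [hφ] at h
    rcases key v hv with rfl | ⟨h1, h2⟩ <;> rcases key v' hv' with rfl | ⟨h3, h4⟩
    · rfl
    · rw [if_pos rfl, if_neg h3] at h
      exact absurd h.symm h4
    · rw [if_pos rfl, if_neg h1] at h
      exact absurd h h2
    · rwa [if_neg h1, if_neg h3] at h
  have hmix : ∀ b ∈ T, ∀ b' ∈ T, ∀ v ∈ C (φ (g b)), v ∈ D b' → b = b' := by
    intro b hb b' hb' v hv hv'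
    have hvPQ : v ∈ P ∩ Q := ⟨hCP _ (hφmem _ (hg b hb)) hv, hDQ _ hb' hv'⟩
    have e1 : φ (g b) = v := hCd _ (hφmem _ (hg b hb)) v (Or.inr hvPQ) v hv (hC v (Or.inr hvPQ)).1
    have hvy : v ≠ y := by rintro rfl; exact hyP hvPQ.1
    have e2 : g b = v :=
      hφinj _ (hg b hb) v (Or.inr hvPQ) (by rw [e1]; simp only [hφ, if_neg hvy])
    obtain ⟨c, hc, hcv⟩ : v ∈ g '' T := by rw [hgim]; exact Or.inr hvPQ
    have e3 : c = b' := hDd c hc b' hb' v (hcv ▸ hgD c hc) hv'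
    rw [← e3]
    exact hginj hb hc (e2.trans hcv.symm)
  refine ⟨T, fun b => C (φ (g b)) ∪ D b, hT, hTk, fun b hb => ⟨Or.inr (hD b hb).1, ?_, ?_⟩, ?_⟩
  · obtain ⟨a, ha, haC⟩ := (hC _ (hφmem _ (hg b hb))).2.1
    exact ⟨a, ha, Or.inl haC⟩
  · have l1 := (hC _ (hφmem _ (hg b hb))).2.2.mono (within_le G P)
    have l2 := (hD b hb).2.2.mono (within_le G Q)
    by_cases hgy : g b = y
    · refine l1.union_of_adj l2 (hC _ (hφmem _ (hg b hb))).1 (hgD b hb) ?_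
      simpa [hφ, hgy] using hxy
    · refine l1.union l2 ⟨g b, ?_, hgD b hb⟩
      have := (hC _ (hφmem _ (hg b hb))).1
      simpa only [hφ, if_neg hgy] using this
  · rintro b hb b' hb' v (hv | hv) (hv' | hv')
    · exact hginj hb hb' (hφinj _ (hg b hb) _ (hg b' hb') (hCd _ (hφmem _ (hg b hb)) _
        (hφmem _ (hg b' hb')) v hv hv'))
    · exact hmix b hb b' hb' v hv hv'
    · exact (hmix b' hb' b hb v hv' hv).symm
    · exact hDd b hb b' hb' v hv hv'

end Linkage

section Fans

variable {V : Type*}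

/-- Removing fewer than `k` vertices leaves `R` linked. -/
def KLinked (G : SimpleGraph V) (R : Set V) (k : ℕ) : Prop :=
  ∀ F : Set V, F.ncard < k → Linked G (R \ F)

/-- The fan lemma: at most `k` terminals in a `k`-linked set are joined to a vertex `x`
by sets that are disjoint apart from `x`. -/
theorem KLinked.exists_fan [Finite V] {G : SimpleGraph V} {R : Set V} {k : ℕ}
    (h : KLinked G R k) {x : V} (hx : x ∈ R) {W : Set V} (hW : W ⊆ R) (hk : (W \ {x}).ncard ≤ k) :
    ∃ C : V → Set V, (∀ w ∈ W, C w ⊆ R \ {x} ∧ Linked G (insert x (C w)) ∧ w ∈ insert x (C w)) ∧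
      ∀ w ∈ W, ∀ w' ∈ W, ∀ v ∈ C w, v ∈ C w' → w = w' := by
  classical
  obtain ⟨T, C, hT, hTk, hC, hd⟩ := exists_disjoint_linked (W \ {x}).ncard (within G (R \ {x}))
    {v | v ∈ R ∧ G.Adj x v} (W \ {x}) (by
      intro P Q hPQ hA hB hcross
      by_contra hlt
      push Not at hlt
      obtain ⟨b, ⟨hbW, hbx⟩, hb⟩ : ∃ b ∈ W \ {x}, b ∉ P ∩ Q := Set.exists_mem_notMem_of_ncard_lt_ncard hlt
      have hF : ((P ∩ Q) \ {x}).ncard < k :=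
        (Set.ncard_le_ncard Set.sdiff_subset).trans_lt (hlt.trans_le hk)
      have hbQ := hB ⟨hbW, hbx⟩
      obtain ⟨u, ⟨huR, huF⟩, v, ⟨hvR, hvF⟩, hu, hv, ha⟩ := h _ hF (insert x (P \ Q))
        ⟨x, ⟨hx, fun h => h.2 rfl⟩, Or.inl rfl⟩
        ⟨b, ⟨hW hbW, fun h => hb h.1⟩, by
          rintro (h | h)
          · exact hbx h
          · exact h.2 hbQ⟩
      have hvx : v ≠ x := fun h => hv (Or.inl h)
      have hvPQ : ¬ (v ∈ P ∧ v ∉ Q) := fun h => hv (Or.inr h)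
      have hvP : v ∉ P := fun hP => by
        by_cases hQ : v ∈ Q
        · exact hvF ⟨⟨hP, hQ⟩, hvx⟩
        · exact hvPQ ⟨hP, hQ⟩
      rcases eq_or_ne u x with rfl | hux
      · exact hvP (hA ⟨hvR, ha⟩)
      · rcases hu with hu | hu
        · exact hux hu
        · exact hcross u hu.1 hu.2 v ((hPQ v).resolve_left hvP) hvP ⟨ha, ⟨huR, hux⟩, ⟨hvR, hvx⟩⟩)
  have hTW : T = W \ {x} := Set.eq_of_subset_of_ncard_le hT hTk.ge
  subst hTW
  have hsub : ∀ w ∈ W \ {x}, C w ⊆ R \ {x} := fun w hw =>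
    (hC w hw).2.2.subset_of_within (hC w hw).1 ⟨hW hw.1, hw.2⟩
  refine ⟨fun w => if w = x then ∅ else C w, fun w hw => ?_, fun w hw w' hw' v hv hv' => ?_⟩
  · by_cases hwx : w = x
    · subst hwx
      simp only [if_true, insert_empty_eq, Set.mem_singleton_iff, and_true]
      exact ⟨Set.empty_subset _, linked_singleton G w⟩
    · simp only [if_neg hwx]
      obtain ⟨h1, ⟨a, ha, haC⟩, h3⟩ := hC w ⟨hw, hwx⟩
      exact ⟨hsub w ⟨hw, hwx⟩, (h3.mono (within_le _ _)).insert haC ha.2, Or.inr h1⟩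
  · by_cases hwx : w = x
    · simp [hwx] at hv
    · by_cases hwx' : w' = x
      · simp [hwx'] at hv'
      · simp only [if_neg hwx] at hv
        simp only [if_neg hwx'] at hv'
        exact hd w ⟨hw, hwx⟩ w' ⟨hw', hwx'⟩ v hv hv'

/-- In a `k`-linked set with more than `k` vertices, `k` neighbours of `y` lie on internally
disjoint connections between `x` and `y`. -/
theorem KLinked.exists_connections [Finite V] {G : SimpleGraph V} {R : Set V} {k : ℕ}
    (h : KLinked G R k) (hk : 1 ≤ k) (hR : k < R.ncard) {x y : V} (hx : x ∈ R) (hy : y ∈ R)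
    (hxy : x ≠ y) :
    ∃ (N : Set V) (D : V → Set V), N.ncard = k ∧ (∀ w ∈ N, w ∈ R ∧ G.Adj w y) ∧
      (∀ w ∈ N, (w = x ∧ D w = ∅) ∨ (w ≠ x ∧ w ∈ D w ∧ D w ⊆ R \ {x, y} ∧ Linked G (D w) ∧
        ∃ v ∈ D w, G.Adj x v)) ∧
      ∀ w ∈ N, ∀ w' ∈ N, ∀ v ∈ D w, v ∈ D w' → w = w' := by
  classical
  have key : ∀ P Q F : Set V, ∀ t : V, (∀ v, v ∈ P ∨ v ∈ Q) → {v | v ∈ R \ {y} ∧ G.Adj x v} ⊆ P →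
      {v | v ∈ R \ {x} ∧ G.Adj y v} ⊆ Q →
      (∀ u ∈ P, u ∉ Q → ∀ v ∈ Q, v ∉ P → ¬ (within G (R \ {x, y})).Adj u v) →
      F.ncard < k → x ∉ F → t ∈ R → t ∉ F → (P ∩ Q) \ {x, y} ⊆ F → (G.Adj x y → y ∈ F) →
      t ≠ x → (t = y ∨ t ∈ Q) → False := by
    intro P Q F t hPQ hA hB hcross hF hxF ht htF hPF hyF htx htQ
    obtain ⟨u, ⟨huR, huF⟩, v, ⟨hvR, hvF⟩, hu, hv, ha⟩ := h _ hF (insert x ((P \ Q) \ {y}))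
        ⟨x, ⟨hx, hxF⟩, Or.inl rfl⟩
        ⟨t, ⟨ht, htF⟩, by
          rintro (h | ⟨⟨-, h1⟩, h2⟩)
          · exact htx h
          · exact htQ.elim h2 h1⟩
    have hvx : v ≠ x := fun h => hv (Or.inl h)
    have hvPQ : ¬ ((v ∈ P ∧ v ∉ Q) ∧ v ≠ y) := fun h => hv (Or.inr h)
    have hvP : v ≠ y → v ∉ P := fun hvy hP => by
      by_cases hQ : v ∈ Q
      · exact hvF (hPF ⟨⟨hP, hQ⟩, by simp [hvx, hvy]⟩)
      · exact hvPQ ⟨⟨hP, hQ⟩, hvy⟩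
    rcases eq_or_ne u x with rfl | hux
    · have hvy : v ≠ y := by
        rintro rfl
        exact hvF (hyF ha)
      exact hvP hvy (hA ⟨⟨hvR, hvy⟩, ha⟩)
    · rcases hu with hu | ⟨⟨huP, huQ⟩, huy⟩
      · exact hux hu
      · have hvy : v ≠ y := by
          rintro rfl
          exact huQ (hB ⟨⟨huR, hux⟩, ha.symm⟩)
        refine hcross u huP huQ v ((hPQ v).resolve_left (hvP hvy)) (hvP hvy) ⟨ha, ⟨huR, ?_⟩, hvR, ?_⟩
        · rintro (h | h)
          · exact hux h
          · exact huy h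
        · rintro (h | h)
          · exact hvx h
          · exact hvy h
  have hmenger := exists_disjoint_linked (if G.Adj x y then k - 1 else k) (within G (R \ {x, y}))
    {v | v ∈ R \ {y} ∧ G.Adj x v} {v | v ∈ R \ {x} ∧ G.Adj y v} (by
      intro P Q hPQ hA hB hcross
      by_contra hlt
      push Not at hlt
      have hFle : ((P ∩ Q) \ {x, y}).ncard ≤ (P ∩ Q).ncard := Set.ncard_le_ncard Set.sdiff_subset
      by_cases hadj : G.Adj x y
      · rw [if_pos hadj] at hlt
        have hins : ∀ w, (insert w ((P ∩ Q) \ {x, y})).ncard < k := fun w =>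
          (Set.ncard_insert_le _ _).trans_lt (by omega)
        obtain ⟨b, ⟨⟨hbR, hbx⟩, hby⟩, hb⟩ : ∃ b ∈ {v | v ∈ R \ {x} ∧ G.Adj y v}, b ∉ P ∩ Q := by
          by_contra hcon
          push Not at hcon
          have hlt' : (insert y (insert x ((P ∩ Q) \ {x, y}))).ncard < R.ncard := by
            have := Set.ncard_insert_le y (insert x ((P ∩ Q) \ {x, y}))
            have := hins x
            omega
          obtain ⟨r, hrR, hr⟩ := Set.exists_mem_notMem_of_ncard_lt_ncard hlt'
          have hyx : y ∉ insert x ((P ∩ Q) \ {x, y}) := by simp [hxy.symm]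
          obtain ⟨u, ⟨huR, huF⟩, v, ⟨hvR, hvF⟩, hu, hv, ha⟩ := h _ (hins x) {y}
            ⟨y, ⟨hy, hyx⟩, rfl⟩ ⟨r, ⟨hrR, fun h => hr (Or.inr h)⟩, fun h => hr (Or.inl h)⟩
          obtain rfl : u = y := hu
          have hvx : v ≠ x := fun h => hvF (Or.inl h)
          exact hvF (Or.inr ⟨hcon v ⟨⟨hvR, hvx⟩, ha⟩, by
            rintro (h | h)
            · exact hvx h
            · exact hv h⟩)
        refine key P Q (insert y ((P ∩ Q) \ {x, y})) b hPQ hA hB hcross (hins y) (by simp [hxy]) hbR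
          ?_ (Set.subset_insert _ _) (fun _ => Or.inl rfl) hbx (Or.inr (hB ⟨⟨hbR, hbx⟩, hby⟩))
        rintro (h | h)
        · exact hby.ne h.symm
        · exact hb h.1
      · rw [if_neg hadj] at hlt
        exact key P Q ((P ∩ Q) \ {x, y}) y hPQ hA hB hcross (by omega) (by simp) hy (by simp)
          subset_rfl (fun h => absurd h hadj) hxy.symm (Or.inl rfl))
  obtain ⟨T, D, hT, hTk, hD, hd⟩ := hmenger
  have hxT : ∀ w ∈ T, w ≠ x := fun w hw => (hT hw).1.2
  have hsub : ∀ w ∈ T, D w ⊆ R \ {x, y} := fun w hw =>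
    (hD w hw).2.2.subset_of_within (hD w hw).1 ⟨(hT hw).1.1, by
      rintro (h | h)
      · exact hxT w hw h
      · exact (hT hw).2.ne h.symm⟩
  have hD' : ∀ w ∈ T, w ≠ x ∧ w ∈ D w ∧ D w ⊆ R \ {x, y} ∧ Linked G (D w) ∧
      ∃ v ∈ D w, G.Adj x v := fun w hw => by
    obtain ⟨h1, ⟨a, ha, haD⟩, h3⟩ := hD w hw
    exact ⟨hxT w hw, h1, hsub w hw, h3.mono (within_le _ _), a, haD, ha.2⟩
  by_cases hadj : G.Adj x y
  · rw [if_pos hadj] at hTk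
    refine ⟨insert x T, fun w => if w = x then ∅ else D w, ?_, ?_, ?_, ?_⟩
    · rw [Set.ncard_insert_of_notMem fun h => hxT x h rfl]
      omega
    · rintro w (rfl | hw)
      · exact ⟨hx, hadj⟩
      · exact ⟨(hT hw).1.1, (hT hw).2.symm⟩
    · rintro w (rfl | hw)
      · simp
      · right
        simpa only [if_neg (hxT w hw)] using hD' w hw
    · rintro w (rfl | hw) w' (rfl | hw') v hv hv'
      · rfl
      · simp at hv
      · simp at hv'
      · simp only [if_neg (hxT w hw)] at hv
        simp only [if_neg (hxT w' hw')] at hv'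
        exact hd w hw w' hw' v hv hv'
  · rw [if_neg hadj] at hTk
    exact ⟨T, D, hTk, fun w hw => ⟨(hT hw).1.1, (hT hw).2.symm⟩, fun w hw => Or.inr (hD' w hw), hd⟩

end Fans

section Packing

variable {V : Type*}

/-- The graph `G` with those edges inside `S` removed that do not belong to `E`. -/
def keep (G : SimpleGraph V) (S : Set V) (E : Set (Sym2 V)) : SimpleGraph V where
  Adj u v := G.Adj u v ∧ (u ∈ S → v ∈ S → s(u, v) ∈ E)
  symm := ⟨fun u v h => ⟨h.1.symm, fun h1 h2 => by rw [Sym2.eq_swap]; exact h.2 h2 h1⟩⟩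
  loopless := ⟨fun _ h => h.1.ne rfl⟩

theorem keep_adj_left {G : SimpleGraph V} {S : Set V} {E : Set (Sym2 V)} {u v : V}
    (h : G.Adj u v) (hu : u ∉ S) : (keep G S E).Adj u v := ⟨h, fun h => absurd h hu⟩

theorem keep_adj_right {G : SimpleGraph V} {S : Set V} {E : Set (Sym2 V)} {u v : V}
    (h : G.Adj u v) (hv : v ∉ S) : (keep G S E).Adj u v := ⟨h, fun _ h => absurd h hv⟩

theorem Linked.keep {G : SimpleGraph V} {S : Set V} (E : Set (Sym2 V)) {C : Set V}
    (h : Linked G C) (hC : ∀ s ∈ C, s ∈ S → ∀ t ∈ C, t ∈ S → s = t) : Linked (keep G S E) C := by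
  intro U h1 h2
  obtain ⟨u, hu, v, hv, hU, hV, ha⟩ := h U h1 h2
  exact ⟨u, hu, v, hv, hU, hV, ha, fun h3 h4 => absurd (hC u hu h3 v hv h4) ha.ne⟩

theorem Linked.of_pendant {G : SimpleGraph V} {X Y : Set V} (h : Linked G X) (hXY : X ⊆ Y)
    (hY : ∀ y ∈ Y, y ∉ X → ∃ x ∈ X, G.Adj y x) : Linked G Y := by
  rintro U ⟨c, hc, hcU⟩ ⟨d, hd, hdU⟩
  by_contra hcon
  push Not at hcon
  have hc' : ∃ c ∈ X, c ∈ U := by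
    by_cases hcX : c ∈ X
    · exact ⟨c, hcX, hcU⟩
    · obtain ⟨x, hx, ha⟩ := hY c hc hcX
      by_contra hno
      exact hcon c hc x (hXY hx) hcU (fun hxU => hno ⟨x, hx, hxU⟩) ha
  have hd' : ∃ d ∈ X, d ∉ U := by
    by_cases hdX : d ∈ X
    · exact ⟨d, hdX, hdU⟩
    · obtain ⟨x, hx, ha⟩ := hY d hd hdX
      by_contra hno
      push Not at hno
      exact hcon x (hXY hx) d hd (hno x hx) hdU ha.symm
  obtain ⟨u, hu, v, hv, hU, hV, ha⟩ := h U hc' hd'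
  exact hcon u (hXY hu) v (hXY hv) hU hV ha

/-- There are `k` internally edge disjoint connected subgraphs spanning `S` inside `R`; the one
with index `i` has vertex set `S ∪ C i`, and `E i` contains its edges inside `S`. -/
def Packs (G : SimpleGraph V) (R S : Set V) (k : ℕ) : Prop :=
  ∃ (β : Type) (_ : Fintype β) (C : β → Set V) (E : β → Set (Sym2 V)), Fintype.card β = k ∧
    (∀ i, Linked (keep G S (E i)) (S ∪ C i) ∧ C i ⊆ R ∧ ∀ v ∈ C i, v ∉ S) ∧
    ∀ i j, i ≠ j → (∀ v ∈ C i, v ∉ C j) ∧ ∀ e ∈ E i, e ∉ E j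

end Packing

section Layers

variable {V ι : Type}

/-- The vertices of `R` with label `i`. -/
def layer (R : Set V) (lab : V → ι) (i : ι) : Set V := {u | u ∈ R ∧ lab u = i}

/-- A vertex set split into `m` layers indexed by `L`, where each vertex `u` has a partner `o u`
in a different layer and any two layers are joined by at least two such edges. -/
structure Layered (G : SimpleGraph V) (R : Set V) (L : Finset ι) (lab : V → ι) (o : V → V)
    (m : ℕ) : Prop where
  four_le : 4 ≤ m
  card_eq : L.card = m
  lab_mem : ∀ u ∈ R, lab u ∈ L
  out_mem : ∀ u ∈ R, o u ∈ R
  out_out : ∀ u, o (o u) = u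
  lab_out : ∀ u ∈ R, lab (o u) ≠ lab u
  adj_out : ∀ u, G.Adj u (o u)
  exists_two : ∀ i ∈ L, ∀ j ∈ L, i ≠ j → ∃ u ∈ R, ∃ v ∈ R, u ≠ v ∧ lab u = i ∧ lab v = i ∧
    lab (o u) = j ∧ lab (o v) = j
  linked : ∀ i ∈ L, KLinked G (layer R lab i) (m - 1)
  lt_ncard : ∀ i ∈ L, m - 1 < (layer R lab i).ncard
  packs : ∀ i ∈ L, ∀ S ⊆ layer R lab i, S.ncard = 3 → Packs G (layer R lab i) S (m - 2)

namespace Layered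

variable {G : SimpleGraph V} {R : Set V} {L : Finset ι} {lab : V → ι} {o : V → V} {m : ℕ}

theorem out_inj (h : Layered G R L lab o m) {u v : V} (huv : o u = o v) : u = v := by
  rw [← h.out_out u, huv, h.out_out]

variable [Finite V]

theorem linked_union (h : Layered G R L lab o m) {L' : Finset ι} (hL : L' ⊆ L) (F : Set V)
    (hF : ∀ i ∈ L', (F ∩ layer R lab i).ncard < m - 1) (hFc : F.ncard < (L'.card - 1) * 2) :
    Linked G ({u | u ∈ R ∧ lab u ∈ L'} \ F) := by
  classical
  rintro U ⟨p, ⟨⟨hpR, hpL⟩, hpF⟩, hpU⟩ ⟨q, ⟨⟨hqR, hqL⟩, hqF⟩, hqU⟩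
  by_contra hcon
  push Not at hcon
  have whole : ∀ k ∈ L', ∀ u ∈ R, lab u = k → u ∉ F → u ∈ U →
      ∀ v ∈ R, lab v = k → v ∉ F → v ∈ U := by
    intro k hk u hu huk huF huU v hv hvk hvF
    by_contra hvU
    have hl := h.linked k (hL hk) (F ∩ layer R lab k) (hF k hk)
    obtain ⟨s, ⟨⟨hs1, hs2⟩, hs3⟩, t, ⟨⟨ht1, ht2⟩, ht3⟩, hsU, htU, ha⟩ := hl U
      ⟨u, ⟨⟨hu, huk⟩, fun h => huF h.1⟩, huU⟩ ⟨v, ⟨⟨hv, hvk⟩, fun h => hvF h.1⟩, hvU⟩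
    exact hcon s ⟨⟨hs1, hs2 ▸ hk⟩, fun h => hs3 ⟨h, hs1, hs2⟩⟩ t
      ⟨⟨ht1, ht2 ▸ hk⟩, fun h => ht3 ⟨h, ht1, ht2⟩⟩ hsU htU ha
  set i := lab p with hi
  set j := lab q with hj
  have hij : i ≠ j := fun e => hqU (whole i hpL p hpR hi.symm hpF hpU q hqR (hj.symm.trans e.symm) hqF)
  let κ : V → ι := fun f => if lab f ≠ i ∧ lab f ≠ j then lab f else
    if lab (o f) ≠ i ∧ lab (o f) ≠ j then lab (o f) else j
  have hFt : (F.toFinite.toFinset).card < (L'.erase i).card * 2 := by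
    rw [Finset.card_erase_of_mem hpL, ← Set.ncard_eq_toFinset_card]
    exact hFc
  obtain ⟨k, hk, hkf⟩ := Finset.exists_card_fiber_lt_of_card_lt_mul (f := κ) hFt
  have hkL : k ∈ L' := Finset.mem_of_mem_erase hk
  have hki : k ≠ i := Finset.ne_of_mem_erase hk
  have unhit : ∀ t ∈ L', t ≠ k → (k = j ∧ t = i ∨ k ≠ j ∧ (t = i ∨ t = j)) →
      ∃ u ∈ R, lab u = k ∧ lab (o u) = t ∧ u ∉ F ∧ o u ∉ F := by
    intro t ht htk hcase
    obtain ⟨u₁, hu₁, u₂, hu₂, hne, h1, h2, h3, h4⟩ := h.exists_two k (hL hkL) t (hL ht) htk.symm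
    by_contra hno
    push Not at hno
    have hκ : ∀ f, (lab f = k ∧ lab (o f) = t ∨ lab f = t ∧ lab (o f) = k) → κ f = k := by
      intro f hf
      simp only [κ]
      grind
    have hit : ∀ u ∈ R, lab u = k → lab (o u) = t → ∃ f, (f = u ∨ f = o u) ∧ f ∈ F ∧ κ f = k := by
      intro u hu e1 e2
      by_cases huF : u ∈ F
      · exact ⟨u, Or.inl rfl, huF, hκ u (Or.inl ⟨e1, e2⟩)⟩
      · exact ⟨o u, Or.inr rfl, hno u hu e1 e2 huF, hκ _ (Or.inr ⟨e2, by rw [h.out_out, e1]⟩)⟩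
    obtain ⟨f₁, hf₁, hf₁F, hf₁κ⟩ := hit u₁ hu₁ h1 h3
    obtain ⟨f₂, hf₂, hf₂F, hf₂κ⟩ := hit u₂ hu₂ h2 h4
    have heq : f₁ = f₂ := Finset.card_le_one.1 (Nat.lt_succ_iff.1 hkf) f₁ (by simp [hf₁F, hf₁κ])
      f₂ (by simp [hf₂F, hf₂κ])
    rcases hf₁ with rfl | rfl <;> rcases hf₂ with rfl | hf₂
    · exact hne heq
    · rw [heq, hf₂, h4] at h1
      exact htk h1
    · rw [heq, h2] at h3
      exact htk h3.symm
    · exact hne (h.out_inj (heq.trans hf₂))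
  have cross : ∀ u ∈ R, lab u ∈ L' → lab (o u) ∈ L' → u ∉ F → o u ∉ F → (u ∈ U ↔ o u ∈ U) := by
    intro u hu h1 h2 h3 h4
    constructor
    · intro h5
      by_contra h6
      exact hcon u ⟨⟨hu, h1⟩, h3⟩ (o u) ⟨⟨h.out_mem u hu, h2⟩, h4⟩ h5 h6 (h.adj_out u)
    · intro h5
      by_contra h6
      exact hcon (o u) ⟨⟨h.out_mem u hu, h2⟩, h4⟩ u ⟨⟨hu, h1⟩, h3⟩ h5 h6 (h.adj_out u).symm
  have hjU : ∀ u ∈ R, lab u = j → u ∉ F → u ∉ U := fun u hu huj huF huU =>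
    hqU (whole j hqL u hu huj huF huU q hqR hj.symm hqF)
  by_cases hkj : k = j
  · obtain ⟨u, hu, h1, h2, h3, h4⟩ := unhit i hpL hki.symm (Or.inl ⟨hkj, rfl⟩)
    refine hjU u hu (h1.trans hkj) h3 ((cross u hu (h1 ▸ hkL) (h2 ▸ hpL) h3 h4).2 ?_)
    exact whole i hpL p hpR hi.symm hpF hpU (o u) (h.out_mem u hu) h2 h4
  · obtain ⟨u, hu, h1, h2, h3, h4⟩ := unhit i hpL hki.symm (Or.inr ⟨hkj, Or.inl rfl⟩)
    obtain ⟨u', hu', h1', h2', h3', h4'⟩ := unhit j hqL (Ne.symm hkj) (Or.inr ⟨hkj, Or.inr rfl⟩)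
    have huU := (cross u hu (h1 ▸ hkL) (h2 ▸ hpL) h3 h4).2
      (whole i hpL p hpR hi.symm hpF hpU (o u) (h.out_mem u hu) h2 h4)
    have huU' := (cross u' hu' (h1' ▸ hkL) (h2' ▸ hqL) h3' h4').1
      (whole k hkL u hu h1 h3 huU u' hu' h1' h3')
    exact hjU (o u') (h.out_mem u' hu') h2' h4' huU'

theorem kLinked_compl (h : Layered G R L lab o m) [DecidableEq ι] {i : ι} (hi : i ∈ L) :
    KLinked G {u | u ∈ R ∧ lab u ∈ L.erase i} (m - 1) := by
  intro F hF
  refine h.linked_union (Finset.erase_subset _ _) F (fun j _ =>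
    (Set.ncard_le_ncard Set.inter_subset_left).trans_lt hF) ?_
  rw [Finset.card_erase_of_mem hi, h.card_eq]
  have := h.four_le
  omega

theorem kLinked (h : Layered G R L lab o m) : KLinked G R m := by
  classical
  intro F hF
  have h4 := h.four_le
  have hR : {u | u ∈ R ∧ lab u ∈ L} = R := by
    ext u
    exact ⟨fun hu => hu.1, fun hu => ⟨hu, h.lab_mem u hu⟩⟩
  by_cases hc : ∀ i ∈ L, (F ∩ layer R lab i).ncard < m - 1
  · have := h.linked_union subset_rfl F hc (by rw [h.card_eq]; omega)
    rwa [hR] at this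
  push Not at hc
  obtain ⟨i, hi, hc⟩ := hc
  have hFi : F ∩ layer R lab i = F :=
    Set.eq_of_subset_of_ncard_le Set.inter_subset_left (by omega)
  have hFl : ∀ u ∈ F, lab u = i := fun u hu => by
    rw [← hFi] at hu
    exact hu.2.2
  have hl := h.kLinked_compl hi ∅ (by simp; omega)
  rw [Set.sdiff_empty] at hl
  refine hl.of_pendant (fun u hu => ⟨hu.1, fun hF => Finset.ne_of_mem_erase hu.2 (hFl u hF)⟩) ?_
  intro u hu huX
  have hui : lab u = i := by
    by_contra hne
    exact huX ⟨hu.1, Finset.mem_erase.2 ⟨hne, h.lab_mem u hu.1⟩⟩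
  refine ⟨o u, ⟨h.out_mem u hu.1, Finset.mem_erase.2 ⟨?_, h.lab_mem _ (h.out_mem u hu.1)⟩⟩,
    h.adj_out u⟩
  rw [← hui]
  exact h.lab_out u hu.1

theorem lt_ncard_self (h : Layered G R L lab o m) : m < R.ncard := by
  have h4 := h.four_le
  obtain ⟨i, hi, j, hj, hij⟩ := Finset.one_lt_card.1 (by rw [h.card_eq]; omega : 1 < L.card)
  obtain ⟨u, hu, -, -, -, hui, -⟩ := h.exists_two i hi j hj hij
  have h1 := h.lt_ncard j hj
  have h2 : (layer R lab j).ncard < R.ncard := Set.ncard_lt_ncard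
    (Set.ssubset_iff_subset_ne.2 ⟨fun v hv => hv.1, fun e => by
      rw [← e] at hu
      exact hij (hui.symm.trans hu.2)⟩)
  omega

theorem packs_of_eq (h : Layered G R L lab o m) {i : ι} (hi : i ∈ L) {S : Set V}
    (hS : S ⊆ layer R lab i) (hS3 : S.ncard = 3) : Packs G R S (m - 1) := by
  classical
  obtain ⟨β, _, C, E, hcard, h1, h2⟩ := h.packs i hi S hS hS3
  have h4 := h.four_le
  set X : Set V := {u | u ∈ R ∧ lab u ∈ L.erase i} with hX
  have hXi : ∀ v ∈ X, lab v ≠ i := fun v hv => Finset.ne_of_mem_erase hv.2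
  have hXS : ∀ v ∈ X, v ∉ S := fun v hv hvS => hXi v hv (hS hvS).2
  have hl : Linked G X := by
    have := h.kLinked_compl hi ∅ (by simp; omega)
    rwa [Set.sdiff_empty] at this
  refine ⟨Option β, inferInstance, fun b => b.elim X C, fun b => b.elim ∅ E, ?_, ?_, ?_⟩
  · rw [Fintype.card_option, hcard]
    omega
  · rintro (_ | b)
    · refine ⟨(hl.keep ∅ fun s hs hsS => absurd hsS (hXS s hs)).of_pendant
        Set.subset_union_right ?_, fun v hv => hv.1, hXS⟩
      rintro y (hy | hy) hyX
      · have hoX : o y ∈ X := by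
          refine ⟨h.out_mem y (hS hy).1, Finset.mem_erase.2 ⟨?_, h.lab_mem _ (h.out_mem y (hS hy).1)⟩⟩
          have := h.lab_out y (hS hy).1
          rwa [(hS hy).2] at this
        exact ⟨o y, hoX, keep_adj_right (h.adj_out y) (hXS _ hoX)⟩
      · exact absurd hy hyX
    · exact ⟨(h1 b).1, fun v hv => ((h1 b).2.1 hv).1, (h1 b).2.2⟩
  · rintro (_ | b) (_ | b') hbb
    · exact absurd rfl hbb
    · exact ⟨fun v hv hv' => hXi v hv ((h1 b').2.1 hv').2, fun e he => absurd he (Set.notMem_empty e)⟩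
    · exact ⟨fun v hv hv' => hXi v hv' ((h1 b).2.1 hv).2, fun e _ he => absurd he (Set.notMem_empty e)⟩
    · exact h2 b b' fun e => hbb (e ▸ rfl)

theorem packs_of_pair (h : Layered G R L lab o m) {x y z : V} (hx : x ∈ R) (hy : y ∈ R)
    (hz : z ∈ R) (hxy : x ≠ y) (hlab : lab y = lab x) (hlabz : lab z ≠ lab x) :
    Packs G R {x, y, z} (m - 1) := by
  classical
  have h4 := h.four_le
  set i := lab x with hi
  have hiL : i ∈ L := h.lab_mem x hx
  obtain ⟨N, D, hN, hNR, hD, hDd⟩ := (h.linked i hiL).exists_connections (by omega)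
    (h.lt_ncard i hiL) (x := x) (y := y) ⟨hx, rfl⟩ ⟨hy, hlab⟩ hxy
  have hoN : o '' N ⊆ {u | u ∈ R ∧ lab u ∈ L.erase i} := by
    rintro _ ⟨w, hw, rfl⟩
    have hwR := (hNR w hw).1
    refine ⟨h.out_mem w hwR.1, Finset.mem_erase.2 ⟨?_, h.lab_mem _ (h.out_mem w hwR.1)⟩⟩
    have := h.lab_out w hwR.1
    rwa [hwR.2] at this
  obtain ⟨E, hE, hEd⟩ := (h.kLinked_compl hiL).exists_fan (x := z)
    ⟨hz, Finset.mem_erase.2 ⟨hlabz, h.lab_mem z hz⟩⟩ hoN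
    ((Set.ncard_le_ncard Set.sdiff_subset).trans ((Set.ncard_image_le).trans hN.le))
  have hEl : ∀ w ∈ N, ∀ v ∈ E (o w), v ∈ R ∧ lab v ≠ i ∧ v ≠ z := fun w hw v hv =>
    have := (hE (o w) ⟨w, hw, rfl⟩).1 hv
    ⟨this.1.1, Finset.ne_of_mem_erase this.1.2, this.2⟩
  have hDl : ∀ w ∈ N, ∀ v ∈ D w, v ∈ R ∧ lab v = i ∧ v ∉ ({x, y, z} : Set V) := by
    intro w hw v hv
    rcases hD w hw with ⟨-, h0⟩ | ⟨-, -, hsub, -⟩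
    · rw [h0] at hv
      exact absurd hv (Set.notMem_empty v)
    · have := hsub hv
      refine ⟨this.1.1, this.1.2, ?_⟩
      rintro (rfl | rfl | rfl)
      · exact this.2 (Or.inl rfl)
      · exact this.2 (Or.inr rfl)
      · exact hlabz this.1.2
  have hES : ∀ w ∈ N, ∀ v ∈ E (o w), v ∉ ({x, y, z} : Set V) := by
    rintro w hw v hv (rfl | rfl | rfl)
    · exact (hEl w hw _ hv).2.1 rfl
    · exact (hEl w hw _ hv).2.1 hlab
    · exact (hEl w hw _ hv).2.2 rfl
  refine ⟨N, Fintype.ofFinite N, fun w => D w ∪ E (o w), fun w => if w.1 = x then Set.univ else ∅,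
    ?_, ?_, ?_⟩
  · rw [Fintype.card_eq_nat_card, Nat.card_coe_set_eq, hN]
  · rintro ⟨w, hw⟩
    refine ⟨?_, ?_, ?_⟩
    · set K := keep G {x, y, z} (if w = x then Set.univ else ∅) with hK
      have hwo : K.Adj w (o w) := by
        rcases hD w hw with ⟨hwx, -⟩ | ⟨-, hwD, -⟩
        · exact ⟨h.adj_out w, fun _ _ => by rw [if_pos hwx]; trivial⟩
        · exact keep_adj_left (h.adj_out w) (hDl w hw w hwD).2.2
      have l2 : Linked K (insert z (E (o w))) := by
        refine (hE (o w) ⟨w, hw, rfl⟩).2.1.keep _ ?_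
        rintro s (rfl | hs) hsS t (rfl | ht) htS
        · rfl
        · exact absurd htS (hES w hw t ht)
        · exact absurd hsS (hES w hw s hs)
        · exact absurd hsS (hES w hw s hs)
      have l1 : Linked K ({x, y} ∪ D w) ∧ w ∈ {x, y} ∪ D w := by
        rcases hD w hw with ⟨hwx, h0⟩ | ⟨hwx, hwD, -, hl, v, hv, hxv⟩
        · rw [h0, Set.union_empty]
          refine ⟨linked_pair ⟨hwx ▸ (hNR w hw).2, fun _ _ => by rw [if_pos hwx]; trivial⟩, Or.inl hwx⟩
        · refine ⟨?_, Or.inr hwD⟩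
          have l3 := hl.keep (S := {x, y, z}) (if w = x then Set.univ else ∅)
            fun s hs hsS => absurd hsS (hDl w hw s hs).2.2
          have l4 := (l3.insert hwD (keep_adj_right (hNR w hw).2.symm (hDl w hw w hwD).2.2)).insert
            (Or.inr hv) (keep_adj_right hxv (hDl w hw v hv).2.2)
          rwa [Set.insert_union, Set.singleton_union]
      have l5 := l1.1.union_of_adj l2 l1.2 (hE (o w) ⟨w, hw, rfl⟩).2.2 hwo
      convert l5 using 1
      ext v
      simp only [Set.mem_union, Set.mem_insert_iff, Set.mem_singleton_iff]
      tauto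
    · rintro v (hv | hv)
      · exact (hDl w hw v hv).1
      · exact (hEl w hw v hv).1
    · rintro v (hv | hv)
      · exact (hDl w hw v hv).2.2
      · exact hES w hw v hv
  · rintro ⟨w, hw⟩ ⟨w', hw'⟩ hne
    have hne' : w ≠ w' := fun e => hne (Subtype.ext e)
    refine ⟨?_, ?_⟩
    · rintro v (hv | hv) (hv' | hv')
      · exact hne' (hDd w hw w' hw' v hv hv')
      · exact (hEl w' hw' v hv').2.1 (hDl w hw v hv).2.1
      · exact (hEl w hw v hv).2.1 (hDl w' hw' v hv').2.1
      · exact hne' (h.out_inj (hEd _ ⟨w, hw, rfl⟩ _ ⟨w', hw', rfl⟩ v hv hv'))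
    · intro e he he'
      dsimp only at he he'
      by_cases hwx : w = x
      · rw [if_neg fun e => hne' (hwx.trans e.symm)] at he'
        exact he'
      · rw [if_neg hwx] at he
        exact he

end Layered
end Layers

section Rearrange

variable {V : Type*} {K : SimpleGraph V} {x y z : V} {A B D X : Set V}

theorem linked_triple_union_of_center (h : Linked K (X ∪ insert x A ∪ insert y B ∪ insert z D)) :
    Linked K ({x, y, z} ∪ (A ∪ B ∪ D ∪ X)) := by
  convert h using 1
  ext v
  simp only [Set.mem_union, Set.mem_insert_iff, Set.mem_singleton_iff]
  tauto

theorem linked_triple_union_of_mid (h : Linked K (insert x A ∪ insert y B ∪ insert y X ∪ insert z D)) :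
    Linked K ({x, y, z} ∪ (A ∪ B ∪ D ∪ X)) := by
  convert h using 1
  ext v
  simp only [Set.mem_union, Set.mem_insert_iff, Set.mem_singleton_iff]
  tauto

theorem linked_triple_union_of_last (h : Linked K (insert x A ∪ insert z D ∪ insert z X ∪ insert y B)) :
    Linked K ({x, y, z} ∪ (A ∪ B ∪ D ∪ X)) := by
  convert h using 1
  ext v
  simp only [Set.mem_union, Set.mem_insert_iff, Set.mem_singleton_iff]
  tauto

end Rearrange

section Layers

variable {V ι : Type}

namespace Layered

variable {G : SimpleGraph V} {R : Set V} {L : Finset ι} {lab : V → ι} {o : V → V} {m : ℕ}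

theorem exists_exits (h : Layered G R L lab o m) {y : V} (hy : y ∈ R) :
    ∃ q : ι → V, ∀ d ∈ L, d ≠ lab y →
      q d ∈ R ∧ lab (q d) = lab y ∧ lab (o (q d)) = d ∧ (lab (o y) = d → q d = y) := by
  have : ∀ d, ∃ v, d ∈ L → d ≠ lab y →
      v ∈ R ∧ lab v = lab y ∧ lab (o v) = d ∧ (lab (o y) = d → v = y) := by
    intro d
    by_cases hd : lab (o y) = d
    · exact ⟨y, fun _ _ => ⟨hy, rfl, hd, fun _ => rfl⟩⟩
    · by_cases hdL : d ∈ L ∧ d ≠ lab y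
      · obtain ⟨u, hu, -, -, -, h1, -, h2, -⟩ :=
          h.exists_two (lab y) (h.lab_mem y hy) d hdL.1 hdL.2.symm
        exact ⟨u, fun _ _ => ⟨hu, h1, h2, fun e => absurd e hd⟩⟩
      · exact ⟨y, fun h1 h2 => absurd ⟨h1, h2⟩ hdL⟩
  choose q hq using this
  exact ⟨q, hq⟩

theorem exists_two_crossing (h : Layered G R L lab o m) {y z : V} (hy : y ∈ R) (hz : z ∈ R)
    (hyz : lab y ≠ lab z) :
    ∃ u ∈ R, ∃ v ∈ R, u ≠ v ∧ lab u = lab y ∧ lab v = lab y ∧ lab (o u) = lab z ∧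
      lab (o v) = lab z ∧ (lab (o y) = lab z → y = u ∨ y = v) ∧
      (lab (o z) = lab y → z = o u ∨ z = o v) := by
  obtain ⟨u, hu, v, hv, huv, h1, h2, h3, h4⟩ :=
    h.exists_two (lab y) (h.lab_mem y hy) (lab z) (h.lab_mem z hz) hyz
  have other : ∀ t, ∃ s ∈ R, s ≠ t ∧ lab s = lab y ∧ lab (o s) = lab z := by
    intro t
    by_cases ht : u = t
    · exact ⟨v, hv, fun e => huv (ht.trans e.symm), h2, h4⟩
    · exact ⟨u, hu, ht, h1, h3⟩
  by_cases hy' : lab (o y) = lab z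
  · by_cases hz' : lab (o z) = lab y ∧ o z ≠ y
    · exact ⟨y, hy, o z, h.out_mem z hz, hz'.2.symm, rfl, hz'.1, hy', by rw [h.out_out],
        fun _ => Or.inl rfl, fun _ => Or.inr (h.out_out z).symm⟩
    · obtain ⟨s, hs, hst, e1, e2⟩ := other y
      refine ⟨y, hy, s, hs, hst.symm, rfl, e1, hy', e2, fun _ => Or.inl rfl, fun e => ?_⟩
      push Not at hz'
      exact Or.inl (by rw [← hz' e, h.out_out])
  · by_cases hz' : lab (o z) = lab y
    · obtain ⟨s, hs, hst, e1, e2⟩ := other (o z)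
      exact ⟨o z, h.out_mem z hz, s, hs, hst.symm, hz', e1, by rw [h.out_out], e2,
        fun e => absurd e hy', fun _ => Or.inl (h.out_out z).symm⟩
    · exact ⟨u, hu, v, hv, huv, h1, h2, h3, h4, fun e => absurd e hy', fun e => absurd e hz'⟩

theorem exists_override {α : Type*} (g : ι → α) {b c : ι} (hbc : b ≠ c) (p q : α) :
    ∃ f : ι → α, f b = p ∧ f c = q ∧ ∀ d, d ≠ b → d ≠ c → f d = g d := by
  classical
  refine ⟨fun d => if d = b then p else if d = c then q else g d, by simp, by simp [hbc.symm], ?_⟩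
  intro d h1 h2
  simp [h1, h2]

variable [Finite V]

set_option maxHeartbeats 2000000 in
theorem packs_of_ne (h : Layered G R L lab o m) {x y z : V} (hx : x ∈ R) (hy : y ∈ R)
    (hz : z ∈ R) (hab : lab x ≠ lab y) (hac : lab x ≠ lab z) (hbc : lab y ≠ lab z) :
    Packs G R {x, y, z} (m - 1) := by
  classical
  have h4 := h.four_le
  obtain ⟨qx, hqx⟩ := h.exists_exits hx
  obtain ⟨qy, hqy⟩ := h.exists_exits hy
  obtain ⟨qz, hqz⟩ := h.exists_exits hz
  obtain ⟨b₁, hb₁, b₂, hb₂, hb₁₂, l1, l2, l3, l4, hyb, hzb⟩ := h.exists_two_crossing hy hz hbc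
  have haL := h.lab_mem x hx
  have hbL := h.lab_mem y hy
  have hcL := h.lab_mem z hz
  have hoyL := h.lab_mem _ (h.out_mem y hy)
  have hozL := h.lab_mem _ (h.out_mem z hz)
  have hoy := h.lab_out y hy
  have hoz := h.lab_out z hz
  obtain ⟨hya1, hya2, hya3, hya4⟩ := hqy _ haL hab
  obtain ⟨hza1, hza2, hza3, hza4⟩ := hqz _ haL hac
  set a := lab x with ha
  set b := lab y with hb
  set c := lab z with hc
  obtain ⟨fx, fxb, fxc, fxd⟩ := exists_override qx hbc (o (qy a)) (o (qz a))
  obtain ⟨fy, fyb, fyc, fyd⟩ := exists_override qy hbc (qy a) b₂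
  obtain ⟨fz, fzb, fzc, fzd⟩ := exists_override qz hbc (o b₁) (qz a)
  have hI : (L.erase a).card = m - 1 := by rw [Finset.card_erase_of_mem haL, h.card_eq]
  have himg : ∀ f : ι → V, (f '' (L.erase a : Finset ι)).ncard ≤ m - 1 := fun f => by
    refine (Set.ncard_image_le).trans ?_
    rw [Set.ncard_coe_finset, hI]
  have hinsert : ∀ (f : ι → V) (s t : V), t ∈ insert s (f '' (L.erase a : Finset ι)) →
      (insert s (f '' (L.erase a : Finset ι)) \ {t}).ncard ≤ m - 1 := fun f s t ht => by
    rw [Set.ncard_sdiff_singleton_of_mem ht]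
    have := Set.ncard_insert_le s (f '' (L.erase a : Finset ι))
    have := himg f
    omega
  have pfx : ∀ d ∈ L, d ≠ a → fx d ∈ R ∧ lab (fx d) = a ∧ lab (o (fx d)) = d := by
    intro d hd hda
    by_cases h1 : d = b
    · rw [h1, fxb]
      exact ⟨h.out_mem _ hya1, hya3, by rw [h.out_out, hya2]⟩
    by_cases h2 : d = c
    · rw [h2, fxc]
      exact ⟨h.out_mem _ hza1, hza3, by rw [h.out_out, hza2]⟩
    rw [fxd d h1 h2]
    obtain ⟨e1, e2, e3, -⟩ := hqx d hd hda
    exact ⟨e1, e2, e3⟩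
  have pfy : ∀ d ∈ L, d ≠ a → fy d ∈ R ∧ lab (fy d) = b ∧
      lab (o (fy d)) = if d = b then a else d := by
    intro d hd hda
    by_cases h1 : d = b
    · rw [if_pos h1, h1, fyb]
      exact ⟨hya1, hya2, hya3⟩
    rw [if_neg h1]
    by_cases h2 : d = c
    · rw [h2, fyc]
      exact ⟨hb₂, l2, l4⟩
    rw [fyd d h1 h2]
    obtain ⟨e1, e2, e3, -⟩ := hqy d hd h1
    exact ⟨e1, e2, e3⟩
  have pfz : ∀ d ∈ L, d ≠ a → fz d ∈ R ∧ lab (fz d) = c ∧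
      lab (o (fz d)) = if d = c then a else d := by
    intro d hd hda
    by_cases h2 : d = c
    · rw [if_pos h2, h2, fzc]
      exact ⟨hza1, hza2, hza3⟩
    rw [if_neg h2]
    by_cases h1 : d = b
    · rw [h1, fzb]
      exact ⟨h.out_mem _ hb₁, l3, by rw [h.out_out, l1]⟩
    rw [fzd d h1 h2]
    obtain ⟨e1, e2, e3, -⟩ := hqz d hd h2
    exact ⟨e1, e2, e3⟩
  have ymem : y ∈ insert b₁ (fy '' (L.erase a : Finset ι)) := by
    by_cases h1 : lab (o y) = a
    · exact Or.inr ⟨b, by simp [hbL, hab.symm], by rw [fyb, hya4 h1]⟩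
    by_cases h2 : lab (o y) = c
    · rcases hyb h2 with e | e
      · exact Or.inl e
      · exact Or.inr ⟨c, by simp [hcL, hac.symm], by rw [fyc, ← e]⟩
    · exact Or.inr ⟨lab (o y), by simp [hoyL, h1],
        by rw [fyd _ hoy h2, (hqy _ hoyL hoy).2.2.2 rfl]⟩
  have zmem : z ∈ insert (o b₂) (fz '' (L.erase a : Finset ι)) := by
    by_cases h1 : lab (o z) = a
    · exact Or.inr ⟨c, by simp [hcL, hac.symm], by rw [fzc, hza4 h1]⟩
    by_cases h2 : lab (o z) = b
    · rcases hzb h2 with e | e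
      · exact Or.inr ⟨b, by simp [hbL, hab.symm], by rw [fzb, ← e]⟩
      · exact Or.inl e
    · exact Or.inr ⟨lab (o z), by simp [hozL, h1],
        by rw [fzd _ h2 hoz, (hqz _ hozL hoz).2.2.2 rfl]⟩
  obtain ⟨A, hA, hAd⟩ := (h.linked a haL).exists_fan (x := x) ⟨hx, rfl⟩
    (W := fx '' (L.erase a : Finset ι)) (by
      rintro _ ⟨d, hd, rfl⟩
      obtain ⟨hda, hd⟩ := Finset.mem_erase.1 hd
      exact ⟨(pfx d hd hda).1, (pfx d hd hda).2.1⟩)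
    ((Set.ncard_le_ncard Set.sdiff_subset).trans (himg fx))
  obtain ⟨B, hB, hBd⟩ := (h.linked b hbL).exists_fan (x := y) ⟨hy, rfl⟩
    (W := insert b₁ (fy '' (L.erase a : Finset ι))) (by
      rintro _ (rfl | ⟨d, hd, rfl⟩)
      · exact ⟨hb₁, l1⟩
      obtain ⟨hda, hd⟩ := Finset.mem_erase.1 hd
      exact ⟨(pfy d hd hda).1, (pfy d hd hda).2.1⟩) (hinsert _ _ _ ymem)
  obtain ⟨D, hD, hDd⟩ := (h.linked c hcL).exists_fan (x := z) ⟨hz, rfl⟩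
    (W := insert (o b₂) (fz '' (L.erase a : Finset ι))) (by
      rintro _ (rfl | ⟨d, hd, rfl⟩)
      · exact ⟨h.out_mem _ hb₂, l4⟩
      obtain ⟨hda, hd⟩ := Finset.mem_erase.1 hd
      exact ⟨(pfz d hd hda).1, (pfz d hd hda).2.1⟩) (hinsert _ _ _ zmem)
  have hA' : ∀ d ∈ L, d ≠ a → fx d ∈ fx '' (L.erase a : Finset ι) := fun d hd hda =>
    ⟨d, by simp [hd, hda], rfl⟩
  have hB' : ∀ d ∈ L, d ≠ a → fy d ∈ insert b₁ (fy '' (L.erase a : Finset ι)) := fun d hd hda =>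
    Or.inr ⟨d, by simp [hd, hda], rfl⟩
  have hD' : ∀ d ∈ L, d ≠ a → fz d ∈ insert (o b₂) (fz '' (L.erase a : Finset ι)) :=
    fun d hd hda => Or.inr ⟨d, by simp [hd, hda], rfl⟩
  have hB₁ : b₁ ∈ insert b₁ (fy '' (L.erase a : Finset ι)) := Or.inl rfl
  have hD₂ : o b₂ ∈ insert (o b₂) (fz '' (L.erase a : Finset ι)) := Or.inl rfl
  obtain ⟨X, Xb, Xc, Xd⟩ := exists_override (layer R lab) hbc (B b₁) (D (o b₂))
  obtain ⟨E, Eb, Ec, Ed⟩ := exists_override (fun _ => (∅ : Set (Sym2 V))) hbc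
    {s(o (qy a), qy a), s(b₁, o b₁)} {s(o (qz a), qz a), s(o b₂, b₂)}
  have notS : ∀ v, lab v ≠ a → lab v ≠ b → lab v ≠ c → v ∉ ({x, y, z} : Set V) := by
    rintro v n1 n2 n3 (rfl | rfl | rfl)
    · exact n1 rfl
    · exact n2 rfl
    · exact n3 rfl
  have fan_notS : ∀ t ∈ ({x, y, z} : Set V), ∀ F : Set V, F ⊆ layer R lab (lab t) \ {t} →
      ∀ v ∈ F, v ∈ R ∧ lab v = lab t ∧ v ∉ ({x, y, z} : Set V) := by
    rintro t ht F hF v hv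
    obtain ⟨⟨hvR, hvt⟩, hne⟩ := hF hv
    refine ⟨hvR, hvt, fun hvS => ?_⟩
    rcases ht with rfl | rfl | rfl <;> rcases hvS with rfl | rfl | rfl
    · exact hne rfl
    · exact hab hvt.symm
    · exact hac hvt.symm
    · exact hab hvt
    · exact hne rfl
    · exact hbc hvt.symm
    · exact hac hvt
    · exact hbc hvt
    · exact hne rfl
  have fan_keep : ∀ t ∈ ({x, y, z} : Set V), ∀ F : Set V, F ⊆ layer R lab (lab t) \ {t} →
      Linked G (insert t F) → ∀ E, Linked (keep G {x, y, z} E) (insert t F) := by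
    intro t ht F hF hl E
    have := fan_notS t ht F hF
    refine hl.keep E ?_
    rintro s (rfl | hs) hsS s' (rfl | hs') hsS'
    · rfl
    · exact absurd hsS' (this s' hs').2.2
    · exact absurd hsS (this s hs).2.2
    · exact absurd hsS (this s hs).2.2
  have mA : ∀ d ∈ L, d ≠ a → ∀ v ∈ A (fx d), v ∈ R ∧ lab v = a ∧ v ∉ ({x, y, z} : Set V) :=
    fun d hd hda => fan_notS x (by simp) _ (hA _ (hA' d hd hda)).1
  have mB : ∀ d ∈ L, d ≠ a → ∀ v ∈ B (fy d), v ∈ R ∧ lab v = b ∧ v ∉ ({x, y, z} : Set V) :=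
    fun d hd hda => fan_notS y (by simp) _ (hB _ (hB' d hd hda)).1
  have mB₁ : ∀ v ∈ B b₁, v ∈ R ∧ lab v = b ∧ v ∉ ({x, y, z} : Set V) :=
    fan_notS y (by simp) _ (hB _ hB₁).1
  have mD : ∀ d ∈ L, d ≠ a → ∀ v ∈ D (fz d), v ∈ R ∧ lab v = c ∧ v ∉ ({x, y, z} : Set V) :=
    fun d hd hda => fan_notS z (by simp) _ (hD _ (hD' d hd hda)).1
  have mD₂ : ∀ v ∈ D (o b₂), v ∈ R ∧ lab v = c ∧ v ∉ ({x, y, z} : Set V) :=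
    fan_notS z (by simp) _ (hD _ hD₂).1
  have mX : ∀ d ∈ L, d ≠ a → ∀ v ∈ X d, v ∈ R ∧ v ∉ ({x, y, z} : Set V) ∧
      (d = b ∧ v ∈ B b₁ ∨ d = c ∧ v ∈ D (o b₂) ∨ d ≠ b ∧ d ≠ c ∧ lab v = d) := by
    intro d hd hda v hv
    by_cases h1 : d = b
    · rw [h1, Xb] at hv
      exact ⟨(mB₁ v hv).1, (mB₁ v hv).2.2, Or.inl ⟨h1, hv⟩⟩
    by_cases h2 : d = c
    · rw [h2, Xc] at hv
      exact ⟨(mD₂ v hv).1, (mD₂ v hv).2.2, Or.inr (Or.inl ⟨h2, hv⟩)⟩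
    rw [Xd d h1 h2] at hv
    exact ⟨hv.1, notS v (hv.2 ▸ hda) (hv.2 ▸ h1) (hv.2 ▸ h2), Or.inr (Or.inr ⟨h1, h2, hv.2⟩)⟩
  have jfx : ∀ d ∈ L, d ≠ a → ∀ d' ∈ L, d' ≠ a → ∀ v ∈ A (fx d), v ∈ A (fx d') → d = d' := by
    intro d hd hda d' hd' hda' v hv hv'
    have e := hAd _ (hA' d hd hda) _ (hA' d' hd' hda') v hv hv'
    rw [← (pfx d hd hda).2.2, e, (pfx d' hd' hda').2.2]
  have jfy : ∀ d ∈ L, d ≠ a → ∀ d' ∈ L, d' ≠ a → ∀ v ∈ B (fy d), v ∈ B (fy d') → d = d' := by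
    intro d hd hda d' hd' hda' v hv hv'
    have e := hBd _ (hB' d hd hda) _ (hB' d' hd' hda') v hv hv'
    have e1 := (pfy d hd hda).2.2
    have e2 := (pfy d' hd' hda').2.2
    rw [e, e2] at e1
    split_ifs at e1 with h1 h2 h2
    · exact h2.trans h1.symm
    · exact absurd e1.symm hda
    · exact absurd e1 hda'
    · exact e1.symm
  have jfz : ∀ d ∈ L, d ≠ a → ∀ d' ∈ L, d' ≠ a → ∀ v ∈ D (fz d), v ∈ D (fz d') → d = d' := by
    intro d hd hda d' hd' hda' v hv hv'
    have e := hDd _ (hD' d hd hda) _ (hD' d' hd' hda') v hv hv'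
    have e1 := (pfz d hd hda).2.2
    have e2 := (pfz d' hd' hda').2.2
    rw [e, e2] at e1
    split_ifs at e1 with h1 h2 h2
    · exact h2.trans h1.symm
    · exact absurd e1.symm hda
    · exact absurd e1 hda'
    · exact e1.symm
  have jb : ∀ d ∈ L, d ≠ a → ∀ v ∈ B (fy d), v ∉ B b₁ := by
    intro d hd hda v hv hv'
    have e := hBd _ (hB' d hd hda) _ hB₁ v hv hv'
    have e1 := (pfy d hd hda).2.2
    rw [e, l3] at e1
    split_ifs at e1 with h1
    · exact hac e1.symm
    · rw [← e1, fyc] at e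
      exact hb₁₂ e.symm
  have jc : ∀ d ∈ L, d ≠ a → ∀ v ∈ D (fz d), v ∉ D (o b₂) := by
    intro d hd hda v hv hv'
    have e := hDd _ (hD' d hd hda) _ hD₂ v hv hv'
    have e1 := (pfz d hd hda).2.2
    rw [e, h.out_out, l2] at e1
    split_ifs at e1 with h1
    · exact hab e1.symm
    · rw [← e1, fzb] at e
      exact hb₁₂ (h.out_inj e)
  refine ⟨(L.erase a : Finset ι), inferInstance, fun d => A (fx d) ∪ B (fy d) ∪ D (fz d) ∪ X d,
    fun d => E d, by rw [Fintype.card_coe, hI], ?_, ?_⟩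
  · rintro ⟨d, hd⟩
    obtain ⟨hda, hd⟩ := Finset.mem_erase.1 hd
    refine ⟨?_, ?_, ?_⟩
    · dsimp only
      have kA := fan_keep x (by simp) _ (hA _ (hA' d hd hda)).1 (hA _ (hA' d hd hda)).2.1 (E d)
      have kB := fan_keep y (by simp) _ (hB _ (hB' d hd hda)).1 (hB _ (hB' d hd hda)).2.1 (E d)
      have kD := fan_keep z (by simp) _ (hD _ (hD' d hd hda)).1 (hD _ (hD' d hd hda)).2.1 (E d)
      have tA := (hA _ (hA' d hd hda)).2.2
      have tB := (hB _ (hB' d hd hda)).2.2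
      have tD := (hD _ (hD' d hd hda)).2.2
      have kB₁ := fan_keep y (by simp) _ (hB _ hB₁).1 (hB _ hB₁).2.1 (E d)
      have kD₂ := fan_keep z (by simp) _ (hD _ hD₂).1 (hD _ hD₂).2.1 (E d)
      have tB₁ := (hB _ hB₁).2.2
      have tD₂ := (hD _ hD₂).2.2
      by_cases h1 : d = b
      · rw [h1, fxb] at kA tA
        rw [h1, fyb] at kB tB
        rw [h1, fzb] at kD tD
        rw [h1] at kB₁
        rw [h1, fxb, fyb, fzb, Xb]
        have s1 := kA.union_of_adj kB tA tB ⟨(h.adj_out (qy a)).symm, fun _ _ => Eb ▸ Or.inl rfl⟩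
        have s2 := s1.union kB₁ ⟨y, Or.inr (Or.inl rfl), Or.inl rfl⟩
        exact linked_triple_union_of_mid
          (s2.union_of_adj kD (Or.inr tB₁) tD ⟨h.adj_out b₁, fun _ _ => Eb ▸ Or.inr rfl⟩)
      by_cases h2 : d = c
      · rw [h2, fxc] at kA tA
        rw [h2, fyc] at kB tB
        rw [h2, fzc] at kD tD
        rw [h2] at kD₂
        rw [h2, fxc, fyc, fzc, Xc]
        have s1 := kA.union_of_adj kD tA tD ⟨(h.adj_out (qz a)).symm, fun _ _ => Ec ▸ Or.inl rfl⟩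
        have s2 := s1.union kD₂ ⟨z, Or.inr (Or.inl rfl), Or.inl rfl⟩
        exact linked_triple_union_of_last (s2.union_of_adj kB (Or.inr tD₂) tB
          ⟨(h.adj_out b₂).symm, fun _ _ => Ec ▸ Or.inr rfl⟩)
      · rw [Xd d h1 h2]
        have hlay : ∀ v ∈ layer R lab d, v ∉ ({x, y, z} : Set V) := fun v hv =>
          notS v (hv.2 ▸ hda) (hv.2 ▸ h1) (hv.2 ▸ h2)
        have kl : Linked G (layer R lab d) := by
          have := h.linked d hd ∅ (by rw [Set.ncard_empty]; omega)
          rwa [Set.sdiff_empty] at this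
        have kX := kl.keep (S := {x, y, z}) (E d) fun s hs hsS => absurd hsS (hlay s hs)
        have oA : o (fx d) ∈ layer R lab d :=
          ⟨h.out_mem _ (pfx d hd hda).1, (pfx d hd hda).2.2⟩
        have oB : o (fy d) ∈ layer R lab d :=
          ⟨h.out_mem _ (pfy d hd hda).1, by rw [(pfy d hd hda).2.2, if_neg h1]⟩
        have oD : o (fz d) ∈ layer R lab d :=
          ⟨h.out_mem _ (pfz d hd hda).1, by rw [(pfz d hd hda).2.2, if_neg h2]⟩
        have s1 := kX.union_of_adj kA oA tA (keep_adj_left (h.adj_out _).symm (hlay _ oA))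
        have s2 := s1.union_of_adj kB (Or.inl oB) tB
          (keep_adj_left (h.adj_out _).symm (hlay _ oB))
        exact linked_triple_union_of_center (s2.union_of_adj kD (Or.inl (Or.inl oD)) tD
          (keep_adj_left (h.adj_out _).symm (hlay _ oD)))
    · rintro v (((hv | hv) | hv) | hv)
      · exact (mA d hd hda v hv).1
      · exact (mB d hd hda v hv).1
      · exact (mD d hd hda v hv).1
      · exact (mX d hd hda v hv).1
    · rintro v (((hv | hv) | hv) | hv)
      · exact (mA d hd hda v hv).2.2
      · exact (mB d hd hda v hv).2.2
      · exact (mD d hd hda v hv).2.2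
      · exact (mX d hd hda v hv).2.1
  · rintro ⟨d, hd⟩ ⟨d', hd'⟩ hne
    obtain ⟨hda, hd⟩ := Finset.mem_erase.1 hd
    obtain ⟨hda', hd'⟩ := Finset.mem_erase.1 hd'
    have hdd : d ≠ d' := fun e => hne (Subtype.ext e)
    have sep : ∀ d ∈ L, d ≠ a → ∀ d' ∈ L, d' ≠ a → d ≠ d' → ∀ v, v ∈ X d →
        v ∉ A (fx d') ∧ v ∉ B (fy d') ∧ v ∉ D (fz d') := by
      intro d hd hda d' hd' hda' hdd v hv
      obtain ⟨-, -, hv⟩ := mX d hd hda v hv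
      refine ⟨fun hv' => ?_, fun hv' => ?_, fun hv' => ?_⟩
      · have := (mA d' hd' hda' v hv').2.1
        rcases hv with ⟨-, hv⟩ | ⟨-, hv⟩ | ⟨-, -, hv⟩
        · exact hab (this.symm.trans (mB₁ v hv).2.1)
        · exact hac (this.symm.trans (mD₂ v hv).2.1)
        · exact hda (hv.symm.trans this)
      · have := (mB d' hd' hda' v hv').2.1
        rcases hv with ⟨-, hv⟩ | ⟨-, hv⟩ | ⟨n1, -, hv⟩
        · exact jb d' hd' hda' v hv' hv
        · exact hbc (this.symm.trans (mD₂ v hv).2.1)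
        · exact n1 (hv.symm.trans this)
      · have := (mD d' hd' hda' v hv').2.1
        rcases hv with ⟨-, hv⟩ | ⟨-, hv⟩ | ⟨-, n2, hv⟩
        · exact hbc ((mB₁ v hv).2.1.symm.trans this)
        · exact jc d' hd' hda' v hv' hv
        · exact n2 (hv.symm.trans this)
    refine ⟨?_, ?_⟩
    · rintro v hv hv'
      rcases hv with ((hv | hv) | hv) | hv <;> rcases hv' with ((hv' | hv') | hv') | hv'
      · exact hdd (jfx d hd hda d' hd' hda' v hv hv')
      · exact hab ((mA d hd hda v hv).2.1.symm.trans (mB d' hd' hda' v hv').2.1)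
      · exact hac ((mA d hd hda v hv).2.1.symm.trans (mD d' hd' hda' v hv').2.1)
      · exact (sep d' hd' hda' d hd hda hdd.symm v hv').1 hv
      · exact hab ((mA d' hd' hda' v hv').2.1.symm.trans (mB d hd hda v hv).2.1)
      · exact hdd (jfy d hd hda d' hd' hda' v hv hv')
      · exact hbc ((mB d hd hda v hv).2.1.symm.trans (mD d' hd' hda' v hv').2.1)
      · exact (sep d' hd' hda' d hd hda hdd.symm v hv').2.1 hv
      · exact hac ((mA d' hd' hda' v hv').2.1.symm.trans (mD d hd hda v hv).2.1)
      · exact hbc ((mB d' hd' hda' v hv').2.1.symm.trans (mD d hd hda v hv).2.1)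
      · exact hdd (jfz d hd hda d' hd' hda' v hv hv')
      · exact (sep d' hd' hda' d hd hda hdd.symm v hv').2.2 hv
      · exact (sep d hd hda d' hd' hda' hdd v hv).1 hv'
      · exact (sep d hd hda d' hd' hda' hdd v hv).2.1 hv'
      · exact (sep d hd hda d' hd' hda' hdd v hv).2.2 hv'
      · obtain ⟨-, -, hv⟩ := mX d hd hda v hv
        obtain ⟨-, -, hv'⟩ := mX d' hd' hda' v hv'
        rcases hv with ⟨e, hv⟩ | ⟨e, hv⟩ | ⟨n1, n2, hv⟩ <;>
          rcases hv' with ⟨e', hv'⟩ | ⟨e', hv'⟩ | ⟨n1', n2', hv'⟩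
        · exact hdd (e.trans e'.symm)
        · exact hbc ((mB₁ v hv).2.1.symm.trans (mD₂ v hv').2.1)
        · exact n1' (hv'.symm.trans (mB₁ v hv).2.1)
        · exact hbc ((mB₁ v hv').2.1.symm.trans (mD₂ v hv).2.1)
        · exact hdd (e.trans e'.symm)
        · exact n2' (hv'.symm.trans (mD₂ v hv).2.1)
        · exact n1 (hv.symm.trans (mB₁ v hv').2.1)
        · exact n2 (hv.symm.trans (mD₂ v hv').2.1)
        · exact hdd (hv.symm.trans hv')
    · have hdisj : ∀ e ∈ E b, e ∉ E c := by
        rw [Eb, Ec]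
        rintro e (rfl | rfl) (he | he) <;> rcases Sym2.eq_iff.1 he with ⟨e1, e2⟩ | ⟨e1, e2⟩
        · rw [e2] at hya2; exact hbc (hya2.symm.trans hza2)
        · rw [e1] at hya3; exact hac (hya3.symm.trans hza2)
        · rw [e1] at hya3; exact hac (hya3.symm.trans l4)
        · rw [e1] at hya3; exact hab (hya3.symm.trans l2)
        · rw [e1] at l1; exact hab (hza3.symm.trans l1)
        · rw [e1] at l1; exact hbc (l1.symm.trans hza2)
        · rw [e1] at l1; exact hbc (l1.symm.trans l4)
        · exact hb₁₂ e1
      intro e he he'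
      dsimp only at he he'
      by_cases h1 : d = b
      · by_cases h2' : d' = c
        · rw [h1] at he
          rw [h2'] at he'
          exact hdisj e he he'
        · rw [Ed d' (fun e => hdd (h1.trans e.symm)) h2'] at he'
          exact he'
      by_cases h2 : d = c
      · by_cases h1' : d' = b
        · rw [h2] at he
          rw [h1'] at he'
          exact hdisj e he' he
        · rw [Ed d' h1' (fun e => hdd (h2.trans e.symm))] at he'
          exact he'
      · rw [Ed d h1 h2] at he
        exact he

theorem packs_self (h : Layered G R L lab o m) {S : Set V} (hS : S ⊆ R) (hS3 : S.ncard = 3) :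
    Packs G R S (m - 1) := by
  obtain ⟨x, y, z, hxy, hxz, hyz, rfl⟩ := Set.ncard_eq_three.1 hS3
  have hx : x ∈ R := hS (by simp)
  have hy : y ∈ R := hS (by simp)
  have hz : z ∈ R := hS (by simp)
  by_cases h1 : lab x = lab y
  · by_cases h2 : lab z = lab x
    · refine h.packs_of_eq (h.lab_mem x hx) ?_ hS3
      rintro v (rfl | rfl | rfl)
      · exact ⟨hx, rfl⟩
      · exact ⟨hy, h1.symm⟩
      · exact ⟨hz, h2⟩
    · exact h.packs_of_pair hx hy hz hxy h1.symm h2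
  by_cases h2 : lab x = lab z
  · have := h.packs_of_pair hx hz hy hxz h2.symm (Ne.symm h1)
    rwa [Set.pair_comm] at this
  by_cases h3 : lab y = lab z
  · have := h.packs_of_pair hy hz hx hyz h3.symm h1
    rwa [Set.pair_comm z x, Set.insert_comm] at this
  · exact h.packs_of_ne hx hy hz h1 h2 h3

end Layered
end Layers

section Trees

variable {V : Type*} {G : SimpleGraph V}

theorem mem_of_connected {K : SimpleGraph V} (hK : K.Preconnected) {U : Set V}
    (hU : ∀ u v, K.Adj u v → u ∈ U → v ∈ U) {a : V} (ha : a ∈ U) (b : V) : b ∈ U := by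
  obtain ⟨p⟩ := hK a b
  induction p with
  | nil => exact ha
  | cons hadj _ ih => exact ih (hU _ _ hadj ha)

theorem Linked.connected_induce {K : SimpleGraph V} {C : Set V} (h : Linked K C)
    (hC : C.Nonempty) : (K.induce C).Connected := by
  have : Nonempty C := hC.to_subtype
  refine ⟨fun a b => ?_⟩
  by_contra hab
  obtain ⟨u, hu, v, hv, ⟨hu', hau⟩, hvU, hadj⟩ := h {v | ∃ hv : v ∈ C, (K.induce C).Reachable a ⟨v, hv⟩}
    ⟨a, a.2, a.2, SimpleGraph.Reachable.refl a⟩ ⟨b, b.2, fun ⟨_, hb⟩ => hab hb⟩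
  refine hvU ⟨hv, hau.trans (SimpleGraph.Adj.reachable ?_)⟩
  exact hadj

theorem Linked.exists_tree {K : SimpleGraph V} {C : Set V} (h : Linked K C) (hC : C.Nonempty)
    (hKG : K ≤ G) : ∃ T : G.Subgraph, T.verts = C ∧ T.coe.IsTree ∧ ∀ u v, T.Adj u v → K.Adj u v := by
  obtain ⟨F, hF, hT⟩ := (h.connected_induce hC).exists_isTree_le
  refine ⟨{
    verts := C
    Adj := fun u v => ∃ (hu : u ∈ C) (hv : v ∈ C), F.Adj ⟨u, hu⟩ ⟨v, hv⟩
    adj_sub := fun ⟨_, _, hadj⟩ => hKG (hF hadj)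
    edge_vert := fun ⟨hu, _⟩ => hu
    symm := ⟨fun _ _ ⟨hu, hv, hadj⟩ => ⟨hv, hu, hadj.symm⟩⟩ }, rfl, ?_,
    fun u v ⟨_, _, hadj⟩ => hF hadj⟩
  convert hT using 1
  ext u v
  exact ⟨fun ⟨_, _, hadj⟩ => hadj, fun hadj => ⟨u.2, v.2, hadj⟩⟩

theorem Packs.exists_family {R S : Set V} {k : ℕ} (h : Packs G R S k) (hS : S.Nonempty) :
    ∃ T : Fin k → G.Subgraph, IsIDSTFamily G S T := by
  obtain ⟨β, _, C, E, rfl, h1, h2⟩ := h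
  have : ∀ i, ∃ T : G.Subgraph, T.verts = S ∪ C i ∧ T.coe.IsTree ∧
      ∀ u v, T.Adj u v → (keep G S (E i)).Adj u v := fun i =>
    (h1 i).1.exists_tree (hS.mono Set.subset_union_left) fun _ _ hadj => hadj.1
  choose T hV hT hE using this
  have e := (Fintype.equivFin β).symm
  have hVV : ∀ i j, i ≠ j → (T i).verts ∩ (T j).verts = S := by
    intro i j hij
    rw [hV, hV]
    ext v
    constructor
    · rintro ⟨hv | hv, hv' | hv'⟩
      · exact hv
      · exact hv
      · exact hv'
      · exact absurd hv' ((h2 i j hij).1 v hv)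
    · exact fun hv => ⟨Or.inl hv, Or.inl hv⟩
  refine ⟨fun i => T (e i), fun i => ⟨hV (e i) ▸ Set.subset_union_left, hT _⟩, fun i j hij => ?_⟩
  have hij' : e i ≠ e j := fun h => hij (e.injective h)
  refine ⟨hVV _ _ hij', Set.eq_empty_iff_forall_notMem.2 fun d hd => ?_⟩
  induction d with | _ u v
  obtain ⟨hi, hj⟩ := hd
  have hu : u ∈ S := hVV _ _ hij' ▸ ⟨(T (e i)).edge_vert hi, (T (e j)).edge_vert hj⟩
  have hv : v ∈ S := hVV _ _ hij' ▸ ⟨(T (e i)).edge_vert hi.symm, (T (e j)).edge_vert hj.symm⟩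
  exact (h2 _ _ hij').2 _ ((hE _ u v hi).2 hu hv) ((hE _ u v hj).2 hu hv)

namespace IsIDSTFamily

variable {S : Set V} {r : ℕ} {T : Fin r → G.Subgraph}

theorem eq_of_adj (h : IsIDSTFamily G S T) {i j : Fin r} {u v : V} (hi : (T i).Adj u v)
    (hj : (T j).Adj u v) : i = j := by
  by_contra hij
  have : s(u, v) ∈ (T i).edgeSet ∩ (T j).edgeSet := ⟨hi, hj⟩
  rw [(h.2 i j hij).2] at this
  exact this

theorem exists_adj (h : IsIDSTFamily G S T) {x y : V} (hx : x ∈ S) (hy : y ∈ S) (hxy : x ≠ y)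
    (i : Fin r) : ∃ w, (T i).Adj x w := by
  by_contra hno
  push Not at hno
  have := mem_of_connected (h.1 i).2.connected.preconnected (U := {v | (v : V) = x})
    (fun u v huv hu => absurd huv (by
      have hu : (u : V) = x := hu
      rw [SimpleGraph.Subgraph.coe_adj, hu]
      exact hno v)) (a := ⟨x, (h.1 i).1 hx⟩) rfl ⟨y, (h.1 i).1 hy⟩
  exact hxy this.symm

theorem exists_injective (h : IsIDSTFamily G S T) {x y : V} (hx : x ∈ S) (hy : y ∈ S)
    (hxy : x ≠ y) : ∃ f : Fin r → G.neighborSet x, Function.Injective f ∧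
      ∀ i, (T i).Adj x (f i) := by
  choose f hf using h.exists_adj hx hy hxy
  refine ⟨fun i => ⟨f i, (hf i).adj_sub⟩, fun i j hij => ?_, hf⟩
  have hij : f i = f j := congrArg Subtype.val hij
  exact h.eq_of_adj (hf i) (hij ▸ hf j)

variable [Finite V]

theorem le_ncard_neighborSet (h : IsIDSTFamily G S T) {x y : V} (hx : x ∈ S) (hy : y ∈ S)
    (hxy : x ≠ y) : r ≤ (G.neighborSet x).ncard := by
  obtain ⟨f, hf, -⟩ := h.exists_injective hx hy hxy
  simpa using Nat.card_le_card_of_injective f hf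

theorem exists_unique_adj (h : IsIDSTFamily G S T) {x y : V} (hx : x ∈ S) (hy : y ∈ S)
    (hxy : x ≠ y) (hr : (G.neighborSet x).ncard ≤ r) {w : V} (hw : G.Adj x w) :
    ∃ i, (T i).Adj x w ∧ ∀ v, (T i).Adj x v → v = w := by
  obtain ⟨f, hf, hT⟩ := h.exists_injective hx hy hxy
  have hsurj : Function.Surjective f :=
    ((Nat.bijective_iff_injective_and_card f).2 ⟨hf, le_antisymm
      (Nat.card_le_card_of_injective f hf) (by simpa using hr)⟩).2
  obtain ⟨i, hi⟩ := hsurj ⟨w, hw⟩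
  have hiw := hT i
  rw [hi] at hiw
  refine ⟨i, hiw, fun v hv => ?_⟩
  obtain ⟨j, hj⟩ := hsurj ⟨v, hv.adj_sub⟩
  have hjv := hT j
  rw [hj] at hjv
  have := h.eq_of_adj hv hjv
  rw [← this, hi] at hj
  exact (congrArg Subtype.val hj).symm

theorem lt_of_adj (h : IsIDSTFamily G S T) {x y z : V} (hx : x ∈ S) (hy : y ∈ S) (hz : z ∈ S)
    (hzx : z ≠ x) (hzy : z ≠ y) (hadj : G.Adj x y) {d : ℕ}
    (hd : ∀ v, (G.neighborSet v).ncard ≤ d) : r < d := by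
  by_contra! hr
  obtain ⟨i, hi, hi'⟩ := h.exists_unique_adj hx hy hadj.ne ((hd x).trans hr) hadj
  obtain ⟨j, hj, hj'⟩ := h.exists_unique_adj hy hx hadj.ne' ((hd y).trans hr) hadj.symm
  obtain rfl := h.eq_of_adj hi hj.symm
  have := mem_of_connected (h.1 i).2.connected.preconnected (U := {v | (v : V) = x ∨ (v : V) = y})
    (fun u v huv hu => by
      rw [SimpleGraph.Subgraph.coe_adj] at huv
      rcases hu with hu | hu <;> rw [hu] at huv
      · exact Or.inr (hi' v huv)
      · exact Or.inl (hj' v huv)) (a := ⟨x, (h.1 i).1 hx⟩) (Or.inl rfl) ⟨z, (h.1 i).1 hz⟩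
  exact this.elim hzx hzy

end IsIDSTFamily

variable [Finite V]

theorem Packs.le_maxIDST {R S : Set V} {k : ℕ} (h : Packs G R S k) {x y : V} (hx : x ∈ S)
    (hy : y ∈ S) (hxy : x ≠ y) : k ≤ maxIDST G S :=
  le_csSup ⟨(G.neighborSet x).ncard, fun _ ⟨_, hT⟩ => hT.le_ncard_neighborSet hx hy hxy⟩
    (h.exists_family ⟨x, hx⟩)

theorem maxIDST_lt {S : Set V} {x y z : V} (hx : x ∈ S) (hy : y ∈ S) (hz : z ∈ S)
    (hzx : z ≠ x) (hzy : z ≠ y) (hadj : G.Adj x y) {d : ℕ}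
    (hd : ∀ v, (G.neighborSet v).ncard ≤ d) : maxIDST G S < d := by
  obtain ⟨T, hT⟩ : maxIDST G S ∈ {r : ℕ | ∃ T : Fin r → G.Subgraph, IsIDSTFamily G S T} :=
    Nat.sSup_mem ⟨0, fun i => i.elim0, fun i => i.elim0, fun i => i.elim0⟩
      ⟨(G.neighborSet x).ncard, fun _ ⟨_, hT⟩ => hT.le_ncard_neighborSet hx hy hadj.ne⟩
  exact hT.lt_of_adj hx hy hz hzx hzy hadj hd

end Trees

section Generators

open Equiv

/-- The involution (12)(3k). -/
def crossing {n : ℕ} (hn : 3 ≤ n) (k : Fin n) : Perm (Fin n) := perm12 n hn * swap ⟨2, by omega⟩ k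

variable {n : ℕ} {hn : 3 ≤ n}

theorem perm12_apply_of_two_le {j : Fin n} (hj : 2 ≤ (j : ℕ)) : perm12 n hn j = j :=
  swap_apply_of_ne_of_ne (fun h => by simp [h] at hj) (fun h => by simp [h] at hj)

theorem perm12_zero : perm12 n hn ⟨0, by omega⟩ = ⟨1, by omega⟩ := swap_apply_left _ _

theorem perm12_one : perm12 n hn ⟨1, by omega⟩ = ⟨0, by omega⟩ := swap_apply_right _ _

theorem perm12_mul_self : perm12 n hn * perm12 n hn = 1 := swap_mul_self _ _

theorem perm123_zero : perm123 n hn ⟨0, by omega⟩ = ⟨1, by omega⟩ := by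
  rw [perm123, Perm.mul_apply, swap_apply_left, swap_apply_of_ne_of_ne] <;> simp

theorem perm123_one : perm123 n hn ⟨1, by omega⟩ = ⟨2, by omega⟩ := by
  rw [perm123, Perm.mul_apply, swap_apply_right, swap_apply_left]

theorem perm123_two : perm123 n hn ⟨2, by omega⟩ = ⟨0, by omega⟩ := by
  simp [perm123, swap_apply_def]

theorem perm123_apply_of_three_le {j : Fin n} (hj : 3 ≤ (j : ℕ)) : perm123 n hn j = j := by
  rw [perm123, Perm.mul_apply, swap_apply_of_ne_of_ne (x := j), swap_apply_of_ne_of_ne] <;>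
    (rintro rfl; simp at hj)

theorem perm132_eq_inv : perm132 n hn = (perm123 n hn)⁻¹ := by
  rw [perm123, mul_inv_rev, swap_inv, swap_inv, perm132]

theorem perm12_mul_perm132 : perm12 n hn * perm132 n hn = perm123 n hn * perm12 n hn := by
  simp [perm12, perm132, perm123, ← mul_assoc]

theorem cases_index (j : Fin n) : j = ⟨0, by omega⟩ ∨ j = ⟨1, by omega⟩ ∨ j = ⟨2, by omega⟩ ∨
    3 ≤ (j : ℕ) := by
  simp only [Fin.ext_iff]
  omega

theorem perm123_pow_three : perm123 n hn ^ 3 = 1 := by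
  ext j : 1
  rcases cases_index (hn := hn) j with rfl | rfl | rfl | hj
  · simp [pow_succ, perm123_zero, perm123_one, perm123_two]
  · simp [pow_succ, perm123_zero, perm123_one, perm123_two]
  · simp [pow_succ, perm123_zero, perm123_one, perm123_two]
  · simp [pow_succ, perm123_apply_of_three_le hj]

variable {k : Fin n}

theorem crossing_two (hk : 3 ≤ (k : ℕ)) : crossing hn k ⟨2, by omega⟩ = k := by
  rw [crossing, Perm.mul_apply, swap_apply_left, perm12_apply_of_two_le (by omega)]

theorem crossing_self : crossing hn k k = ⟨2, by omega⟩ := by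
  rw [crossing, Perm.mul_apply, swap_apply_right, perm12_apply_of_two_le (by simp)]

theorem crossing_zero (hk : 3 ≤ (k : ℕ)) : crossing hn k ⟨0, by omega⟩ = ⟨1, by omega⟩ := by
  rw [crossing, Perm.mul_apply, swap_apply_of_ne_of_ne, perm12_zero]
  · simp
  · intro h
    simp [← h] at hk

theorem crossing_one (hk : 3 ≤ (k : ℕ)) : crossing hn k ⟨1, by omega⟩ = ⟨0, by omega⟩ := by
  rw [crossing, Perm.mul_apply, swap_apply_of_ne_of_ne, perm12_one]
  · simp
  · intro h
    simp [← h] at hk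

theorem crossing_of_ne {j : Fin n} (hj : 3 ≤ (j : ℕ)) (hjk : j ≠ k) : crossing hn k j = j := by
  rw [crossing, Perm.mul_apply, swap_apply_of_ne_of_ne (by rintro rfl; simp at hj) hjk,
    perm12_apply_of_two_le (by omega)]

theorem crossing_mul_self (hk : 3 ≤ (k : ℕ)) : crossing hn k * crossing hn k = 1 := by
  ext j : 1
  rcases cases_index (hn := hn) j with rfl | rfl | rfl | hj
  · simp [crossing_zero hk, crossing_one hk]
  · simp [crossing_zero hk, crossing_one hk]
  · simp [crossing_two hk, crossing_self]
  · by_cases hjk : j = k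
    · subst hjk
      simp [crossing_two hk, crossing_self]
    · simp [crossing_of_ne hj hjk]

theorem inv_mem_OmegaStar {s : Perm (Fin n)} (hs : s ∈ OmegaStar n hn) : s⁻¹ ∈ OmegaStar n hn := by
  rcases hs with (rfl | rfl | rfl) | ⟨k, hk, rfl⟩
  · rw [inv_eq_of_mul_eq_one_left perm12_mul_self]
    exact Or.inl (Or.inl rfl)
  · rw [← perm132_eq_inv]
    exact Or.inl (Or.inr (Or.inr rfl))
  · rw [perm132_eq_inv, inv_inv]
    exact Or.inl (Or.inr (Or.inl rfl))
  · rw [← crossing, inv_eq_of_mul_eq_one_left (crossing_mul_self hk)]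
    exact Or.inr ⟨k, hk, rfl⟩

theorem adj_mul {s : Perm (Fin n)} (hs : s ∈ OmegaStar n hn) (h1 : s ≠ 1) (u : Perm (Fin n)) :
    (godanGraph n hn).Adj u (u * s) := by
  rw [godanGraph, SimpleGraph.fromRel_adj]
  exact ⟨fun h => h1 (left_eq_mul.1 h), Or.inr ⟨s, hs, rfl⟩⟩

theorem ncard_neighborSet_le (u : Perm (Fin n)) : ((godanGraph n hn).neighborSet u).ncard ≤ n := by
  have hsub : (godanGraph n hn).neighborSet u ⊆ (u * ·) '' OmegaStar n hn := by
    intro v hv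
    rw [SimpleGraph.mem_neighborSet, godanGraph, SimpleGraph.fromRel_adj] at hv
    obtain ⟨-, ⟨s, hs, rfl⟩ | ⟨s, hs, rfl⟩⟩ := hv
    · exact ⟨s⁻¹, inv_mem_OmegaStar hs, by simp⟩
    · exact ⟨s, hs, rfl⟩
  have hthree : ({perm12 n hn, perm123 n hn, perm132 n hn} : Set (Perm (Fin n))).ncard ≤ 3 :=
    Set.ncard_insert_le _ _ |>.trans (by
      have := Set.ncard_insert_le (perm123 n hn) {perm132 n hn}
      rw [Set.ncard_singleton] at this
      omega)
  have hrest : {s | ∃ k : Fin n, 3 ≤ (k : ℕ) ∧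
      s = perm12 n hn * swap ⟨2, by omega⟩ k}.ncard ≤ n - 3 := by
    have himg : {s | ∃ k : Fin n, 3 ≤ (k : ℕ) ∧ s = perm12 n hn * swap ⟨2, by omega⟩ k} ⊆
        crossing hn '' {k | 3 ≤ (k : ℕ)} := by
      rintro s ⟨k, hk, rfl⟩
      exact ⟨k, hk, rfl⟩
    refine (Set.ncard_le_ncard himg).trans ((Set.ncard_image_le).trans ?_)
    have := Set.ncard_le_ncard_of_injOn (s := {k : Fin n | 3 ≤ (k : ℕ)})
      (t := (Finset.Ico 3 n : Set ℕ)) (fun k => (k : ℕ)) (fun k hk => by simpa using hk)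
      (fun a _ b _ hab => Fin.ext hab)
    rwa [Set.ncard_coe_finset, Nat.card_Ico] at this
  refine (Set.ncard_le_ncard hsub).trans ((Set.ncard_image_le).trans
    ((Set.ncard_union_le _ _).trans ?_))
  omega

theorem adj_mul_crossing (hk : 3 ≤ (k : ℕ)) (u : Perm (Fin n)) : (godanGraph n hn).Adj u (u * crossing hn k) := by
  refine adj_mul (Or.inr ⟨k, hk, rfl⟩) (fun h => ?_) u
  have := crossing_zero (hn := hn) hk
  rw [crossing, h] at this
  simp at this

theorem adj_mul_perm12 (u : Perm (Fin n)) : (godanGraph n hn).Adj u (u * perm12 n hn) := by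
  refine adj_mul (Or.inl (Or.inl rfl)) (fun h => ?_) u
  have := perm12_zero (hn := hn)
  rw [h] at this
  simp at this

theorem adj_mul_perm123 (u : Perm (Fin n)) : (godanGraph n hn).Adj u (u * perm123 n hn) := by
  refine adj_mul (Or.inl (Or.inr (Or.inl rfl))) (fun h => ?_) u
  have := perm123_zero (hn := hn)
  rw [h] at this
  simp at this

end Generators

section Regions

open Equiv

variable {n : ℕ} {hn : 3 ≤ n}

/-- The permutations agreeing with `w` on all indices at least `m`. -/
def region (m : ℕ) (w : Perm (Fin n)) : Set (Perm (Fin n)) := {u | ∀ j : Fin n, m ≤ (j : ℕ) → u j = w j}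

theorem layer_region {m : ℕ} {w u : Perm (Fin n)} {k : Fin n} (hk : (k : ℕ) + 1 = m)
    (hu : u ∈ region m w) : layer (region m w) (fun v => v k) (u k) = region k u := by
  ext v
  constructor
  · rintro ⟨hv, hvk⟩ j hj
    rcases eq_or_ne j k with rfl | hjk
    · exact hvk
    · have : m ≤ (j : ℕ) := by
        have := Fin.val_ne_of_ne hjk
        omega
      rw [hv j this, hu j this]
  · intro hv
    exact ⟨fun j hj => by rw [hv j (by omega), hu j hj], hv k le_rfl⟩

/-- The properties of regions that are proved by induction on their size. -/
def GoodRegions (hn : 3 ≤ n) (m : ℕ) : Prop :=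
  ∀ w : Perm (Fin n), KLinked (godanGraph n hn) (region m w) m ∧ m < (region m w).ncard ∧
    ∀ S ⊆ region m w, S.ncard = 3 → Packs (godanGraph n hn) (region m w) S (m - 1)

theorem layered_region {m : ℕ} (hm : 4 ≤ m) {k : Fin n} (hk : (k : ℕ) + 1 = m)
    (h : GoodRegions hn (m - 1)) (w : Perm (Fin n)) :
    Layered (godanGraph n hn) (region m w) ((Finset.univ.filter fun j : Fin n => (j : ℕ) < m).map
      w.toEmbedding) (fun u => u k) (fun u => u * crossing hn k) m := by
  have hk3 : 3 ≤ (k : ℕ) := by omega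
  have hkm : (k : ℕ) = m - 1 := by omega
  have hmem : ∀ i : Fin n, i ∈ (Finset.univ.filter fun j : Fin n => (j : ℕ) < m).map w.toEmbedding →
      ∃ p : Fin n, (p : ℕ) < m ∧ w p = i := by
    intro i hi
    obtain ⟨p, hp, rfl⟩ := Finset.mem_map.1 hi
    exact ⟨p, (Finset.mem_filter.1 hp).2, rfl⟩
  have hlayer : ∀ i ∈ (Finset.univ.filter fun j : Fin n => (j : ℕ) < m).map w.toEmbedding,
      ∃ u, layer (region m w) (fun v => v k) i = region (m - 1) u := by
    intro i hi
    obtain ⟨p, hp, rfl⟩ := hmem i hi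
    have hu : w * swap k p ∈ region m w := fun j hj => by
      rw [Perm.mul_apply, swap_apply_of_ne_of_ne]
      · rintro rfl; omega
      · rintro rfl; omega
    have := layer_region hk hu
    rw [Perm.mul_apply, swap_apply_left, hkm] at this
    exact ⟨_, this⟩
  refine ⟨hm, ?_, ?_, ?_, ?_, ?_, ?_, ?_, ?_, ?_, ?_⟩
  · rw [Finset.card_map, Fin.card_filter_val_lt]
    omega
  · intro u hu
    simp only [Finset.mem_map_equiv, Finset.mem_filter, Finset.mem_univ, true_and]
    by_contra! hj
    have := hu _ hj
    rw [apply_symm_apply, u.injective.eq_iff] at this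
    rw [this] at hj
    omega
  · intro u hu j hj
    rw [Perm.mul_apply, crossing_of_ne (by omega) (by rintro rfl; omega), hu j hj]
  · intro u
    rw [mul_assoc, crossing_mul_self hk3, mul_one]
  · intro u hu
    rw [Perm.mul_apply, crossing_self, u.injective.ne_iff, Ne, Fin.ext_iff]
    dsimp only
    omega
  · exact adj_mul_crossing hk3
  · intro i hi j hj hij
    obtain ⟨p, hp, rfl⟩ := hmem i hi
    obtain ⟨q, hq, rfl⟩ := hmem j hj
    have hpq : p ≠ q := fun e => hij (e ▸ rfl)
    have hk2 : k ≠ ⟨2, by omega⟩ := by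
      rw [Ne, Fin.ext_iff]
      dsimp only
      omega
    have hkr : k ≠ swap k p q := fun e => hpq (by
      have := congrArg (swap k p) e
      rwa [swap_apply_left, swap_apply_self] at this)
    have hfix : ∀ j : Fin n, m ≤ (j : ℕ) → swap k p j = j := fun j hj =>
      swap_apply_of_ne_of_ne (by rintro rfl; omega) (by rintro rfl; omega)
    set u := w * swap k p * swap ⟨2, by omega⟩ (swap k p q) with hu
    have huk : u k = w p := by
      rw [hu, Perm.mul_apply, swap_apply_of_ne_of_ne hk2 hkr, Perm.mul_apply, swap_apply_left]
    have hu2 : u ⟨2, by omega⟩ = w q := by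
      rw [hu, Perm.mul_apply, swap_apply_left, Perm.mul_apply, swap_apply_self]
    have huR : u ∈ region m w := fun j hj => by
      rw [hu, Perm.mul_apply, swap_apply_of_ne_of_ne, Perm.mul_apply, hfix j hj]
      · rintro rfl
        simp only at hj
        omega
      · intro e
        have := congrArg (swap k p) e
        rw [swap_apply_self, hfix j hj] at this
        rw [this] at hj
        omega
    refine ⟨u, huR, u * perm12 n hn, fun j hj => ?_, ?_, huk, ?_, ?_, ?_⟩
    · rw [Perm.mul_apply, perm12_apply_of_two_le (by omega), huR j hj]
    · exact (adj_mul_perm12 (hn := hn) u).ne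
    · rw [Perm.mul_apply, perm12_apply_of_two_le (by omega), huk]
    · rw [Perm.mul_apply, crossing_self, hu2]
    · rw [Perm.mul_apply, crossing_self, Perm.mul_apply, perm12_apply_of_two_le le_rfl, hu2]
  · intro i hi
    obtain ⟨u, hu⟩ := hlayer i hi
    rw [hu]
    exact (h u).1
  · intro i hi
    obtain ⟨u, hu⟩ := hlayer i hi
    rw [hu]
    exact (h u).2.1
  · intro i hi
    obtain ⟨u, hu⟩ := hlayer i hi
    rw [hu]
    exact (h u).2.2

end Regions

section Prism

/-- Adjacency in the triangular prism. -/
def PrismAdj (x y : Fin 3 × Bool) : Prop := x.1 ≠ y.1 ∧ x.2 = y.2 ∨ x.1 = y.1 ∧ x.2 ≠ y.2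

instance : DecidableRel PrismAdj := fun x y =>
  inferInstanceAs (Decidable (x.1 ≠ y.1 ∧ x.2 = y.2 ∨ x.1 = y.1 ∧ x.2 ≠ y.2))

/-- Any two points of `C` are joined by a path of length at most three in `C` along `r`. -/
def ShortlyLinked {α : Type*} (r : α → α → Prop) (C : Finset α) : Prop :=
  ∀ x ∈ C, ∀ y ∈ C, ∃ p ∈ C, ∃ q ∈ C, (x = p ∨ r x p) ∧ (p = q ∨ r p q) ∧ (q = y ∨ r q y)

instance {α : Type*} [DecidableEq α] (r : α → α → Prop) [DecidableRel r] (C : Finset α) :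
    Decidable (ShortlyLinked r C) :=
  inferInstanceAs (Decidable (∀ x ∈ C, ∀ y ∈ C, ∃ p ∈ C, ∃ q ∈ C,
    (x = p ∨ r x p) ∧ (p = q ∨ r p q) ∧ (q = y ∨ r q y)))

theorem prism_sdiff_shortlyLinked : ∀ F : Finset (Fin 3 × Bool), F.card < 3 →
    ShortlyLinked PrismAdj Fᶜ := by
  decide +kernel

theorem prism_exists_packing : ∀ S : Finset (Fin 3 × Bool), S.card = 3 →
    ∃ a b c : Fin 3 × Bool, Disjoint {a, b, c} S ∧ ShortlyLinked PrismAdj ({a, b, c}ᶜ) ∧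
      ShortlyLinked (fun x y => PrismAdj x y ∧ (x ∈ S → y ∉ S)) (S ∪ {a, b, c}) := by
  decide +kernel

theorem ShortlyLinked.linked_image {α V : Type*} {r : α → α → Prop} {C : Finset α}
    (h : ShortlyLinked r C) {K : SimpleGraph V} {φ : α → V}
    (hφ : ∀ x y, r x y → K.Adj (φ x) (φ y)) : Linked K (φ '' C) := by
  rintro U ⟨_, ⟨x, hx, rfl⟩, hxU⟩ ⟨_, ⟨y, hy, rfl⟩, hyU⟩
  by_contra hcon
  have step : ∀ p ∈ C, ∀ q ∈ C, (p = q ∨ r p q) → φ p ∈ U → φ q ∈ U := by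
    rintro p hp q hq (rfl | hpq) hpU
    · exact hpU
    · by_contra hqU
      exact hcon ⟨_, ⟨p, hp, rfl⟩, _, ⟨q, hq, rfl⟩, hpU, hqU, hφ p q hpq⟩
  obtain ⟨p, hp, q, hq, h1, h2, h3⟩ := h x hx y hy
  exact hyU (step q hq y hy h3 (step p hp q hq h2 (step x hx p hp h1 hxU)))

end Prism

section Base

open Equiv

variable {n : ℕ} {hn : 3 ≤ n}

/-- The vertices of the copy of the prism through `w`, running around the triangles. -/
def prismVertex (hn : 3 ≤ n) (w : Perm (Fin n)) (i : ℕ) (b : Bool) : Perm (Fin n) :=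
  w * perm123 n hn ^ i * perm12 n hn ^ b.toNat

theorem prismVertex_add_three (w : Perm (Fin n)) (i : ℕ) (b : Bool) :
    prismVertex hn w (i + 3) b = prismVertex hn w i b := by
  rw [prismVertex, pow_add, perm123_pow_three, mul_one, prismVertex]

theorem adj_prismVertex_succ (w : Perm (Fin n)) (i : ℕ) (b : Bool) :
    (godanGraph n hn).Adj (prismVertex hn w i b) (prismVertex hn w (i + 1) b) := by
  cases b
  · convert adj_mul_perm123 (hn := hn) (prismVertex hn w i false) using 1
    simp [prismVertex, pow_succ, mul_assoc]
  · have : prismVertex hn w (i + 1) true * perm123 n hn = prismVertex hn w i true := by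
      have h : perm12 n hn * perm123 n hn = (perm123 n hn)⁻¹ * perm12 n hn := by
        rw [eq_inv_mul_iff_mul_eq, ← mul_assoc, ← perm12_mul_perm132, perm132_eq_inv, mul_assoc,
          inv_mul_cancel, mul_one]
      simp [prismVertex, pow_succ, mul_assoc, h]
    rw [← this]
    exact (adj_mul_perm123 _).symm

theorem adj_prismVertex_not (w : Perm (Fin n)) (i : ℕ) (b : Bool) :
    (godanGraph n hn).Adj (prismVertex hn w i b) (prismVertex hn w i !b) := by
  have : prismVertex hn w i true = prismVertex hn w i false * perm12 n hn := by
    simp [prismVertex]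
  cases b
  · rw [Bool.not_false, this]
    exact adj_mul_perm12 _
  · rw [Bool.not_true, this]
    exact (adj_mul_perm12 _).symm

theorem adj_prismVertex (w : Perm (Fin n)) {x y : Fin 3 × Bool} (h : PrismAdj x y) :
    (godanGraph n hn).Adj (prismVertex hn w x.1 x.2) (prismVertex hn w y.1 y.2) := by
  obtain ⟨i, b⟩ := x
  obtain ⟨j, b'⟩ := y
  rcases h with ⟨h1, h2⟩ | ⟨h1, h2⟩
  · obtain rfl : b = b' := h2
    have h0 := adj_prismVertex_succ (hn := hn) w 0 b
    have h1 := adj_prismVertex_succ (hn := hn) w 1 b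
    have h2 := adj_prismVertex_succ (hn := hn) w 2 b
    rw [show 2 + 1 = 0 + 3 from rfl, prismVertex_add_three] at h2
    fin_cases i <;> fin_cases j <;> simp_all [SimpleGraph.adj_comm]
  · obtain rfl : i = j := h1
    obtain rfl : b' = !b := by
      cases b <;> cases b' <;> simp_all
    exact adj_prismVertex_not w i b

theorem perm12_pow_apply (b : ℕ) {j : Fin n} (hj : 2 ≤ (j : ℕ)) : (perm12 n hn ^ b) j = j := by
  induction b with
  | zero => rfl
  | succ b ih => rw [pow_succ, Perm.mul_apply, perm12_apply_of_two_le hj, ih]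

theorem perm123_pow_apply (i : ℕ) {j : Fin n} (hj : 3 ≤ (j : ℕ)) : (perm123 n hn ^ i) j = j := by
  induction i with
  | zero => rfl
  | succ i ih => rw [pow_succ, Perm.mul_apply, perm123_apply_of_three_le hj, ih]

theorem prismVertex_injective (w : Perm (Fin n)) :
    Function.Injective fun x : Fin 3 × Bool => prismVertex hn w x.1 x.2 := by
  rintro ⟨i, b⟩ ⟨j, b'⟩ h
  simp only [prismVertex, mul_assoc, mul_right_inj] at h
  have hij : i = j := by
    have h2 := congrArg (fun g : Perm (Fin n) => g ⟨2, by omega⟩) h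
    have e : ∀ b, (perm12 n hn ^ b) ⟨2, by omega⟩ = ⟨2, by omega⟩ := fun b =>
      perm12_pow_apply b le_rfl
    simp only [Perm.mul_apply, e] at h2
    clear h e
    fin_cases i <;> fin_cases j <;> simp [pow_succ, perm123_two, perm123_zero] at h2 ⊢
  subst hij
  rw [mul_right_inj] at h
  have h0 := congrArg (fun g : Perm (Fin n) => g ⟨0, by omega⟩) h
  clear h
  cases b <;> cases b' <;> simp [perm12_zero] at h0 ⊢

theorem exists_prismVertex {w u : Perm (Fin n)} (hu : u ∈ region 3 w) :
    ∃ x : Fin 3 × Bool, prismVertex hn w x.1 x.2 = u := by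
  have hfix : ∀ j : Fin n, 3 ≤ (j : ℕ) → (w⁻¹ * u) j = j := fun j hj => by
    rw [Perm.mul_apply, hu j hj, ← Perm.mul_apply, inv_mul_cancel, Perm.one_apply]
  set g := w⁻¹ * u with hg
  have hi : ∃ i : Fin 3, (perm123 n hn ^ (i : ℕ)) ⟨2, by omega⟩ = g ⟨2, by omega⟩ := by
    rcases cases_index (hn := hn) (g ⟨2, by omega⟩) with h | h | h | h
    · exact ⟨1, by rw [h]; simp [perm123_two]⟩
    · exact ⟨2, by rw [h]; simp [pow_succ, perm123_two, perm123_zero]⟩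
    · exact ⟨0, by rw [h]; simp⟩
    · have := g.injective (hfix _ h)
      rw [this] at h
      simp at h
  obtain ⟨i, hi⟩ := hi
  set f := (perm123 n hn ^ (i : ℕ))⁻¹ * g with hf
  have f2 : ∀ j : Fin n, 2 ≤ (j : ℕ) → f j = j := by
    intro j hj
    rcases cases_index (hn := hn) j with rfl | rfl | rfl | h
    · simp at hj
    · simp at hj
    · rw [hf, Perm.mul_apply, ← hi, ← Perm.mul_apply, inv_mul_cancel, Perm.one_apply]
    · rw [hf, Perm.mul_apply, hfix j h, Perm.inv_eq_iff_eq, perm123_pow_apply _ h]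
  have hlt : ∀ j : Fin n, (j : ℕ) < 2 → (f j : ℕ) < 2 := by
    intro j hj
    by_contra! h
    have := f.injective (f2 _ h)
    rw [this] at h
    omega
  have h01 : f ⟨0, by omega⟩ ≠ f ⟨1, by omega⟩ := by
    rw [f.injective.ne_iff]
    simp
  have h0 := hlt ⟨0, by omega⟩ (by simp)
  have h1 := hlt ⟨1, by omega⟩ (by simp)
  rw [Ne, Fin.ext_iff] at h01
  have hb : ∃ b : Bool, perm12 n hn ^ b.toNat = f := by
    by_cases hz : (f ⟨0, by omega⟩ : ℕ) = 0
    · refine ⟨false, Perm.ext fun j => ?_⟩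
      rcases cases_index (hn := hn) j with rfl | rfl | rfl | h
      · simp [Fin.ext_iff, hz]
      · simp [Fin.ext_iff]
        omega
      · simp [f2]
      · simp [f2 j (by omega)]
    · refine ⟨true, Perm.ext fun j => ?_⟩
      rcases cases_index (hn := hn) j with rfl | rfl | rfl | h
      · simp [Fin.ext_iff, perm12_zero]
        omega
      · simp [Fin.ext_iff, perm12_one]
        omega
      · simp [f2, perm12_apply_of_two_le]
      · simp [f2 j (by omega), perm12_apply_of_two_le (show 2 ≤ (j : ℕ) by omega)]
  obtain ⟨b, hb⟩ := hb
  refine ⟨(i, b), ?_⟩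
  rw [prismVertex, hb, hf, hg]
  group

theorem prismVertex_mem (w : Perm (Fin n)) (i : ℕ) (b : Bool) :
    prismVertex hn w i b ∈ region 3 w := fun j hj => by
  rw [prismVertex, Perm.mul_apply, Perm.mul_apply, perm12_pow_apply _ (by omega),
    perm123_pow_apply _ hj]

theorem goodRegions_three (hn : 3 ≤ n) : GoodRegions hn 3 := by
  intro w
  classical
  set φ : Fin 3 × Bool → Perm (Fin n) := fun x => prismVertex hn w x.1 x.2 with hφ
  have hinj : Function.Injective φ := prismVertex_injective w
  have hadj : ∀ x y, PrismAdj x y → (godanGraph n hn).Adj (φ x) (φ y) := fun _ _ =>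
    adj_prismVertex w
  have hsurj : ∀ u ∈ region 3 w, ∃ x, φ x = u := fun u => exists_prismVertex
  have hmem : ∀ x, φ x ∈ region 3 w := fun x => prismVertex_mem w x.1 x.2
  refine ⟨fun F hF => ?_, ?_, fun S hS hS3 => ?_⟩
  · set F' := Finset.univ.filter fun x => φ x ∈ F with hF'
    have hcard : F'.card < 3 := by
      rw [← Set.ncard_coe_finset, ← Set.ncard_image_of_injective _ hinj]
      refine (Set.ncard_le_ncard ?_).trans_lt hF
      rintro _ ⟨x, hx, rfl⟩
      simpa [hF'] using hx
    convert (prism_sdiff_shortlyLinked F' hcard).linked_image hadj using 1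
    ext u
    constructor
    · rintro ⟨hu, huF⟩
      obtain ⟨x, rfl⟩ := hsurj u hu
      exact ⟨x, by simpa [hF'] using huF, rfl⟩
    · rintro ⟨x, hx, rfl⟩
      exact ⟨hmem x, by simpa [hF'] using hx⟩
  · have : (φ '' Set.univ).ncard = 6 := by
      rw [Set.ncard_image_of_injective _ hinj, Set.ncard_univ]
      simp
    have := Set.ncard_le_ncard (s := φ '' Set.univ) (t := region 3 w) (by
      rintro _ ⟨x, -, rfl⟩
      exact hmem x)
    omega
  · set S' := Finset.univ.filter fun x => φ x ∈ S with hS'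
    have hSS : φ '' S' = S := by
      ext u
      constructor
      · rintro ⟨x, hx, rfl⟩
        simpa [hS'] using hx
      · intro hu
        obtain ⟨x, rfl⟩ := hsurj u (hS hu)
        exact ⟨x, by simpa [hS'] using hu, rfl⟩
    have hcard : S'.card = 3 := by
      rw [← hSS, Set.ncard_image_of_injective _ hinj, Set.ncard_coe_finset] at hS3
      exact hS3
    have hmS : ∀ x, φ x ∈ S ↔ x ∈ S' := fun x => by simp [hS']
    obtain ⟨a, b, c, hdisj, h1, h2⟩ := prism_exists_packing S' hcard
    have hT := Finset.disjoint_left.1 hdisj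
    generalize ({a, b, c} : Finset (Fin 3 × Bool)) = T at hT h1 h2
    refine ⟨Bool, inferInstance, fun i => φ '' (bif i then T else (S' ∪ T)ᶜ : Finset _),
      fun i => bif i then ∅ else Set.univ, rfl, ?_, ?_⟩
    · rintro (_ | _)
      · refine ⟨?_, ?_, ?_⟩
        · change Linked (keep (godanGraph n hn) S Set.univ) _
          convert h1.linked_image (φ := φ) (K := keep (godanGraph n hn) S Set.univ)
            fun x y hxy => ⟨hadj x y hxy, fun _ _ => trivial⟩ using 1
          rw [← hSS, ← Set.image_union]
          congr 1
          ext x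
          have := @hT x
          simp
          tauto
        · rintro _ ⟨x, -, rfl⟩
          exact hmem x
        · rintro _ ⟨x, hx, rfl⟩
          rw [hmS]
          simp at hx
          tauto
      · refine ⟨?_, ?_, ?_⟩
        · change Linked (keep (godanGraph n hn) S ∅) _
          convert h2.linked_image (φ := φ) (K := keep (godanGraph n hn) S ∅)
            fun x y hxy => ⟨hadj x y hxy.1, fun hx hy =>
              absurd ((hmS y).1 hy) (hxy.2 ((hmS x).1 hx))⟩ using 1
          rw [← hSS, ← Set.image_union]
          simp
        · rintro _ ⟨x, -, rfl⟩
          exact hmem x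
        · rintro _ ⟨x, hx, rfl⟩
          rw [hmS]
          exact hT hx
    · have hCC : ∀ v ∈ φ '' (T : Set (Fin 3 × Bool)), v ∉ φ '' (((S' ∪ T)ᶜ : Finset _) : Set _) := by
        rintro _ ⟨x, hx, rfl⟩ ⟨y, hy, hyx⟩
        rw [hinj hyx] at hy
        simp at hx hy
        tauto
      rintro (_ | _) (_ | _) hij
      · exact absurd rfl hij
      · exact ⟨fun v hv hv' => hCC v hv' hv, fun e _ he => he⟩
      · exact ⟨hCC, fun e he => absurd he (Set.notMem_empty e)⟩
      · exact absurd rfl hij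

theorem goodRegions {m : ℕ} (hm : 3 ≤ m) (hmn : m ≤ n) : GoodRegions hn m := by
  induction m, hm using Nat.le_induction with
  | base => exact goodRegions_three hn
  | succ m hm ih =>
    intro w
    have h := layered_region (m := m + 1) (k := ⟨m, by omega⟩) (by omega) rfl
      (by simpa using ih (by omega)) w
    exact ⟨h.kLinked, h.lt_ncard_self, fun S => h.packs_self⟩

end Base

/-- For every integer n ≥ 3, the generalized 3-connectivity of the godan graph
EA_n equals n − 1. -/
theorem kappa3_godan (n : ℕ) (hn : 3 ≤ n) :
    genConn (godanGraph n hn) 3 = n - 1 := by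
  have hpacks : ∀ S : Finset (Equiv.Perm (Fin n)), S.card = 3 →
      n - 1 ≤ maxIDST (godanGraph n hn) (S : Set (Equiv.Perm (Fin n))) := by
    intro S hS
    obtain ⟨x, hx, y, hy, hxy⟩ := Finset.one_lt_card.1 (by omega : 1 < S.card)
    exact ((goodRegions (hn := hn) hn le_rfl 1).2.2 S
      (fun u _ j hj => absurd j.2 (by omega))
      (by rw [Set.ncard_coe_finset, hS])).le_maxIDST hx hy hxy
  set t := perm12 n hn
  set c := perm123 n hn
  have ht := adj_mul_perm12 (hn := hn) 1
  have hc := adj_mul_perm123 (hn := hn) 1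
  have htc : t ≠ c := fun h => by
    have h1 : t ⟨1, by omega⟩ = c ⟨1, by omega⟩ := by rw [h]
    rw [perm12_one, perm123_one] at h1
    simp at h1
  rw [one_mul] at ht hc
  have hS : ({1, t, c} : Finset (Equiv.Perm (Fin n))).card = 3 :=
    Finset.card_eq_three.2 ⟨1, t, c, ht.ne, hc.ne, htc, rfl⟩
  have hmem : maxIDST (godanGraph n hn) ({1, t, c} : Finset (Equiv.Perm (Fin n))) ∈
      {m | ∃ S : Finset (Equiv.Perm (Fin n)), S.card = 3 ∧ maxIDST (godanGraph n hn) S = m} :=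
    ⟨_, hS, rfl⟩
  refine le_antisymm ((Nat.sInf_le hmem).trans (Nat.le_sub_one_of_lt ?_)) (le_csInf ⟨_, hmem⟩ ?_)
  · exact maxIDST_lt (x := 1) (y := t) (z := c) (by simp) (by simp) (by simp) hc.ne' htc.symm ht
      ncard_neighborSet_le
  · rintro _ ⟨S, hS, rfl⟩
    exact hpacks S hS

end Godan
end

section
/- For every 4-element subset S of the vertex set of the godan graph EA_3, there exist 2 pairwise internally edge disjoint S-trees in EA_3; consequently κ₄(EA_3) ≥ 2. -/
namespace Godan

section Trees

variable {V : Type*} {G : SimpleGraph V}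

/-- A finite subgraph is a tree iff it is connected with one more vertex than edges. -/
lemma coe_isTree_iff [Finite V] (T : G.Subgraph) :
    T.coe.IsTree ↔ T.Connected ∧ T.edgeSet.ncard + 1 = T.verts.ncard := by
  rw [SimpleGraph.isTree_iff_connected_and_card, SimpleGraph.Subgraph.connected_iff',
    ← T.image_coe_edgeSet_coe,
    Set.ncard_image_of_injective _ (Sym2.map.injective Subtype.val_injective)]
  rfl

/-- Attaching a pendant edge to a tree gives a tree. -/
lemma isTree_sup_subgraphOfAdj [Finite V] {T : G.Subgraph} (hT : T.coe.IsTree) {u v : V}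
    (h : G.Adj u v) (hu : u ∈ T.verts) (hv : v ∉ T.verts) :
    (T ⊔ G.subgraphOfAdj h).coe.IsTree := by
  rw [coe_isTree_iff] at hT ⊢
  refine ⟨SimpleGraph.Subgraph.connected_sup hT.1.preconnected
    (SimpleGraph.Subgraph.subgraphOfAdj_connected h).preconnected ⟨u, by simp [hu]⟩, ?_⟩
  have he : s(u, v) ∉ T.edgeSet := fun he => hv (T.edge_vert (SimpleGraph.Subgraph.Adj.symm he))
  have hverts : (T ⊔ G.subgraphOfAdj h).verts = insert v T.verts := by
    ext x
    simp only [SimpleGraph.Subgraph.verts_sup, SimpleGraph.subgraphOfAdj_verts, Set.mem_union,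
      Set.mem_insert_iff, Set.mem_singleton_iff]
    grind
  rw [hverts, SimpleGraph.Subgraph.edgeSet_sup, SimpleGraph.edgeSet_subgraphOfAdj,
    Set.union_singleton, Set.ncard_insert_of_notMem he, Set.ncard_insert_of_notMem hv, hT.2]

/-- A pair of trees meeting exactly in `S` and sharing no edge is a family of internally edge
disjoint `S`-trees. -/
lemma isIDSTFamily_pair {S : Set V} {T₁ T₂ : G.Subgraph} (h₁ : T₁.coe.IsTree)
    (h₂ : T₂.coe.IsTree) (hV : T₁.verts ∩ T₂.verts = S) (hE : T₁.edgeSet ∩ T₂.edgeSet = ∅) :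
    IsIDSTFamily G S ![T₁, T₂] := by
  constructor
  · intro i
    fin_cases i
    · exact ⟨hV ▸ Set.inter_subset_left, h₁⟩
    · exact ⟨hV ▸ Set.inter_subset_right, h₂⟩
  · intro i j hij
    fin_cases i <;> fin_cases j
    · exact absurd rfl hij
    · exact ⟨hV, hE⟩
    · exact ⟨Set.inter_comm _ _ ▸ hV, Set.inter_comm _ _ ▸ hE⟩
    · exact absurd rfl hij

/-- A tree containing two distinct vertices has an edge, so the size of a family of internally
edge disjoint `S`-trees is bounded by the number of pairs of vertices. -/
lemma IsIDSTFamily.le_card [Finite V] {S : Set V} (hS : S.Nontrivial) {r : ℕ} {T : Fin r → G.Subgraph}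
    (hT : IsIDSTFamily G S T) : r ≤ Nat.card (Sym2 V) := by
  have hne : ∀ i, (T i).edgeSet.Nonempty := by
    intro i
    have htree := (coe_isTree_iff (T i)).1 (hT.1 i).2
    have hcard := (Set.one_lt_ncard (s := (T i).verts)).2 (hS.mono (hT.1 i).1)
    exact Set.nonempty_of_ncard_ne_zero (by omega)
  choose e he using hne
  have hinj : Function.Injective e := by
    intro i j hij
    by_contra hne
    have hmem : e i ∈ (T i).edgeSet ∩ (T j).edgeSet := ⟨he i, hij ▸ he j⟩
    rw [(hT.2 i j hne).2] at hmem
    exact hmem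
  simpa using Nat.card_le_card_of_injective e hinj

lemma IsIDSTFamily.le_maxIDST [Finite V] {S : Set V} (hS : S.Nontrivial) {r : ℕ} {T : Fin r → G.Subgraph}
    (hT : IsIDSTFamily G S T) : r ≤ maxIDST G S :=
  le_csSup ⟨Nat.card (Sym2 V), fun _ ⟨_, h⟩ => h.le_card hS⟩ ⟨T, hT⟩

end Trees

/-- The vertices `a₁, a₂, a₃` and `b₁, b₂, b₃` span two triangles joined by the matching
`aᵢ bᵢ`. -/
structure IsPrism {V : Type*} (G : SimpleGraph V) (a₁ a₂ a₃ b₁ b₂ b₃ : V) : Prop where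
  nodup : [a₁, a₂, a₃, b₁, b₂, b₃].Nodup
  a₁₂ : G.Adj a₁ a₂
  a₁₃ : G.Adj a₁ a₃
  a₂₃ : G.Adj a₂ a₃
  b₁₂ : G.Adj b₁ b₂
  b₁₃ : G.Adj b₁ b₃
  b₂₃ : G.Adj b₂ b₃
  ab₁ : G.Adj a₁ b₁
  ab₂ : G.Adj a₂ b₂
  ab₃ : G.Adj a₃ b₃

namespace IsPrism

variable {V : Type*} [Finite V] {G : SimpleGraph V} {a₁ a₂ a₃ b₁ b₂ b₃ : V}

/-- Two trees for a triangle together with one further vertex. -/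
lemma exists_trees_triangle (h : IsPrism G a₁ a₂ a₃ b₁ b₂ b₃) :
    ∃ T : Fin 2 → G.Subgraph, IsIDSTFamily G {a₁, a₂, a₃, b₁} T := by
  have hn := h.nodup
  simp only [List.nodup_cons, List.mem_cons, List.not_mem_nil, or_false, not_or] at hn
  refine ⟨_, isIDSTFamily_pair
    (T₁ := G.subgraphOfAdj h.ab₁ ⊔ G.subgraphOfAdj h.a₁₂ ⊔ G.subgraphOfAdj h.a₂₃)
    (T₂ := G.subgraphOfAdj h.a₁₃ ⊔ G.subgraphOfAdj h.ab₃ ⊔ G.subgraphOfAdj h.b₁₃.symm ⊔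
      G.subgraphOfAdj h.b₁₂ ⊔ G.subgraphOfAdj h.ab₂.symm) ?_ ?_ ?_ ?_⟩
  · refine isTree_sup_subgraphOfAdj (isTree_sup_subgraphOfAdj (.coe_subgraphOfAdj _) _ ?_ ?_)
      _ ?_ ?_ <;> simp <;> grind
  · refine isTree_sup_subgraphOfAdj (isTree_sup_subgraphOfAdj (isTree_sup_subgraphOfAdj
      (isTree_sup_subgraphOfAdj (.coe_subgraphOfAdj _) _ ?_ ?_) _ ?_ ?_) _ ?_ ?_) _ ?_ ?_ <;>
      simp <;> grind
  · ext x
    simp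
    grind
  · ext e
    induction e with | _ x y
    simp
    grind

/-- Two trees for the 4-cycle left by deleting two matched vertices. -/
lemma exists_trees_square (h : IsPrism G a₁ a₂ a₃ b₁ b₂ b₃) :
    ∃ T : Fin 2 → G.Subgraph, IsIDSTFamily G {a₂, a₃, b₂, b₃} T := by
  have hn := h.nodup
  simp only [List.nodup_cons, List.mem_cons, List.not_mem_nil, or_false, not_or] at hn
  refine ⟨_, isIDSTFamily_pair
    (T₁ := G.subgraphOfAdj h.a₂₃ ⊔ G.subgraphOfAdj h.ab₃ ⊔ G.subgraphOfAdj h.b₂₃.symm)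
    (T₂ := G.subgraphOfAdj h.a₁₃.symm ⊔ G.subgraphOfAdj h.a₁₂ ⊔ G.subgraphOfAdj h.ab₂ ⊔
      G.subgraphOfAdj h.b₁₂.symm ⊔ G.subgraphOfAdj h.b₁₃) ?_ ?_ ?_ ?_⟩
  · refine isTree_sup_subgraphOfAdj (isTree_sup_subgraphOfAdj (.coe_subgraphOfAdj _) _ ?_ ?_)
      _ ?_ ?_ <;> simp <;> grind
  · refine isTree_sup_subgraphOfAdj (isTree_sup_subgraphOfAdj (isTree_sup_subgraphOfAdj
      (isTree_sup_subgraphOfAdj (.coe_subgraphOfAdj _) _ ?_ ?_) _ ?_ ?_) _ ?_ ?_) _ ?_ ?_ <;>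
      simp <;> grind
  · ext x
    simp
    grind
  · ext e
    induction e with | _ x y
    simp
    grind

/-- Two trees for the path left by deleting two unmatched vertices of different triangles. -/
lemma exists_trees_path (h : IsPrism G a₁ a₂ a₃ b₁ b₂ b₃) :
    ∃ T : Fin 2 → G.Subgraph, IsIDSTFamily G {a₂, a₃, b₁, b₃} T := by
  have hn := h.nodup
  simp only [List.nodup_cons, List.mem_cons, List.not_mem_nil, or_false, not_or] at hn
  refine ⟨_, isIDSTFamily_pair
    (T₁ := G.subgraphOfAdj h.a₂₃ ⊔ G.subgraphOfAdj h.ab₃ ⊔ G.subgraphOfAdj h.b₁₃.symm)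
    (T₂ := G.subgraphOfAdj h.a₁₂.symm ⊔ G.subgraphOfAdj h.a₁₃ ⊔ G.subgraphOfAdj h.ab₁ ⊔
      G.subgraphOfAdj h.b₁₂ ⊔ G.subgraphOfAdj h.b₂₃) ?_ ?_ ?_ ?_⟩
  · refine isTree_sup_subgraphOfAdj (isTree_sup_subgraphOfAdj (.coe_subgraphOfAdj _) _ ?_ ?_)
      _ ?_ ?_ <;> simp <;> grind
  · refine isTree_sup_subgraphOfAdj (isTree_sup_subgraphOfAdj (isTree_sup_subgraphOfAdj
      (isTree_sup_subgraphOfAdj (.coe_subgraphOfAdj _) _ ?_ ?_) _ ?_ ?_) _ ?_ ?_) _ ?_ ?_ <;>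
      simp <;> grind
  · ext x
    simp
    grind
  · ext e
    induction e with | _ x y
    simp
    grind

end IsPrism

lemma godanGraph_three_adj_iff (u v : Equiv.Perm (Fin 3)) :
    (godanGraph 3 (by norm_num)).Adj u v ↔
      v⁻¹ * u ∈ ({perm12 3 le_rfl, perm123 3 le_rfl, perm132 3 le_rfl} :
        Finset (Equiv.Perm (Fin 3))) := by
  have hΩ : ∀ s, s ∈ OmegaStar 3 le_rfl ↔
      s ∈ ({perm12 3 le_rfl, perm123 3 le_rfl, perm132 3 le_rfl} :
        Finset (Equiv.Perm (Fin 3))) := by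
    intro s
    have hk : ¬ ∃ k : Fin 3, 3 ≤ (k : ℕ) ∧ s = perm12 3 le_rfl * Equiv.swap ⟨2, by omega⟩ k :=
      fun ⟨k, hk, _⟩ => absurd k.isLt (by omega)
    simp only [OmegaStar, Set.mem_union, Set.mem_ofPred_eq, hk, or_false, Finset.mem_insert,
      Finset.mem_singleton, Set.mem_insert_iff, Set.mem_singleton_iff]
  simp only [godanGraph, SimpleGraph.fromRel_adj, hΩ]
  revert u v
  decide

set_option maxRecDepth 10000 in
/-- The two cosets of the rotations in `S₃` are the triangles of a prism, whose matching is given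
by right multiplication with `(12)`. -/
lemma isPrism_godanGraph_three (g c : Equiv.Perm (Fin 3))
    (hc : c = perm123 3 le_rfl ∨ c = perm132 3 le_rfl) :
    IsPrism (godanGraph 3 (by norm_num)) g (g * c) (g * c ^ 2) (g * perm12 3 le_rfl)
      (g * c * perm12 3 le_rfl) (g * c ^ 2 * perm12 3 le_rfl) := by
  constructor
  case nodup =>
    revert g c
    decide
  all_goals
    rw [godanGraph_three_adj_iff]
    revert g c
    decide

set_option maxRecDepth 10000 in
/-- Up to symmetries of the prism, there are three kinds of 4-element vertex sets. -/
lemma four_subset_cases (S : Finset (Equiv.Perm (Fin 3))) (hS : S.card = 4) :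
    ∃ g c : Equiv.Perm (Fin 3), (c = perm123 3 le_rfl ∨ c = perm132 3 le_rfl) ∧
      (S = {g, g * c, g * c ^ 2, g * perm12 3 le_rfl} ∨
        S = {g * c, g * c ^ 2, g * c * perm12 3 le_rfl, g * c ^ 2 * perm12 3 le_rfl} ∨
        S = {g * c, g * c ^ 2, g * perm12 3 le_rfl, g * c ^ 2 * perm12 3 le_rfl}) := by
  revert S
  decide

lemma exists_isIDSTFamily_two (S : Finset (Equiv.Perm (Fin 3))) (hS : S.card = 4) :
    ∃ T : Fin 2 → (godanGraph 3 (by norm_num)).Subgraph,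
      IsIDSTFamily (godanGraph 3 (by norm_num)) (↑S : Set (Equiv.Perm (Fin 3))) T := by
  obtain ⟨g, c, hc, rfl | rfl | rfl⟩ := four_subset_cases S hS
  · simpa using (isPrism_godanGraph_three g c hc).exists_trees_triangle
  · simpa using (isPrism_godanGraph_three g c hc).exists_trees_square
  · simpa using (isPrism_godanGraph_three g c hc).exists_trees_path

/-- For every 4-element subset S of the vertex set of the godan graph EA_3, there
exist 2 pairwise internally edge disjoint S-trees in EA_3; consequently
κ₄(EA_3) ≥ 2. -/
theorem two_IDSTs_EA3 :
    (∀ S : Finset (Equiv.Perm (Fin 3)), S.card = 4 →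
      ∃ T : Fin 2 → (godanGraph 3 (by norm_num)).Subgraph,
        IsIDSTFamily (godanGraph 3 (by norm_num)) (↑S : Set (Equiv.Perm (Fin 3))) T) ∧
    2 ≤ genConn (godanGraph 3 (by norm_num)) 4 := by
  refine ⟨exists_isIDSTFamily_two, le_csInf ?_ ?_⟩
  · obtain ⟨S, -, hS⟩ := Finset.exists_subset_card_eq
      (s := (Finset.univ : Finset (Equiv.Perm (Fin 3)))) (n := 4) (by decide)
    exact ⟨_, S, hS, rfl⟩
  · rintro _ ⟨S, hS, rfl⟩
    obtain ⟨T, hT⟩ := exists_isIDSTFamily_two S hS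
    refine hT.le_maxIDST ?_
    rw [Finset.nontrivial_coe, ← Finset.one_lt_card_iff_nontrivial]
    omega

end Godan
end

section
/- Let n ≥ 4 and let x be a vertex of the godan graph EA_n. Let B = B₁ ∪ {x̃, v}, where x̃ = x∘(12), B₁ is any set of n − 2 neighbours of x other than x̃, and v is any neighbour of x̃ with v ≠ x. Then the graph obtained from EA_n by deleting all vertices of B (i.e., the subgraph induced on V(EA_n) \ B) is connected. -/
namespace Godan

section GodanSystem

variable {G K α : Type*} [Group G]

/-- The relations between the generators of the godan graph: `a` stands for `(12)`, `c` for
`(123)`, `t k` for `(12)(3k)`, and `ε` for the signature. -/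
structure IsGodanSystem (ε : G →* ℤˣ) (a c : G) (t : K → G) : Prop where
  a_sq : a * a = 1
  c_cube : c ^ 3 = 1
  t_sq : ∀ k, t k * t k = 1
  ct_cube : ∀ k, (c * t k) ^ 3 = 1
  a_c : a * c * a = c⁻¹
  a_t : ∀ k, a * t k * a = t k
  c_ne : c ≠ 1
  t_ne : ∀ k, t k ≠ 1
  sign_a : ε a = -1
  sign_c : ε c = 1
  sign_t : ∀ k, ε (t k) = 1

/-- The even generators. -/
def evenGens (c : G) (t : K → G) : Set G := {c, c⁻¹} ∪ Set.range t

theorem mem_evenGens {c : G} {t : K → G} {s : G} :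
    s ∈ evenGens c t ↔ s = c ∨ s = c⁻¹ ∨ ∃ k, t k = s := by
  simp [evenGens, or_assoc]

theorem left_mem_evenGens (c : G) (t : K → G) : c ∈ evenGens c t := by simp [mem_evenGens]

theorem inv_left_mem_evenGens (c : G) (t : K → G) : c⁻¹ ∈ evenGens c t := by simp [mem_evenGens]

theorem apply_mem_evenGens (c : G) (t : K → G) (k : K) : t k ∈ evenGens c t := by
  simp [mem_evenGens]

theorem evenGens_inv (c : G) (t : K → G) : evenGens c⁻¹ t = evenGens c t := by
  ext s
  simp only [mem_evenGens, inv_inv]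
  tauto

/-- Elements of order three. -/
def OrderThree (g : G) : Prop := g ≠ 1 ∧ g ^ 3 = 1

theorem OrderThree.inv {g : G} (hg : OrderThree g) : OrderThree g⁻¹ :=
  ⟨inv_ne_one.2 hg.1, by rw [inv_pow, hg.2, inv_one]⟩

theorem OrderThree.ne_of_sq {g h : G} (hg : OrderThree g) (hh : h * h = 1) : g ≠ h := by
  rintro rfl
  apply hg.1
  have := hg.2
  rwa [pow_succ, pow_two, hh, one_mul] at this

theorem OrderThree.mul_self {g : G} (hg : OrderThree g) : g * g = g⁻¹ := by
  rw [eq_inv_iff_mul_eq_one, ← pow_two, ← pow_succ, hg.2]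

theorem OrderThree.ne_inv {g : G} (hg : OrderThree g) : g ≠ g⁻¹ := by
  rw [← hg.mul_self, Ne, left_eq_mul]
  exact hg.1

namespace IsGodanSystem

variable {ε : G →* ℤˣ} {a c : G} {t : K → G}

theorem orderThree_c (h : IsGodanSystem ε a c t) : OrderThree c := ⟨h.c_ne, h.c_cube⟩

theorem t_inv (h : IsGodanSystem ε a c t) (k : K) : (t k)⁻¹ = t k :=
  inv_eq_of_mul_eq_one_left (h.t_sq k)

theorem orderThree_ct (h : IsGodanSystem ε a c t) (k : K) : OrderThree (c * t k) :=
  ⟨fun e => h.orderThree_c.ne_of_sq (h.t_sq k)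
    (by rw [mul_eq_one_iff_eq_inv, h.t_inv] at e; exact e), h.ct_cube k⟩

theorem ctct (h : IsGodanSystem ε a c t) (k : K) : c * t k * c * t k = t k * c⁻¹ := by
  rw [mul_assoc (c * t k), (h.orderThree_ct k).mul_self, mul_inv_rev, h.t_inv]

theorem ctc (h : IsGodanSystem ε a c t) (k : K) : c * t k * c = t k * c⁻¹ * t k := by
  rw [← h.ctct, mul_assoc _ (t k) (t k), h.t_sq, mul_one]

theorem ctctc (h : IsGodanSystem ε a c t) (k : K) : c * t k * c * t k * c = t k := by
  rw [h.ctct, inv_mul_cancel_right]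

theorem orderThree_ctct (h : IsGodanSystem ε a c t) (k : K) :
    OrderThree (c * t k * c * t k) := by
  rw [mul_assoc (c * t k), (h.orderThree_ct k).mul_self]
  exact (h.orderThree_ct k).inv

theorem orderThree_ctc (h : IsGodanSystem ε a c t) (k : K) : OrderThree (c * t k * c) := by
  have e : c * t k * c = t k * c⁻¹ * (t k)⁻¹ := by rw [h.ctc, h.t_inv]
  rw [e]
  exact ⟨by simpa using h.c_ne, by rw [conj_pow, h.orderThree_c.inv.2]; simp⟩

theorem inv (h : IsGodanSystem ε a c t) : IsGodanSystem ε a c⁻¹ t where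
  a_sq := h.a_sq
  c_cube := h.orderThree_c.inv.2
  t_sq := h.t_sq
  ct_cube k := by
    have := (h.orderThree_ctct k).2
    rw [h.ctct] at this
    have e : c⁻¹ * t k = (t k)⁻¹ * (t k * c⁻¹) * (t k)⁻¹⁻¹ := by group
    rw [e, conj_pow, this]
    simp
  a_c := by
    have : a⁻¹ = a := inv_eq_of_mul_eq_one_left h.a_sq
    rw [← h.a_c, mul_inv_rev, mul_inv_rev, h.a_c, this, ← mul_assoc]
  a_t := h.a_t
  c_ne := inv_ne_one.2 h.c_ne
  t_ne := h.t_ne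
  sign_a := h.sign_a
  sign_c := by simp [h.sign_c]
  sign_t := h.sign_t

theorem sign_gen (h : IsGodanSystem ε a c t) {s : G} (hs : s ∈ evenGens c t) : ε s = 1 := by
  obtain rfl | rfl | ⟨k, rfl⟩ := mem_evenGens.1 hs <;> simp [h.sign_c, h.sign_t]

theorem gen_ne_one (h : IsGodanSystem ε a c t) {s : G} (hs : s ∈ evenGens c t) : s ≠ 1 := by
  obtain rfl | rfl | ⟨k, rfl⟩ := mem_evenGens.1 hs <;> simp [h.c_ne, h.t_ne]

theorem inv_gen (h : IsGodanSystem ε a c t) {s : G} (hs : s ∈ evenGens c t) :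
    s⁻¹ ∈ evenGens c t := by
  obtain rfl | rfl | ⟨k, rfl⟩ := mem_evenGens.1 hs <;> simp [mem_evenGens, h.t_inv]

theorem conj_gen (h : IsGodanSystem ε a c t) {s : G} (hs : s ∈ evenGens c t) :
    a * s * a ∈ evenGens c t := by
  obtain rfl | rfl | ⟨k, rfl⟩ := mem_evenGens.1 hs
  · simp [mem_evenGens, h.a_c]
  · simp [mem_evenGens, h.inv.a_c]
  · simp [mem_evenGens, h.a_t]

theorem mem_closure_of_sign_eq_one (h : IsGodanSystem ε a c t)
    (hgen : Subgroup.closure (insert a (evenGens c t)) = ⊤) {g : G} (hg : ε g = 1) :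
    g ∈ Subgroup.closure (evenGens c t) := by
  set N := Subgroup.closure (evenGens c t)
  have key : ∀ u s, s ∈ insert a (evenGens c t) → u ∈ N ∨ u * a ∈ N →
      u * s ∈ N ∨ u * s * a ∈ N := by
    rintro u s (rfl | hs) hu
    · rw [mul_assoc, h.a_sq, mul_one]
      exact hu.symm
    · refine hu.imp (fun hu => N.mul_mem hu (Subgroup.subset_closure hs)) fun hu => ?_
      have e : u * s * a = u * a * (a * s * a) := by
        rw [mul_assoc u a, ← mul_assoc a, ← mul_assoc a, h.a_sq, one_mul, mul_assoc]
      rw [e]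
      exact N.mul_mem hu (Subgroup.subset_closure (h.conj_gen hs))
  have hg' : g ∈ N ∨ g * a ∈ N := by
    have hmem : g ∈ Subgroup.closure (insert a (evenGens c t)) := hgen ▸ Subgroup.mem_top g
    clear hg
    induction hmem using Subgroup.closure_induction_right with
    | one => exact Or.inl N.one_mem
    | mul_right u _ s hs ih => exact key u s hs ih
    | mul_inv_cancel u _ s hs ih =>
      refine key u s⁻¹ ?_ ih
      obtain rfl | hs := hs
      · rw [inv_eq_of_mul_eq_one_left h.a_sq]
        exact Set.mem_insert _ _
      · exact Or.inr (h.inv_gen hs)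
  refine hg'.resolve_right fun hga => ?_
  have hN : N ≤ ε.ker := (Subgroup.closure_le _).2 fun s hs => h.sign_gen hs
  have := hN hga
  rw [MonoidHom.mem_ker, map_mul, hg, h.sign_a] at this
  exact absurd this (by decide)

/-- If a function is constant along the edges of the even Cayley graph that avoid `1` and the
generator `s`, and takes the value `z` at the other neighbours of `1` and `s`, it is `z`
everywhere else. -/
theorem eq_of_eq_neighbours (h : IsGodanSystem ε a c t) {f : G → α} {z : α} {s : G}
    (hf : ∀ g r, ε g = 1 → r ∈ evenGens c t → g ≠ 1 → g ≠ s → g * r ≠ 1 → g * r ≠ s →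
      f g = f (g * r))
    (h1 : ∀ r ∈ evenGens c t, r ≠ s → f r = z)
    (hs : ∀ r ∈ evenGens c t, s * r ≠ 1 → f (s * r) = z) {g : G}
    (hg : g ∈ Subgroup.closure (evenGens c t)) (hg1 : g ≠ 1) (hgs : g ≠ s) : f g = z := by
  have hN : Subgroup.closure (evenGens c t) ≤ ε.ker :=
    (Subgroup.closure_le _).2 fun s hs => h.sign_gen hs
  have key : ∀ u r, u ∈ Subgroup.closure (evenGens c t) → r ∈ evenGens c t →
      (u ≠ 1 → u ≠ s → f u = z) → u * r ≠ 1 → u * r ≠ s → f (u * r) = z := by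
    intro u r hu hr hz h₁ h₂
    by_cases hu1 : u = 1
    · subst hu1
      rw [one_mul] at *
      exact h1 r hr h₂
    by_cases hus : u = s
    · subst hus
      exact hs r hr h₁
    rw [← hf u r (hN hu) hr hu1 hus h₁ h₂, hz hu1 hus]
  induction hg using Subgroup.closure_induction_right with
  | one => exact absurd rfl hg1
  | mul_right u hu r hr ih => exact key u r hu hr ih hg1 hgs
  | mul_inv_cancel u hu r hr ih => exact key u r⁻¹ hu (h.inv_gen hr) ih hg1 hgs

theorem exists_const_of_eq_c (h : IsGodanSystem ε a c t) {f : G → α}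
    (hf : ∀ g r, ε g = 1 → r ∈ evenGens c t → g ≠ 1 → g ≠ c → g * r ≠ 1 → g * r ≠ c →
      f g = f (g * r)) :
    ∃ z, ∀ g ∈ Subgroup.closure (evenGens c t), g ≠ 1 → g ≠ c → f g = z := by
  have ht : ∀ k, f c⁻¹ = f (t k) := by
    intro k
    have o1 := h.inv.orderThree_ct k
    have o2 := h.inv.orderThree_ctc k
    have o3 := h.inv.orderThree_ctct k
    have n0 : c⁻¹ ≠ c := h.orderThree_c.ne_inv.symm
    have n1 : c⁻¹ * t k ≠ c := by
      rw [Ne, inv_mul_eq_iff_eq_mul, h.orderThree_c.mul_self]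
      exact (h.orderThree_c.inv.ne_of_sq (h.t_sq k)).symm
    have n2 : c⁻¹ * t k * c⁻¹ ≠ c := by
      rw [Ne, mul_inv_eq_iff_eq_mul, inv_mul_eq_iff_eq_mul, ← pow_two, ← pow_succ', h.c_cube]
      exact h.t_ne k
    have n3 : c⁻¹ * t k * c⁻¹ * t k ≠ c := by
      rw [h.inv.ctct, inv_inv]
      simpa using h.t_ne k
    have n4 : t k ≠ c := (h.orderThree_c.ne_of_sq (h.t_sq k)).symm
    have mt := apply_mem_evenGens c t k
    have mc := inv_left_mem_evenGens c t
    have e0 := hf c⁻¹ (t k) (by simp [h.sign_c]) mt (inv_ne_one.2 h.c_ne) n0 o1.1 n1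
    have e1 := hf _ c⁻¹ (by simp [h.sign_c, h.sign_t]) mc o1.1 n1 o2.1 n2
    have e2 := hf _ (t k) (by simp [h.sign_c, h.sign_t]) mt o2.1 n2 o3.1 n3
    have e3 := hf _ c⁻¹ (by simp [h.sign_c, h.sign_t]) mc o3.1 n3
      (by rw [h.inv.ctctc]; exact h.t_ne k) (by rw [h.inv.ctctc]; exact n4)
    rw [h.inv.ctctc] at e3
    rw [e0, e1, e2, e3]
  have hct : ∀ k, f (c * t k) = f (t k) := by
    intro k
    have o1 := h.orderThree_ct k
    have o2 := h.orderThree_ctc k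
    have o3 := h.orderThree_ctct k
    have n1 : c * t k ≠ c := by simpa using h.t_ne k
    have n2 : c * t k * c ≠ c := by simpa using o1.1
    have n3 : c * t k * c * t k ≠ c := by
      rw [h.ctct, Ne, mul_inv_eq_iff_eq_mul, h.orderThree_c.mul_self]
      exact (h.orderThree_c.inv.ne_of_sq (h.t_sq k)).symm
    have n4 : t k ≠ c := (h.orderThree_c.ne_of_sq (h.t_sq k)).symm
    have mt := apply_mem_evenGens c t k
    have mc := left_mem_evenGens c t
    have e1 := hf _ c (by simp [h.sign_c, h.sign_t]) mc o1.1 n1 o2.1 n2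
    have e2 := hf _ (t k) (by simp [h.sign_c, h.sign_t]) mt o2.1 n2 o3.1 n3
    have e3 := hf _ c (by simp [h.sign_c, h.sign_t]) mc o3.1 n3
      (by rw [h.ctctc]; exact h.t_ne k) (by rw [h.ctctc]; exact n4)
    rw [h.ctctc] at e3
    rw [e1, e2, e3]
  refine ⟨f c⁻¹, fun g hg => h.eq_of_eq_neighbours hf ?_ ?_ hg⟩
  · intro r hr hrc
    obtain rfl | rfl | ⟨k, rfl⟩ := mem_evenGens.1 hr
    · exact absurd rfl hrc
    · rfl
    · exact (ht k).symm
  · intro r hr hrc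
    obtain rfl | rfl | ⟨k, rfl⟩ := mem_evenGens.1 hr
    · rw [h.orderThree_c.mul_self]
    · simp at hrc
    · rw [hct, ht]

theorem exists_const_of_eq_t (h : IsGodanSystem ε a c t) (j : K) {f : G → α}
    (hf : ∀ g r, ε g = 1 → r ∈ evenGens c t → g ≠ 1 → g ≠ t j → g * r ≠ 1 → g * r ≠ t j →
      f g = f (g * r)) :
    ∃ z, ∀ g ∈ Subgroup.closure (evenGens c t), g ≠ 1 → g ≠ t j → f g = z := by
  have mc := left_mem_evenGens c t
  have ne {g : G} (hg : OrderThree g) : g ≠ t j := hg.ne_of_sq (h.t_sq j)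
  have ne_one {g : G} (hg : g ≠ t j) : t j * g ≠ 1 := by
    rwa [Ne, mul_eq_one_iff_inv_eq, h.t_inv, eq_comm]
  have ne_t {g : G} (hg : g ≠ 1) : t j * g ≠ t j := by simpa using hg
  have oc := h.orderThree_c
  have hc : f c = f c⁻¹ := by
    have := hf c c h.sign_c mc oc.1 (ne oc)
    rw [oc.mul_self] at this
    exact this oc.inv.1 (ne oc.inv)
  have hpath : ∀ k, f c = f (c * t k * c * t k) := by
    intro k
    have o1 := h.orderThree_ct k
    have o2 := h.orderThree_ctc k
    have o3 := h.orderThree_ctct k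
    have mt := apply_mem_evenGens c t k
    rw [hf c (t k) h.sign_c mt oc.1 (ne oc) o1.1 (ne o1),
      hf _ c (by simp [h.sign_c, h.sign_t]) mc o1.1 (ne o1) o2.1 (ne o2),
      hf _ (t k) (by simp [h.sign_c, h.sign_t]) mt o2.1 (ne o2) o3.1 (ne o3)]
  have htc' : f (t j * c⁻¹) = f c := by rw [hpath j, h.ctct]
  have htc : f (t j * c) = f c := by
    have := hf (t j * c) c (by simp [h.sign_c, h.sign_t]) mc (ne_one (ne oc)) (ne_t oc.1)
    rw [mul_assoc, oc.mul_self] at this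
    rw [this (ne_one (ne oc.inv)) (ne_t oc.inv.1), htc']
  have ht : ∀ k, t k ≠ t j → f (t k) = f c := by
    intro k hk
    have o3 := h.orderThree_ctct k
    have := hf _ c (by simp [h.sign_c, h.sign_t]) mc o3.1 (ne o3)
    rw [h.ctctc] at this
    rw [hpath k, this (h.t_ne k) hk]
  have htt : ∀ k, t k ≠ t j → f (t j * t k) = f c := by
    intro k hk
    have o1 := h.orderThree_ct k
    have o2 := h.orderThree_ctc k
    have o3 := h.orderThree_ctct k
    have mt := apply_mem_evenGens c t k
    have step {u r : G} (hu : ε u = 1) (hr : r ∈ evenGens c t) (hu1 : u ≠ 1) (huj : u ≠ t j)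
        (hr1 : u * r ≠ 1) (hrj : u * r ≠ t j) : f (t j * u) = f (t j * (u * r)) := by
      rw [← mul_assoc]
      refine hf _ r (by simp [h.sign_t, hu]) hr (ne_one huj) (ne_t hu1) ?_ ?_ <;> rw [mul_assoc]
      exacts [ne_one hrj, ne_t hr1]
    have e0 := step h.sign_c mt oc.1 (ne oc) o1.1 (ne o1)
    have e1 := step (by simp [h.sign_c, h.sign_t]) mc o1.1 (ne o1) o2.1 (ne o2)
    have e2 := step (by simp [h.sign_c, h.sign_t]) mt o2.1 (ne o2) o3.1 (ne o3)
    have e3 := step (r := c) (by simp [h.sign_c, h.sign_t]) mc o3.1 (ne o3)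
    rw [h.ctctc] at e3
    rw [← htc, e0, e1, e2, e3 (h.t_ne k) hk]
  refine ⟨f c, fun g hg => h.eq_of_eq_neighbours hf ?_ ?_ hg⟩
  · intro r hr hrc
    obtain rfl | rfl | ⟨k, rfl⟩ := mem_evenGens.1 hr
    · rfl
    · exact hc.symm
    · exact ht k hrc
  · intro r hr hrc
    obtain rfl | rfl | ⟨k, rfl⟩ := mem_evenGens.1 hr
    · exact htc
    · exact htc'
    · refine htt k fun e => hrc ?_
      rw [e, h.t_sq]

/-- Deleting two adjacent vertices leaves the even Cayley graph connected. -/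
theorem exists_const (h : IsGodanSystem ε a c t) {s : G} (hs : s ∈ evenGens c t) {f : G → α}
    (hf : ∀ g r, ε g = 1 → r ∈ evenGens c t → g ≠ 1 → g ≠ s → g * r ≠ 1 → g * r ≠ s →
      f g = f (g * r)) :
    ∃ z, ∀ g ∈ Subgroup.closure (evenGens c t), g ≠ 1 → g ≠ s → f g = z := by
  obtain rfl | rfl | ⟨k, rfl⟩ := mem_evenGens.1 hs
  · exact h.exists_const_of_eq_c hf
  · rw [← evenGens_inv] at hf ⊢
    exact h.inv.exists_const_of_eq_c hf
  · exact h.exists_const_of_eq_t k hf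

/-- Every neighbour of `1` has a neighbour at distance two from `1`. -/
theorem exists_mul_notMem [Nonempty K] (h : IsGodanSystem ε a c t) {s : G}
    (hs : s ∈ evenGens c t) :
    ∃ r ∈ evenGens c t, s * r ∉ evenGens c t ∧ s * r ≠ 1 := by
  obtain ⟨k⟩ := ‹Nonempty K›
  have main {c : G} (h : IsGodanSystem ε a c t) : c * t k ∉ evenGens c t := by
    intro hm
    obtain e | e | ⟨j, e⟩ := mem_evenGens.1 hm
    · exact h.t_ne k (by simpa using e)
    · rw [← h.orderThree_c.mul_self, mul_right_inj] at e
      exact h.orderThree_c.ne_of_sq (h.t_sq k) e.symm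
    · exact (h.orderThree_ct k).ne_of_sq (h.t_sq j) e.symm
  obtain rfl | rfl | ⟨j, rfl⟩ := mem_evenGens.1 hs
  · exact ⟨t k, apply_mem_evenGens _ t k, main h, (h.orderThree_ct k).1⟩
  · refine ⟨t k, apply_mem_evenGens c t k, ?_, (h.inv.orderThree_ct k).1⟩
    rw [← evenGens_inv]
    exact main h.inv
  · have o : OrderThree (t j * c) := by
      have := (h.inv.orderThree_ct j).inv
      rwa [mul_inv_rev, inv_inv, h.t_inv] at this
    refine ⟨c, left_mem_evenGens c t, fun hm => ?_, o.1⟩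
    obtain e | e | ⟨i, e⟩ := mem_evenGens.1 hm
    · exact h.t_ne j (by simpa using e)
    · rw [← h.orderThree_c.mul_self, mul_left_inj] at e
      exact h.orderThree_c.ne_of_sq (h.t_sq j) e.symm
    · exact o.ne_of_sq (h.t_sq i) e.symm

/-- Deleting `x * a`, one of its even neighbours, and all but at least one of the even neighbours
of `x` leaves the Cayley graph connected: functions constant along its edges are constant. -/
theorem eq_of_notMem [Nonempty K] (h : IsGodanSystem ε a c t)
    (hgen : Subgroup.closure (insert a (evenGens c t)) = ⊤) {x s w : G} {B D : Set G}
    (hB : ∀ b ∈ B, ∃ r ∈ evenGens c t, b = x * r) (hs : s ∈ evenGens c t)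
    (hw : w ∈ evenGens c t) (hwB : x * w ∉ B) (hD : D = B ∪ {x * a, x * a * s}) {f : G → α}
    (hf : ∀ g r, r ∈ insert a (evenGens c t) → g ∉ D → g * r ∉ D → f g = f (g * r))
    {u v : G} (hu : u ∉ D) (hv : v ∉ D) : f u = f v := by
  have hεne : ∀ g, ε g ≠ ε (g * a) := by
    intro g e
    rw [map_mul, h.sign_a, mul_neg, mul_one] at e
    obtain e' | e' := Int.units_eq_one_or (ε g) <;> rw [e'] at e <;> exact absurd e (by decide)
  have hεor : ∀ g, ε g = ε x ∨ ε g = ε (x * a) := by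
    intro g
    rw [map_mul, h.sign_a]
    obtain e | e := Int.units_eq_one_or (ε g) <;> obtain e' | e' := Int.units_eq_one_or (ε x) <;>
      simp [e, e']
  have hBε : ∀ b ∈ B, ε b = ε x := by
    intro b hb
    obtain ⟨r, hr, rfl⟩ := hB b hb
    rw [map_mul, h.sign_gen hr, mul_one]
  have memD {g : G} : g ∈ D ↔ g ∈ B ∨ g = x * a ∨ g = x * a * s := by
    rw [hD]
    rfl
  have odd_notMem {g : G} (hg : ε g = ε (x * a)) (h1 : g ≠ x * a) (h2 : g ≠ x * a * s) :
      g ∉ D := by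
    rw [memD]
    rintro (hb | e | e)
    exacts [hεne x ((hBε g hb).symm.trans hg), h1 e, h2 e]
  have even_notMem {g : G} (hg : ε g = ε x) (hgB : g ∉ B) : g ∉ D := by
    rw [memD]
    rintro (hb | rfl | rfl)
    exacts [hgB hb, hεne x hg.symm, hεne x (by rw [← hg, map_mul _ _ s, h.sign_gen hs, mul_one])]
  obtain ⟨z, hz⟩ := h.exists_const hs (f := fun g => f (x * a * g)) (by
    intro g r hg hr h1 h2 h3 h4
    have hr' : ε (g * r) = 1 := by rw [map_mul, hg, h.sign_gen hr, mul_one]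
    rw [← mul_assoc]
    refine hf _ _ (Or.inr hr) (odd_notMem ?_ ?_ ?_) (mul_assoc (x * a) g r ▸ odd_notMem ?_ ?_ ?_)
    · rw [map_mul, hg, mul_one]
    · simpa using h1
    · simpa using h2
    · rw [map_mul, hr', mul_one]
    · simpa using h3
    · simpa using h4)
  have hodd {g : G} (hg : ε g = ε (x * a)) (h1 : g ≠ x * a) (h2 : g ≠ x * a * s) : f g = z := by
    have := hz ((x * a)⁻¹ * g) (h.mem_closure_of_sign_eq_one hgen (by
      rw [map_mul, map_inv, hg, inv_mul_cancel]))
      (by rwa [Ne, inv_mul_eq_one, eq_comm]) (by rwa [Ne, inv_mul_eq_iff_eq_mul])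
    rwa [mul_inv_cancel_left] at this
  have heven {g : G} (hg : ε g = ε x) (hgB : g ∉ B) (h1 : g ≠ x) (h2 : g * a ≠ x * a * s) :
      f g = z := by
    have hga : ε (g * a) = ε (x * a) := by rw [map_mul, map_mul, hg]
    have h1' : g * a ≠ x * a := by simpa using h1
    rw [hf g a (Set.mem_insert _ _) (even_notMem hg hgB) (odd_notMem hga h1' h2)]
    exact hodd hga h1' h2
  have hmate {g : G} (hg : ε g = ε x) (hgB : g ∉ B) (h1 : g ≠ x) : f g = z := by
    by_cases h2 : g * a = x * a * s
    · obtain ⟨r, hr, hr', hr1⟩ := h.exists_mul_notMem (h.conj_gen hs)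
      have e : g = x * (a * s * a) := by
        rw [← mul_assoc, ← mul_assoc, ← h2, mul_assoc, h.a_sq, mul_one]
      have hgr : ε (g * r) = ε x := by rw [map_mul, hg, h.sign_gen hr, mul_one]
      have hgrB : g * r ∉ B := by
        intro hb
        obtain ⟨r', hr'', e'⟩ := hB _ hb
        rw [e, mul_assoc x, mul_right_inj] at e'
        exact hr' (e' ▸ hr'')
      rw [hf g r (Or.inr hr) (even_notMem hg hgB) (even_notMem hgr hgrB)]
      refine heven hgr hgrB ?_ ?_
      · rw [e, mul_assoc x]
        simpa using hr1
      · rw [← h2]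
        simpa using h.gen_ne_one hr
    · exact heven hg hgB h1 h2
  suffices key : ∀ g, g ∉ D → f g = z by rw [key u hu, key v hv]
  intro g hg
  obtain e | e := hεor g
  · by_cases hgx : g = x
    · subst hgx
      have hgw : ε (g * w) = ε g := by rw [map_mul, h.sign_gen hw, mul_one]
      rw [hf g w (Or.inr hw) hg (even_notMem hgw hwB)]
      exact hmate hgw hwB (by simpa using h.gen_ne_one hw)
    · exact hmate e (fun hb => hg (memD.2 (Or.inl hb))) hgx
  · exact hodd e (fun h' => hg (memD.2 (Or.inr (Or.inl h'))))
      (fun h' => hg (memD.2 (Or.inr (Or.inr h'))))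

end IsGodanSystem

end GodanSystem

section Perm

open Equiv Equiv.Perm

/-- The generator `(12)(3k)`. -/
def permT (n : ℕ) (hn : 3 ≤ n) (k : {k : Fin n // 3 ≤ (k : ℕ)}) : Perm (Fin n) :=
  perm12 n hn * swap ⟨2, by omega⟩ (k : Fin n)

theorem perm123_inv (n : ℕ) (hn : 3 ≤ n) : (perm123 n hn)⁻¹ = perm132 n hn := by
  simp [perm123, perm132]

theorem perm12_mul_swap (n : ℕ) (hn : 3 ≤ n) (k : {k : Fin n // 3 ≤ (k : ℕ)}) :
    perm12 n hn * swap ⟨2, by omega⟩ (k : Fin n) =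
      swap ⟨2, by omega⟩ (k : Fin n) * perm12 n hn := by
  obtain ⟨k, hk⟩ := k
  rw [perm12, mul_swap_eq_swap_mul]
  congr 2
  apply swap_apply_of_ne_of_ne <;> simp only [Ne, Fin.ext_iff] <;> omega

theorem IsThreeCycle.pow_three {β : Type*} [Fintype β] [DecidableEq β] {σ : Perm β}
    (h : σ.IsThreeCycle) : σ ^ 3 = 1 := by
  rw [← h.orderOf, pow_orderOf_eq_one]

theorem isThreeCycle_perm123 (n : ℕ) (hn : 3 ≤ n) : (perm123 n hn).IsThreeCycle :=
  isThreeCycle_swap_mul_swap_same (by simp) (by simp) (by simp)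

theorem permT_apply_two (n : ℕ) (hn : 3 ≤ n) (k : {k : Fin n // 3 ≤ (k : ℕ)}) :
    permT n hn k ⟨2, by omega⟩ = k := by
  obtain ⟨k, hk⟩ := k
  rw [permT, Perm.mul_apply, swap_apply_left, perm12]
  apply swap_apply_of_ne_of_ne <;> simp only [Ne, Fin.ext_iff] <;> omega

theorem isGodanSystem_perm (n : ℕ) (hn : 3 ≤ n) :
    IsGodanSystem Perm.sign (perm12 n hn) (perm123 n hn) (permT n hn) where
  a_sq := swap_mul_self _ _
  c_cube := IsThreeCycle.pow_three (isThreeCycle_perm123 n hn)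
  t_sq k := by
    rw [permT, mul_assoc, perm12_mul_swap, ← mul_assoc (swap _ _), swap_mul_self, one_mul]
    exact swap_mul_self _ _
  ct_cube k := by
    obtain ⟨k, hk⟩ := k
    apply IsThreeCycle.pow_three
    rw [permT, perm123, perm12, mul_assoc, swap_mul_self_mul, swap_comm]
    apply isThreeCycle_swap_mul_swap_same <;> simp only [Ne, Fin.ext_iff] <;> omega
  a_c := by simp [perm12, perm123, mul_assoc]
  a_t k := by
    rw [permT, mul_assoc, mul_assoc, ← perm12_mul_swap]
    exact swap_mul_self_mul _ _ _
  c_ne h := by simpa [h] using (isThreeCycle_perm123 n hn).orderOf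
  t_ne k h := by
    have := permT_apply_two n hn k
    obtain ⟨k, hk⟩ := k
    simp only [h, Perm.one_apply, Fin.ext_iff] at this
    omega
  sign_a := sign_swap (by simp)
  sign_c := (isThreeCycle_perm123 n hn).sign
  sign_t k := by
    obtain ⟨k, hk⟩ := k
    rw [permT, perm12, map_mul, sign_swap (by simp), sign_swap]
    · rfl
    · simp only [Ne, Fin.ext_iff]
      omega

theorem OmegaStar_eq (n : ℕ) (hn : 3 ≤ n) :
    OmegaStar n hn = insert (perm12 n hn) (evenGens (perm123 n hn) (permT n hn)) := by
  ext s
  have e : (∃ k, permT n hn k = s) ↔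
      ∃ k : Fin n, 3 ≤ (k : ℕ) ∧ s = perm12 n hn * Equiv.swap ⟨2, by omega⟩ k :=
    ⟨fun ⟨k, hk⟩ => ⟨k, k.2, hk.symm⟩, fun ⟨k, hk, hs⟩ => ⟨⟨k, hk⟩, hs.symm⟩⟩
  rw [Set.mem_insert_iff, mem_evenGens, e, perm123_inv, ← or_assoc, ← or_assoc, OmegaStar,
    or_assoc (a := s = _)]
  rfl

theorem godanGraph_adj_iff (n : ℕ) (hn : 3 ≤ n) (u v : Perm (Fin n)) :
    (godanGraph n hn).Adj u v ↔
      ∃ s ∈ insert (perm12 n hn) (evenGens (perm123 n hn) (permT n hn)), v = u * s := by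
  have h := isGodanSystem_perm n hn
  have inv_mem {s : Perm (Fin n)}
      (hs : s ∈ insert (perm12 n hn) (evenGens (perm123 n hn) (permT n hn))) :
      s⁻¹ ∈ insert (perm12 n hn) (evenGens (perm123 n hn) (permT n hn)) := by
    obtain rfl | hs := hs
    · rw [inv_eq_of_mul_eq_one_left h.a_sq]
      exact Set.mem_insert _ _
    · exact Or.inr (h.inv_gen hs)
  rw [godanGraph, SimpleGraph.fromRel_adj, OmegaStar_eq]
  constructor
  · rintro ⟨-, ⟨s, hs, rfl⟩ | hs⟩
    · exact ⟨s⁻¹, inv_mem hs, by simp⟩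
    · exact hs
  · rintro ⟨s, hs, rfl⟩
    refine ⟨?_, Or.inr ⟨s, hs, rfl⟩⟩
    rw [Ne, left_eq_mul]
    obtain rfl | hs := hs
    · intro e
      have := h.sign_a
      rw [e, map_one] at this
      exact absurd this (by decide)
    · exact h.gen_ne_one hs

theorem closure_gens_eq_top (n : ℕ) (hn : 3 ≤ n) :
    Subgroup.closure (insert (perm12 n hn) (evenGens (perm123 n hn) (permT n hn))) = ⊤ := by
  set H := Subgroup.closure (insert (perm12 n hn) (evenGens (perm123 n hn) (permT n hn)))
  have ha : perm12 n hn ∈ H := Subgroup.subset_closure (Set.mem_insert _ _)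
  have hc : perm123 n hn ∈ H := Subgroup.subset_closure (Or.inr (left_mem_evenGens _ _))
  have ht (k) : permT n hn k ∈ H := Subgroup.subset_closure (Or.inr (apply_mem_evenGens _ _ k))
  have h0 : swap (⟨2, by omega⟩ : Fin n) ⟨0, by omega⟩ ∈ H := by
    have := H.mul_mem hc ha
    rwa [perm123, perm12, mul_assoc, swap_mul_self, mul_one, swap_comm] at this
  have h1 : swap (⟨2, by omega⟩ : Fin n) ⟨1, by omega⟩ ∈ H := by
    have := H.mul_mem (H.mul_mem ha h0) ha
    rwa [perm12, mul_swap_eq_swap_mul _ (⟨2, by omega⟩ : Fin n), mul_assoc, swap_mul_self, mul_one,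
      swap_apply_left, swap_apply_of_ne_of_ne (by simp) (by simp)] at this
  have hstar (k : Fin n) : swap ⟨2, by omega⟩ k ∈ H := by
    by_cases hk : 3 ≤ (k : ℕ)
    · have := H.mul_mem ha (ht ⟨k, hk⟩)
      rwa [permT, perm12, swap_mul_self_mul] at this
    · obtain ⟨k, hk'⟩ := k
      obtain rfl | rfl | rfl : k = 0 ∨ k = 1 ∨ k = 2 := by simp at hk; omega
      · exact h0
      · exact h1
      · rw [swap_self]
        exact H.one_mem
  rw [eq_top_iff, ← closure_isSwap, Subgroup.closure_le]
  rintro _ ⟨i, j, hij, rfl⟩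
  exact SubmonoidClass.swap_mem_trans H (by rw [swap_comm]; exact hstar i) (hstar j)

theorem exists_evenGens_apply_two (n : ℕ) (hn : 3 ≤ n) {k : Fin n} (hk : k ≠ ⟨2, by omega⟩) :
    ∃ r ∈ evenGens (perm123 n hn) (permT n hn), r ⟨2, by omega⟩ = k := by
  by_cases hk3 : 3 ≤ (k : ℕ)
  · exact ⟨_, apply_mem_evenGens _ _ ⟨k, hk3⟩, permT_apply_two n hn ⟨k, hk3⟩⟩
  · obtain ⟨k, hk'⟩ := k
    simp only [Ne, Fin.ext_iff] at hk hk3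
    obtain rfl | rfl : k = 0 ∨ k = 1 := by omega
    · exact ⟨_, left_mem_evenGens _ _, by simp [perm123, swap_apply_def]⟩
    · refine ⟨_, inv_left_mem_evenGens _ _, ?_⟩
      rw [perm123_inv]
      simp [perm132]

theorem exists_evenGens_mul_notMem (n : ℕ) (hn : 3 ≤ n) (x : Perm (Fin n))
    {B : Finset (Perm (Fin n))} (hB : B.card = n - 2) :
    ∃ w ∈ evenGens (perm123 n hn) (permT n hn), x * w ∉ B := by
  by_contra! hall
  have hsub : Finset.univ.erase (⟨2, by omega⟩ : Fin n) ⊆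
      B.image fun b => (x⁻¹ * b) ⟨2, by omega⟩ := by
    intro k hk
    obtain ⟨r, hr, rfl⟩ := exists_evenGens_apply_two n hn (Finset.ne_of_mem_erase hk)
    exact Finset.mem_image.2 ⟨x * r, hall r hr, by simp⟩
  have := (Finset.card_le_card hsub).trans Finset.card_image_le
  rw [Finset.card_erase_of_mem (Finset.mem_univ _), Finset.card_univ, Fintype.card_fin] at this
  omega

end Perm

/-- Let n ≥ 4, x a vertex of EA_n, B₁ a set of n − 2 neighbours of x other than
the parity neighbour x̃ = x∘(12), and v a neighbour of x̃ with v ≠ x. Then deleting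
B = B₁ ∪ {x̃, v} from EA_n leaves a connected graph. -/
theorem delete_connected (n : ℕ) (hn : 4 ≤ n) (x v : Equiv.Perm (Fin n))
    (B₁ : Finset (Equiv.Perm (Fin n)))
    (hB₁adj : ∀ b ∈ B₁, (godanGraph n (by omega)).Adj x b)
    (hB₁card : B₁.card = n - 2)
    (hB₁tilde : x * perm12 n (by omega) ∉ B₁)
    (hv : (godanGraph n (by omega)).Adj (x * perm12 n (by omega)) v)
    (hvx : v ≠ x) :
    ((godanGraph n (by omega)).induce
      ((↑B₁ ∪ {x * perm12 n (by omega), v} : Set (Equiv.Perm (Fin n)))ᶜ)).Connected := by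
  have hn3 : 3 ≤ n := by omega
  have h := isGodanSystem_perm n hn3
  have : Nonempty {k : Fin n // 3 ≤ (k : ℕ)} := ⟨⟨⟨3, by omega⟩, le_rfl⟩⟩
  obtain ⟨w, hw, hwB⟩ := exists_evenGens_mul_notMem n hn3 x hB₁card
  have hB : ∀ b ∈ (B₁ : Set (Equiv.Perm (Fin n))),
      ∃ r ∈ evenGens (perm123 n hn3) (permT n hn3), b = x * r := by
    intro b hb
    obtain ⟨r, rfl | hr, rfl⟩ := (godanGraph_adj_iff n hn3 x b).1 (hB₁adj b hb)
    · exact absurd hb hB₁tilde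
    · exact ⟨r, hr, rfl⟩
  obtain ⟨s, hs, rfl⟩ : ∃ s ∈ evenGens (perm123 n hn3) (permT n hn3),
      v = x * perm12 n hn3 * s := by
    obtain ⟨s, rfl | hs, rfl⟩ := (godanGraph_adj_iff n hn3 _ v).1 hv
    · rw [mul_assoc, h.a_sq, mul_one] at hvx
      exact absurd rfl hvx
    · exact ⟨s, hs, rfl⟩
  set D : Set (Equiv.Perm (Fin n)) := ↑B₁ ∪ {x * perm12 n hn3, x * perm12 n hn3 * s} with hD
  have hconst {α : Type} {f : Equiv.Perm (Fin n) → α} := h.eq_of_notMem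
    (closure_gens_eq_top n hn3) hB hs hw hwB hD (f := f)
  have hwD : x * w ∉ D := by
    have hsign : Equiv.Perm.sign (x * w) ≠ Equiv.Perm.sign (x * perm12 n hn3) := by
      rw [map_mul, map_mul, h.sign_gen hw, h.sign_a, Ne, mul_right_inj]
      decide
    rintro (hb | e | e)
    · exact hwB hb
    · exact hsign (by rw [e])
    · exact hsign (by rw [e, map_mul _ _ s, h.sign_gen hs, mul_one])
  classical
  let G := (godanGraph n hn3).induce Dᶜ
  let f : Equiv.Perm (Fin n) → Option G.ConnectedComponent := fun g =>
    if hg : g ∈ Dᶜ then some (G.connectedComponentMk ⟨g, hg⟩) else none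
  have hf : ∀ g r, r ∈ insert (perm12 n hn3) (evenGens (perm123 n hn3) (permT n hn3)) →
      g ∉ D → g * r ∉ D → f g = f (g * r) := by
    intro g r hr hg hgr
    have hadj : G.Adj ⟨g, hg⟩ ⟨g * r, hgr⟩ := (godanGraph_adj_iff n hn3 _ _).2 ⟨r, hr, rfl⟩
    simp only [f, Set.mem_compl_iff, hg, hgr, not_false_eq_true, dite_true, Option.some_inj]
    exact SimpleGraph.ConnectedComponent.sound hadj.reachable
  refine (SimpleGraph.connected_iff _).2 ⟨fun u v => ?_, ⟨⟨x * w, hwD⟩⟩⟩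
  have := hconst hf u.2 v.2
  have hu := u.2
  have hv := v.2
  simp only [f, hu, hv, dite_true, Option.some_inj] at this
  exact SimpleGraph.ConnectedComponent.exact this

end Godan
end

section
/- Let n ≥ 4 and let i, j be distinct elements of {1,…,n}. Then the number of edges of the godan graph EA_n having one endpoint in the cluster EA_n^{n:i} and the other endpoint in the cluster EA_n^{n:j} equals (n−2)!. -/
namespace Godan

/-- The position of the n-th (last) symbol, as an index of `Fin n`. -/
def lastPos (n : ℕ) (hn : 3 ≤ n) : Fin n := ⟨n - 1, by omega⟩

/-- The permutation (12)(3n), giving the out neighbour x' = x ∘ (12)(3n). -/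
def outPerm (n : ℕ) (hn : 4 ≤ n) : Equiv.Perm (Fin n) :=
  perm12 n (by omega) * Equiv.swap ⟨2, by omega⟩ ⟨n - 1, by omega⟩

/-- Any two distinct points can be moved to any two distinct points by a permutation. -/
theorem exists_perm_apply_eq_and_apply_eq {α : Type*} [DecidableEq α] {a b i j : α}
    (hab : a ≠ b) (hij : i ≠ j) : ∃ τ : Equiv.Perm α, τ a = i ∧ τ b = j := by
  refine ⟨Equiv.swap (Equiv.swap a i b) j * Equiv.swap a i, ?_, by simp⟩
  have hi : i ≠ Equiv.swap a i b := fun h =>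
    hab ((Equiv.swap a i).injective (by simpa using h))
  simp [Equiv.swap_apply_of_ne_of_ne hi hij]

theorem ncard_perm_fixing_pair {α : Type*} [Fintype α] [DecidableEq α] {a b : α}
    (hab : a ≠ b) :
    {σ : Equiv.Perm α | σ a = a ∧ σ b = b}.ncard = (Fintype.card α - 2).factorial := by
  have hset : {σ : Equiv.Perm α | σ a = a ∧ σ b = b} =
      {σ | ∀ x, ¬ (x ∉ ({a, b} : Finset α)) → σ x = x} := by
    ext σ
    simp only [Set.mem_ofPred_eq, not_not, Finset.mem_insert, Finset.mem_singleton,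
      forall_eq_or_imp, forall_eq]
  rw [hset, ← Nat.card_coe_set_eq]
  refine (Nat.card_congr
    (Equiv.Perm.subtypeEquivSubtypePerm (fun x => x ∉ ({a, b} : Finset α)))).symm.trans ?_
  rw [Nat.card_perm, Nat.card_eq_fintype_card, Fintype.card_subtype_compl,
    Fintype.card_coe, Finset.card_pair hab]

theorem ncard_perm_apply_eq_and_apply_eq {α : Type*} [Fintype α] [DecidableEq α] {a b i j : α}
    (hab : a ≠ b) (hij : i ≠ j) :
    {σ : Equiv.Perm α | σ a = i ∧ σ b = j}.ncard = (Fintype.card α - 2).factorial := by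
  obtain ⟨τ, rfl, rfl⟩ := exists_perm_apply_eq_and_apply_eq hab hij
  rw [← ncard_perm_fixing_pair hab,
    ← Set.ncard_image_of_injective {σ : Equiv.Perm α | σ a = a ∧ σ b = b} (mul_right_injective τ)]
  congr 1
  ext σ
  constructor
  · rintro ⟨ha, hb⟩
    exact ⟨τ⁻¹ * σ, ⟨by simp [ha], by simp [hb]⟩, by simp⟩
  · rintro ⟨ρ, ⟨ha, hb⟩, rfl⟩
    simp [ha, hb]

theorem eq_outPerm_of_mem_OmegaStar (n : ℕ) (hn : 4 ≤ n) {s : Equiv.Perm (Fin n)}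
    (hs : s ∈ OmegaStar n (by omega))
    (hmove : s (lastPos n (by omega)) ≠ lastPos n (by omega)) : s = outPerm n hn := by
  have h0 : lastPos n (by omega) ≠ ⟨0, by omega⟩ := by simp [lastPos]; omega
  have h1 : lastPos n (by omega) ≠ ⟨1, by omega⟩ := by simp [lastPos]; omega
  have h2 : lastPos n (by omega) ≠ ⟨2, by omega⟩ := by simp [lastPos]; omega
  rcases hs with (rfl | rfl | rfl) | ⟨k, -, rfl⟩
  · exact absurd (by simp [perm12, Equiv.swap_apply_of_ne_of_ne, *]) hmove
  · exact absurd (by simp [perm123, Equiv.swap_apply_of_ne_of_ne, *]) hmove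
  · exact absurd (by simp [perm132, Equiv.swap_apply_of_ne_of_ne, *]) hmove
  · by_cases hk : lastPos n (by omega) = k
    · subst hk
      rfl
    · exact absurd (by simp [perm12, Equiv.swap_apply_of_ne_of_ne, *]) hmove

theorem outPerm_mem_OmegaStar (n : ℕ) (hn : 4 ≤ n) :
    outPerm n hn ∈ OmegaStar n (by omega) :=
  Or.inr ⟨⟨n - 1, by omega⟩, by simp only; omega, rfl⟩

theorem outPerm_mul_self (n : ℕ) (hn : 4 ≤ n) : outPerm n hn * outPerm n hn = 1 := by
  have hd : Commute (perm12 n (by omega)) (Equiv.swap ⟨2, by omega⟩ ⟨n - 1, by omega⟩) := by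
    refine Equiv.Perm.Disjoint.commute fun x => ?_
    rw [or_iff_not_imp_right]
    intro hx
    have hx' : x = ⟨2, by omega⟩ ∨ x = ⟨n - 1, by omega⟩ := by
      by_contra! h
      exact hx (Equiv.swap_apply_of_ne_of_ne h.1 h.2)
    apply Equiv.swap_apply_of_ne_of_ne <;> rcases hx' with rfl | rfl <;>
      simp only [ne_eq, Fin.mk.injEq] <;> omega
  rw [outPerm, hd.symm.mul_mul_mul_comm, perm12, Equiv.swap_mul_self, Equiv.swap_mul_self, one_mul]

theorem outPerm_lastPos (n : ℕ) (hn : 4 ≤ n) :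
    outPerm n hn (lastPos n (by omega)) = ⟨2, by omega⟩ := by
  simp [outPerm, perm12, lastPos, Equiv.swap_apply_of_ne_of_ne]

/-- Adjacent vertices in different clusters at the last position are out-neighbours. -/
theorem adj_iff_eq_mul_outPerm (n : ℕ) (hn : 4 ≤ n) {u v : Equiv.Perm (Fin n)}
    (huv : u (lastPos n (by omega)) ≠ v (lastPos n (by omega))) :
    (godanGraph n (by omega)).Adj u v ↔ v = u * outPerm n hn := by
  rw [godanGraph, SimpleGraph.fromRel_adj]
  constructor
  · rintro ⟨-, ⟨s, hs, rfl⟩ | ⟨s, hs, rfl⟩⟩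
    · rw [eq_outPerm_of_mem_OmegaStar n hn hs fun h => huv (by simp [h]), mul_assoc,
        outPerm_mul_self, mul_one]
    · rw [eq_outPerm_of_mem_OmegaStar n hn hs fun h => huv (by simp [h])]
  · rintro rfl
    exact ⟨fun h => huv (by rw [← h]), Or.inr ⟨_, outPerm_mem_OmegaStar n hn, rfl⟩⟩

/-- Let n ≥ 4 and i ≠ j (symbols are represented 0-based, so `i : Fin n` stands
for the symbol i+1). The number of edges of EA_n between the clusters EA_n^{n:i}
and EA_n^{n:j} equals (n−2)!. Since i ≠ j, each such edge corresponds to exactly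
one ordered pair (u, v) with u in cluster i and v in cluster j. -/
theorem edges_between_clusters (n : ℕ) (hn : 4 ≤ n) (i j : Fin n) (hij : i ≠ j) :
    Set.ncard {p : Equiv.Perm (Fin n) × Equiv.Perm (Fin n) |
        (godanGraph n (by omega)).Adj p.1 p.2 ∧
        p.1 (lastPos n (by omega)) = i ∧ p.2 (lastPos n (by omega)) = j} =
      Nat.factorial (n - 2) := by
  have hset : {p : Equiv.Perm (Fin n) × Equiv.Perm (Fin n) |
        (godanGraph n (by omega)).Adj p.1 p.2 ∧
        p.1 (lastPos n (by omega)) = i ∧ p.2 (lastPos n (by omega)) = j} =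
      (fun u => (u, u * outPerm n hn)) ''
        {u | u (lastPos n (by omega)) = i ∧ u ⟨2, by omega⟩ = j} := by
    ext ⟨u, v⟩
    constructor
    · rintro ⟨hadj, rfl, rfl⟩
      obtain rfl : v = u * outPerm n hn := (adj_iff_eq_mul_outPerm n hn hij).1 hadj
      exact ⟨u, ⟨rfl, by simp [outPerm_lastPos]⟩, rfl⟩
    · rintro ⟨w, ⟨rfl, rfl⟩, h⟩
      obtain ⟨rfl, rfl⟩ := Prod.mk.inj h
      have hlast : (w * outPerm n hn) (lastPos n (by omega)) = w ⟨2, by omega⟩ := by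
        simp [outPerm_lastPos]
      exact ⟨(adj_iff_eq_mul_outPerm n hn (hlast ▸ hij)).2 rfl, rfl, hlast⟩
  have hpos : lastPos n (by omega) ≠ ⟨2, by omega⟩ := by
    simp only [lastPos, ne_eq, Fin.mk.injEq]
    omega
  rw [hset, Set.ncard_image_of_injective _ fun _ _ h => congrArg Prod.fst h,
    ncard_perm_apply_eq_and_apply_eq hpos hij, Fintype.card_fin]

end Godan
end
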